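/- There exist constants c, c₄, c₅ > 0 such that for every prime p and all integers L, N with 0 < L+1 < L+N < p and c₅·√p·(log p)² ≤ N ≤ c₄·p^(4/5)·(log p)^(4/5), one has |A_N / A_N| ≥ c·N·Q^(1/3), where Q = N/(√p·(log p)²) (as a real number). -/

import Mathlib

/-- For a prime `p` and integers `L, N`, `A_N = {n! mod p : L+1 ≤ n ≤ L+N} ⊆ ZMod p`. -/
def intervalFactorials (p L N : ℕ) : Finset (ZMod p) :=
  (Finset.Icc (L + 1) (L + N)).image (fun n => (n.factorial : ZMod p))

/-- The ratio set `A_N / A_N = {a·b⁻¹ : a, b ∈ A_N}`. -/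
def intervalFactorialsRatio (p L N : ℕ) : Finset (ZMod p) :=
  Finset.image₂ (fun a b => a * b⁻¹) (intervalFactorials p L N) (intervalFactorials p L N)

set_option linter.unusedSectionVars false

open Polynomial
open scoped nonZeroDivisors

/-- A `ℤ`-indexed multiplicative increasing filtration of a `k`-algebra. -/
structure RingFilt (k B : Type*) [Field k] [CommRing B] [Algebra k B] where
  F : ℤ → Submodule k B
  mono : ∀ {a b}, a ≤ b → F a ≤ F b
  mul_mem : ∀ {a b x y}, x ∈ F a → y ∈ F b → x * y ∈ F (a + b)
  one_mem : (1 : B) ∈ F 0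

lemma Polynomial.eq_sum_fin_of_degree_lt {B : Type*} [CommRing B] {g : B[X]} {n : ℕ}
    (h : g.degree < n) : g = ∑ i : Fin n, C (g.coeff i) * X ^ (i : ℕ) := by
  rw [Fin.sum_univ_eq_sum_range (fun i => C (g.coeff i) * X ^ i) n]
  ext i
  simp only [finsetSum_coeff, coeff_C_mul, coeff_X_pow, mul_ite, mul_one, mul_zero,
    Finset.sum_ite_eq, Finset.mem_range]
  split_ifs with hi
  · rfl
  · exact coeff_eq_zero_of_degree_lt (h.trans_le (by exact_mod_cast not_lt.1 hi))

namespace RingFilt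

variable {k B : Type*} [Field k] [CommRing B] [Algebra k B]

lemma prod_mem (S : RingFilt k B) {ι : Type*} (s : Finset ι) (f : ι → B) (n : ι → ℤ)
    (h : ∀ i ∈ s, f i ∈ S.F (n i)) : ∏ i ∈ s, f i ∈ S.F (∑ i ∈ s, n i) := by
  classical
  induction s using Finset.induction_on with
  | empty => simpa using S.one_mem
  | insert a s ha ih =>
    rw [Finset.prod_insert ha, Finset.sum_insert ha]
    exact S.mul_mem (h _ (Finset.mem_insert_self _ _))
      (ih fun i hi => h i (Finset.mem_insert_of_mem hi))

lemma pow_mem (S : RingFilt k B) {x : B} {n : ℤ} (h : x ∈ S.F n) (r : ℕ) :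
    x ^ r ∈ S.F (r * n) := by
  simpa using S.prod_mem (Finset.range r) (fun _ => x) (fun _ => n) (fun _ _ => h)

/-- The weighted filtration on polynomials where the variable has weight `δ`. -/
def poly (S : RingFilt k B) (δ : ℤ) : RingFilt k B[X] where
  F n :=
    { carrier := {g | ∀ i : ℕ, g.coeff i ∈ S.F (n - δ * i)}
      add_mem' := fun hx hy i => by rw [coeff_add]; exact add_mem (hx i) (hy i)
      zero_mem' := fun i => by simp
      smul_mem' := fun c x hx i => by rw [coeff_smul]; exact Submodule.smul_mem _ _ (hx i) }
  mono hab x hx i := S.mono (by linarith) (hx i)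
  mul_mem {a b x y} hx hy i := by
    rw [coeff_mul]
    refine Submodule.sum_mem _ fun c hc => ?_
    have := S.mul_mem (hx c.1) (hy c.2)
    rw [Finset.HasAntidiagonal.mem_antidiagonal] at hc
    convert this using 2
    rw [← hc]; push_cast; ring
  one_mem i := by
    rw [coeff_one]
    split_ifs with h
    · subst h; simpa using S.one_mem
    · simp

lemma mem_poly {S : RingFilt k B} {δ n : ℤ} {g : B[X]} :
    g ∈ (S.poly δ).F n ↔ ∀ i : ℕ, g.coeff i ∈ S.F (n - δ * i) := Iff.rfl

lemma C_mem_poly {S : RingFilt k B} {δ n : ℤ} {b : B} (hb : b ∈ S.F n) :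
    C b ∈ (S.poly δ).F n := by
  intro i
  rw [coeff_C]
  split_ifs with h
  · subst h; simpa using hb
  · simp

lemma X_mem_poly (S : RingFilt k B) (δ : ℤ) : (X : B[X]) ∈ (S.poly δ).F δ := by
  intro i
  rw [coeff_X]
  split_ifs with h
  · subst h; simpa using S.one_mem
  · simp

/-- Reduction modulo a monic polynomial of the expected weight preserves the filtration. -/
lemma modByMonic_mem [Nontrivial B] {S : RingFilt k B} {δ n : ℤ} {Φ : B[X]} (hm : Φ.Monic)
    (hΦ : Φ ∈ (S.poly δ).F (δ * Φ.natDegree)) {g : B[X]} (hg : g ∈ (S.poly δ).F n) :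
    g %ₘ Φ ∈ (S.poly δ).F n := by
  induction hd : g.natDegree using Nat.strong_induction_on generalizing g with
  | _ d ih =>
  by_cases h : g.degree < Φ.degree
  · rwa [(modByMonic_eq_self_iff hm).2 h]
  rcases eq_or_ne g 0 with rfl | hg0
  · simp
  push Not at h
  have hle : Φ.natDegree ≤ g.natDegree := natDegree_le_natDegree h
  set q : B[X] := C g.leadingCoeff * X ^ (g.natDegree - Φ.natDegree) with hq
  have hqm : q ∈ (S.poly δ).F (n - δ * Φ.natDegree) := by
    have h1 := hg g.natDegree
    have h2 := (S.poly δ).mul_mem (C_mem_poly (δ := δ) h1)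
      ((S.poly δ).pow_mem (S.X_mem_poly δ) (g.natDegree - Φ.natDegree))
    rw [hq, leadingCoeff]
    convert h2 using 2
    push_cast [Nat.cast_sub hle]; ring
  have hsub : g - Φ * q ∈ (S.poly δ).F n := by
    refine sub_mem hg ?_
    have := (S.poly δ).mul_mem hΦ hqm
    convert this using 2; ring
  have hmod : g %ₘ Φ = (g - Φ * q) %ₘ Φ := by
    rw [sub_modByMonic, self_mul_modByMonic hm, sub_zero]
  rw [hmod]
  by_cases hz : g - Φ * q = 0
  · simp [hz]
  have hdeg : (g - Φ * q).degree < g.degree := by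
    exact div_wf_lemma ⟨h, hg0⟩ hm
  exact ih _ (hd ▸ natDegree_lt_natDegree hz hdeg) hsub rfl

/-- The induced filtration on `B[X]/(Φ)`. -/
noncomputable def adj (S : RingFilt k B) (δ : ℤ) (Φ : B[X]) : RingFilt k (AdjoinRoot Φ) where
  F n := ((S.poly δ).F n).map (Ideal.Quotient.mkₐ k (Ideal.span {Φ})).toLinearMap
  mono hab := Submodule.map_mono ((S.poly δ).mono hab)
  mul_mem := by
    rintro a b _ _ ⟨x, hx, rfl⟩ ⟨y, hy, rfl⟩
    exact ⟨x * y, (S.poly δ).mul_mem hx hy, map_mul (Ideal.Quotient.mkₐ k (Ideal.span {Φ})) x y⟩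
  one_mem := ⟨1, (S.poly δ).one_mem, map_one (Ideal.Quotient.mkₐ k (Ideal.span {Φ}))⟩

lemma mem_adj {S : RingFilt k B} {δ n : ℤ} {Φ : B[X]} {x : AdjoinRoot Φ} :
    x ∈ (S.adj δ Φ).F n ↔ ∃ g ∈ (S.poly δ).F n, AdjoinRoot.mk Φ g = x := Iff.rfl

lemma mk_mem_adj {S : RingFilt k B} {δ n : ℤ} {Φ : B[X]} {g : B[X]} (hg : g ∈ (S.poly δ).F n) :
    AdjoinRoot.mk Φ g ∈ (S.adj δ Φ).F n := ⟨g, hg, rfl⟩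

lemma of_mem_adj {S : RingFilt k B} {δ n : ℤ} {Φ : B[X]} {b : B} (hb : b ∈ S.F n) :
    AdjoinRoot.of Φ b ∈ (S.adj δ Φ).F n := mk_mem_adj (C_mem_poly hb)

lemma root_mem_adj (S : RingFilt k B) (δ : ℤ) (Φ : B[X]) :
    AdjoinRoot.root Φ ∈ (S.adj δ Φ).F δ := mk_mem_adj (S.X_mem_poly δ)

lemma exists_rep [Nontrivial B] {S : RingFilt k B} {δ n : ℤ} {Φ : B[X]} (hm : Φ.Monic)
    (hΦ : Φ ∈ (S.poly δ).F (δ * Φ.natDegree)) {x : AdjoinRoot Φ} (hx : x ∈ (S.adj δ Φ).F n) :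
    ∃ g ∈ (S.poly δ).F n, g.degree < Φ.degree ∧ AdjoinRoot.mk Φ g = x := by
  obtain ⟨g, hg, rfl⟩ := mem_adj.1 hx
  refine ⟨g %ₘ Φ, modByMonic_mem hm hΦ hg, degree_modByMonic_lt _ hm, ?_⟩
  conv_rhs => rw [← modByMonic_add_div g Φ]
  simp

lemma finrank_adj_le [Nontrivial B] {S : RingFilt k B} {δ n : ℤ} (hδ : 0 ≤ δ) {Φ : B[X]}
    (hm : Φ.Monic) (hΦ : Φ ∈ (S.poly δ).F (δ * Φ.natDegree)) [FiniteDimensional k (S.F n)] :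
    FiniteDimensional k ((S.adj δ Φ).F n) ∧
      Module.finrank k ((S.adj δ Φ).F n) ≤ Φ.natDegree * Module.finrank k (S.F n) := by
  let f : (Fin Φ.natDegree → S.F n) →ₗ[k] AdjoinRoot Φ :=
    ∑ j : Fin Φ.natDegree, (LinearMap.mulRight k (AdjoinRoot.root Φ ^ (j : ℕ))) ∘ₗ
      (Algebra.ofId B (AdjoinRoot Φ)).toLinearMap.restrictScalars k ∘ₗ (S.F n).subtype ∘ₗ
        LinearMap.proj j
  have hle : (S.adj δ Φ).F n ≤ LinearMap.range f := by
    intro x hx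
    obtain ⟨g, hg, hdeg, rfl⟩ := exists_rep hm hΦ hx
    have hc : ∀ i, g.coeff i ∈ S.F n := fun i => S.mono (by nlinarith) (hg i)
    refine ⟨fun j => ⟨g.coeff j, hc j⟩, ?_⟩
    rw [degree_eq_natDegree hm.ne_zero] at hdeg
    conv_rhs => rw [eq_sum_fin_of_degree_lt hdeg]
    simp only [f, LinearMap.sum_apply, LinearMap.comp_apply, LinearMap.proj_apply,
      Submodule.subtype_apply, LinearMap.mulRight_apply, map_sum, map_mul, map_pow,
      AdjoinRoot.mk_C, AdjoinRoot.mk_X]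
    rfl
  have hfin : FiniteDimensional k (LinearMap.range f) := inferInstance
  refine ⟨Submodule.finiteDimensional_of_le hle, (Submodule.finrank_mono hle).trans ?_⟩
  refine (LinearMap.finrank_range_le f).trans ?_
  simp [Module.finrank_pi_fintype]

/-- The degree filtration on `k[X]`. -/
def deg (k : Type*) [Field k] : RingFilt k k[X] where
  F n :=
    { carrier := {g | ∀ i : ℕ, n < i → g.coeff i = 0}
      add_mem' := fun hx hy i hi => by rw [coeff_add, hx i hi, hy i hi, add_zero]
      zero_mem' := fun i _ => by simp
      smul_mem' := fun c x hx i hi => by rw [coeff_smul, hx i hi, smul_zero] }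
  mono hab x hx i hi := hx i (by linarith)
  mul_mem {a b x y} hx hy i hi := by
    rw [coeff_mul]
    refine Finset.sum_eq_zero fun c hc => ?_
    rw [Finset.HasAntidiagonal.mem_antidiagonal] at hc
    have : (c.1 : ℤ) + c.2 = i := by exact_mod_cast hc
    rcases lt_or_ge a c.1 with h | h
    · rw [hx _ h, zero_mul]
    · rw [hy c.2 (by linarith), mul_zero]
  one_mem i hi := by
    rw [coeff_one, if_neg]
    rintro rfl
    simp at hi

lemma mem_deg {k : Type*} [Field k] {n : ℤ} {g : k[X]} :
    g ∈ (deg k).F n ↔ ∀ i : ℕ, n < i → g.coeff i = 0 := Iff.rfl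

lemma mem_deg_natCast {k : Type*} [Field k] {n : ℕ} {g : k[X]} :
    g ∈ (deg k).F n ↔ g.natDegree ≤ n := by
  rw [mem_deg, natDegree_le_iff_coeff_eq_zero]
  simp

lemma eq_zero_of_mem_deg {k : Type*} [Field k] {n : ℤ} {g : k[X]} (hg : g ∈ (deg k).F n)
    (hn : n < 0) : g = 0 := by
  ext i; simpa using hg i (by omega)

lemma natDegree_le_of_mem_deg {k : Type*} [Field k] {n : ℤ} {g : k[X]} (hg : g ∈ (deg k).F n)
    (h0 : g ≠ 0) : (g.natDegree : ℤ) ≤ n := by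
  by_contra! h
  exact h0 (leadingCoeff_eq_zero.1 (hg _ h))

lemma deg_eq_degreeLT {k : Type*} [Field k] (n : ℕ) : (deg k).F n = degreeLT k (n + 1) := by
  ext g
  rw [mem_deg_natCast, mem_degreeLT, natDegree_le_iff_coeff_eq_zero]
  exact_mod_cast (degree_lt_iff_coeff_zero g (n + 1)).symm

end RingFilt

/-- An element of weight at most `n` has norm of degree at most `m n`. -/
lemma natDegree_det_le {k : Type*} [Field k] {ι : Type*} [Fintype ι] [DecidableEq ι]
    (M : Matrix ι ι k[X]) (w : ι → ℤ) (n : ℕ)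
    (h : ∀ i j, M i j ∈ (RingFilt.deg k).F (n + w j - w i)) :
    M.det.natDegree ≤ Fintype.card ι * n := by
  rw [← RingFilt.mem_deg_natCast, Matrix.det_apply]
  refine Submodule.sum_mem _ fun σ _ => ?_
  have := (RingFilt.deg k).prod_mem Finset.univ (fun i => M (σ i) i)
    (fun i => n + w i - w (σ i)) fun i _ => h _ _
  have hs : ∑ i, ((n : ℤ) + w i - w (σ i)) = (Fintype.card ι * n : ℕ) := by
    rw [Finset.sum_sub_distrib, Finset.sum_add_distrib, Equiv.sum_comp σ w]
    simp
  rw [hs] at this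
  rcases Int.units_eq_one_or (Equiv.Perm.sign σ) with h | h <;> rw [h]
  · simpa using this
  · simpa using neg_mem this

namespace RingFilt

instance finite_deg (k : Type*) [Field k] (n : ℤ) : FiniteDimensional k ((deg k).F n) := by
  have h : (deg k).F n ≤ degreeLT k (n.toNat + 1) := by
    rw [← deg_eq_degreeLT]
    exact (deg k).mono (by omega)
  exact Submodule.finiteDimensional_of_le h

lemma finrank_deg (k : Type*) [Field k] (n : ℕ) : Module.finrank k ((deg k).F n) = n + 1 := by
  rw [deg_eq_degreeLT, (degreeLTEquiv k (n + 1)).finrank_eq]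
  simp

end RingFilt

section Curve

variable {k : Type*} [Field k] {Φ : k[X][X]} {δ : ℕ}

/-- Weighted degree bound for a polynomial in two variables: `X` (inner) of weight one,
outer variable of weight `δ`, total weight that of the leading term. -/
def DegBound (δ : ℕ) (Φ : k[X][X]) : Prop :=
  Φ ∈ ((RingFilt.deg k).poly δ).F (δ * Φ.natDegree)

/-- The filtration on the coordinate ring. -/
noncomputable abbrev curveFilt (δ : ℕ) (Φ : k[X][X]) : RingFilt k (AdjoinRoot Φ) :=
  (RingFilt.deg k).adj δ Φ

lemma finrank_curveFilt_le (hm : Φ.Monic) (hΦ : DegBound δ Φ) (n : ℤ) :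
    FiniteDimensional k ((curveFilt δ Φ).F n) ∧
    Module.finrank k ((curveFilt δ Φ).F n) ≤ Φ.natDegree * (n.toNat + 1) := by
  have h := RingFilt.finrank_adj_le (n := n.toNat) (by positivity) hm hΦ
  have hle : (curveFilt δ Φ).F n ≤ (curveFilt δ Φ).F n.toNat :=
    RingFilt.mono _ (by omega)
  have := h.1
  refine ⟨Submodule.finiteDimensional_of_le hle, ?_⟩
  refine (Submodule.finrank_mono hle).trans ?_
  simpa [RingFilt.finrank_deg] using h.2

lemma le_finrank_curveFilt (hm : Φ.Monic) (hΦ : DegBound δ Φ) (n : ℕ) :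
    Φ.natDegree * (n + 1) ≤ Module.finrank k ((curveFilt δ Φ).F n) + δ * Φ.natDegree ^ 2 := by
  set m := Φ.natDegree with hmdef
  by_cases hn : n < δ * m
  · nlinarith
  push Not at hn
  let s := n - δ * m
  let f : (Fin m → (RingFilt.deg k).F s) →ₗ[k] AdjoinRoot Φ :=
    ∑ j : Fin m, (LinearMap.mulRight k (AdjoinRoot.root Φ ^ (j : ℕ))) ∘ₗ
      (Algebra.ofId k[X] (AdjoinRoot Φ)).toLinearMap.restrictScalars k ∘ₗ
        ((RingFilt.deg k).F s).subtype ∘ₗ LinearMap.proj j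
  have hf : ∀ v, f v = ∑ j : Fin m, AdjoinRoot.of Φ (v j).1 * AdjoinRoot.root Φ ^ (j : ℕ) := by
    intro v
    simp only [f, LinearMap.sum_apply, LinearMap.comp_apply, LinearMap.proj_apply,
      Submodule.subtype_apply, LinearMap.mulRight_apply]
    rfl
  have hinj : Function.Injective f := by
    rw [← LinearMap.ker_eq_bot, LinearMap.ker_eq_bot']
    intro v hv
    rw [hf] at hv
    have hg : AdjoinRoot.mk Φ (∑ j : Fin m, C (v j).1 * X ^ (j : ℕ)) = 0 := by
      simpa [map_sum] using hv
    rw [AdjoinRoot.mk_eq_zero] at hg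
    have hz := Polynomial.eq_zero_of_dvd_of_degree_lt hg (by
      rw [degree_eq_natDegree hm.ne_zero, ← hmdef]
      refine (degree_sum_le _ _).trans_lt ?_
      refine (Finset.sup_lt_iff (WithBot.bot_lt_coe m)).2 ?_
      exact fun j _ => (degree_C_mul_X_pow_le _ _).trans_lt (Nat.cast_lt.2 j.2))
    ext j : 2
    have := congrArg (fun g => coeff g (j : ℕ)) hz
    simpa [finsetSum_coeff, coeff_X_pow, Fin.val_inj] using this
  have hran : LinearMap.range f ≤ (curveFilt δ Φ).F n := by
    rintro _ ⟨v, rfl⟩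
    rw [hf]
    refine Submodule.sum_mem _ fun j _ => ?_
    have h := (curveFilt δ Φ).mul_mem (RingFilt.of_mem_adj (δ := δ) (Φ := Φ) (v j).2)
      ((curveFilt δ Φ).pow_mem (RingFilt.root_mem_adj (RingFilt.deg k) δ Φ) j)
    refine (curveFilt δ Φ).mono ?_ h
    have hj : (j : ℕ) * δ ≤ δ * m := by rw [mul_comm]; gcongr; exact j.2.le
    have hs : (s : ℤ) + δ * m = n := by
      have : s + δ * m = n := Nat.sub_add_cancel hn
      exact_mod_cast this
    have hj' : ((j : ℕ) : ℤ) * δ ≤ δ * m := by exact_mod_cast hj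
    linarith
  have hfd := (finrank_curveFilt_le hm hΦ (n : ℤ)).1
  have h1 := Submodule.finrank_mono hran
  rw [LinearMap.finrank_range_of_inj hinj, Module.finrank_pi_fintype] at h1
  simp only [RingFilt.finrank_deg, Finset.sum_const, Finset.card_univ, Fintype.card_fin,
    smul_eq_mul] at h1
  have hs : s + δ * m = n := Nat.sub_add_cancel hn
  have : m * (n + 1) = m * (s + 1) + δ * m ^ 2 := by rw [← hs]; ring
  omega

/-- Multiplication matrix entries. -/
lemma leftMulMatrix_mem (hm : Φ.Monic) (hΦ : DegBound δ Φ) {θ : AdjoinRoot Φ} {n : ℤ}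
    (hθ : θ ∈ (curveFilt δ Φ).F n) (i j : Fin (AdjoinRoot.powerBasis' hm).dim) :
    Algebra.leftMulMatrix (AdjoinRoot.powerBasis' hm).basis θ i j ∈
      (RingFilt.deg k).F (n + δ * j - δ * i) := by
  rw [Algebra.leftMulMatrix_eq_repr_mul]
  have h : θ * (AdjoinRoot.powerBasis' hm).basis j ∈ (curveFilt δ Φ).F (n + j * δ) := by
    refine RingFilt.mul_mem _ hθ ?_
    rw [PowerBasis.basis_eq_pow]
    exact (curveFilt δ Φ).pow_mem (RingFilt.root_mem_adj (RingFilt.deg k) δ Φ) j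
  obtain ⟨g, hg, -, hgx⟩ := RingFilt.exists_rep hm hΦ h
  rw [← hgx]
  have hmod := RingFilt.modByMonic_mem hm hΦ hg i
  have hr : (AdjoinRoot.powerBasis' hm).basis.repr (AdjoinRoot.mk Φ g) i =
      (g %ₘ Φ).coeff i := by
    change (AdjoinRoot.powerBasisAux' hm).repr (AdjoinRoot.mk Φ g) i = _
    exact (AdjoinRoot.powerBasisAux'_repr_apply_to_fun hm _ _).trans
      (by rw [AdjoinRoot.modByMonicHom_mk])
  rw [hr]
  convert hmod using 2
  ring

lemma finrank_quotient_le [IsDomain (AdjoinRoot Φ)] (hm : Φ.Monic) (hΦ : DegBound δ Φ)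
    {θ : AdjoinRoot Φ} {n : ℕ} (hθ : θ ∈ (curveFilt δ Φ).F n) (h0 : θ ≠ 0) :
    FiniteDimensional k (AdjoinRoot Φ ⧸ Ideal.span {θ}) ∧
    Module.finrank k (AdjoinRoot Φ ⧸ Ideal.span {θ}) ≤ Φ.natDegree * n := by
  have hI : Ideal.span {θ} ≠ ⊥ := by simpa using h0
  have hfd : FiniteDimensional k (AdjoinRoot Φ ⧸ Ideal.span {θ}) :=
    Module.Finite.equiv
      (Ideal.quotientEquivDirectSum k (AdjoinRoot.powerBasis' hm).basis hI).symm
  refine ⟨hfd, ?_⟩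
  rw [finrank_quotient_span_eq_natDegree_norm (AdjoinRoot.powerBasis' hm).basis h0,
    Algebra.norm_eq_matrix_det (AdjoinRoot.powerBasis' hm).basis]
  refine (natDegree_det_le _ (fun i : Fin (AdjoinRoot.powerBasis' hm).dim => (δ : ℤ) * ((i : ℕ) : ℤ))
    n fun i j => leftMulMatrix_mem hm hΦ hθ i j).trans (by simp)

end Curve

section Homs

variable {k Ω : Type*} [Field k] [Field Ω] [Algebra k Ω] {Φ : k[X][X]} {δ : ℕ}

lemma isDomain_adjoinRoot_of_irreducible (h : Irreducible Φ) : IsDomain (AdjoinRoot Φ) := by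
  have := (Ideal.span_singleton_prime h.ne_zero).2 h.prime
  exact Ideal.Quotient.isDomain _

/-- Algebra homomorphisms from a `k`-algebra killing an element of finite codimension. -/
lemma finite_algHom_ker {O : Type*} [CommRing O] [Algebra k O] (θ : O)
    [FiniteDimensional k (O ⧸ Ideal.span {θ})] :
    {τ : O →ₐ[k] Ω | τ θ = 0}.Finite ∧
    {τ : O →ₐ[k] Ω | τ θ = 0}.ncard ≤ Module.finrank k (O ⧸ Ideal.span {θ}) := by
  let f : {τ : O →ₐ[k] Ω | τ θ = 0} → ((O ⧸ Ideal.span {θ}) →ₐ[k] Ω) := fun τ =>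
    Ideal.Quotient.liftₐ _ τ.1 (fun a ha => by
      obtain ⟨b, rfl⟩ := Ideal.mem_span_singleton'.1 ha
      rw [map_mul, τ.2, mul_zero])
  have hf : Function.Injective f := by
    intro σ τ h
    ext x
    have := DFunLike.congr_fun h (Ideal.Quotient.mk _ x)
    exact this
  have hfin : Finite ((O ⧸ Ideal.span {θ}) →ₐ[k] Ω) := inferInstance
  refine ⟨Set.finite_coe_iff.1 (Finite.of_injective f hf), ?_⟩
  rw [← Nat.card_coe_set_eq]
  exact (Nat.card_le_card_of_injective f hf).trans (card_algHom_le_finrank k _ Ω)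

/-- A nonzero function of weight `n` has at most `m n` zeros. -/
lemma finite_zeros [IsDomain (AdjoinRoot Φ)] (hm : Φ.Monic) (hΦ : DegBound δ Φ)
    {θ : AdjoinRoot Φ} {n : ℕ} (hθ : θ ∈ (curveFilt δ Φ).F n) (h0 : θ ≠ 0) :
    {τ : AdjoinRoot Φ →ₐ[k] Ω | τ θ = 0}.Finite ∧
    {τ : AdjoinRoot Φ →ₐ[k] Ω | τ θ = 0}.ncard ≤ Φ.natDegree * n := by
  obtain ⟨h1, h2⟩ := finrank_quotient_le hm hΦ hθ h0
  exact ⟨(finite_algHom_ker θ).1, (finite_algHom_ker θ).2.trans h2⟩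

/-- The first coordinate. -/
noncomputable abbrev coordX (Φ : k[X][X]) : AdjoinRoot Φ := AdjoinRoot.of Φ X

/-- Evaluation of a bivariate polynomial at a point of an extension field. -/
noncomputable def evalPt (k : Type*) {Ω : Type*} [Field k] [Field Ω] [Algebra k Ω] (z y : Ω) :
    k[X][X] →ₐ[k] Ω :=
  { eval₂RingHom ((aeval z : k[X] →ₐ[k] Ω) : k[X] →+* Ω) y with
    commutes' := fun r => by simp [Polynomial.algebraMap_apply] }

lemma evalPt_apply (z y : Ω) (g : k[X][X]) :
    evalPt k z y g = g.eval₂ ((aeval z : k[X] →ₐ[k] Ω) : k[X] →+* Ω) y := rfl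

@[simp] lemma evalPt_C (z y : Ω) (g : k[X]) : evalPt k z y (C g) = aeval z g := by
  simp [evalPt_apply]

@[simp] lemma evalPt_X (z y : Ω) : evalPt k z y X = y := by
  simp [evalPt_apply]

/-- The algebra homomorphism attached to a point of the curve. -/
noncomputable def pointHom (Φ : k[X][X]) {z y : Ω} (h : evalPt k z y Φ = 0) :
    AdjoinRoot Φ →ₐ[k] Ω :=
  AdjoinRoot.liftAlgHom Φ (aeval z) y h

lemma pointHom_mk {z y : Ω} (h : evalPt k z y Φ = 0) (g : k[X][X]) :
    pointHom Φ h (AdjoinRoot.mk Φ g) = evalPt k z y g := rfl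

lemma pointHom_coordX {z y : Ω} (h : evalPt k z y Φ = 0) : pointHom Φ h (coordX Φ) = z := by
  rw [coordX, ← AdjoinRoot.mk_C, pointHom_mk]; simp

lemma pointHom_root {z y : Ω} (h : evalPt k z y Φ = 0) :
    pointHom Φ h (AdjoinRoot.root Φ) = y := by
  rw [← AdjoinRoot.mk_X, pointHom_mk]; simp

lemma algHom_mk_eq (τ : AdjoinRoot Φ →ₐ[k] Ω) (g : k[X][X]) :
    τ (AdjoinRoot.mk Φ g) = evalPt k (τ (coordX Φ)) (τ (AdjoinRoot.root Φ)) g := by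
  induction g using Polynomial.induction_on' with
  | add p q hp hq => rw [map_add, map_add, hp, hq, map_add]
  | monomial n a =>
    rw [← C_mul_X_pow_eq_monomial, map_mul, map_mul, map_mul, map_pow, map_pow, map_pow, evalPt_C,
      evalPt_X, AdjoinRoot.mk_X, AdjoinRoot.mk_C]
    congr 1
    have : (τ.comp ((AdjoinRoot.ofAlgHom k Φ))) = aeval (τ (coordX Φ)) := by
      ext; simp
    exact DFunLike.congr_fun this a

lemma evalPt_algHom (τ : AdjoinRoot Φ →ₐ[k] Ω) :
    evalPt k (τ (coordX Φ)) (τ (AdjoinRoot.root Φ)) Φ = 0 := by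
  rw [← algHom_mk_eq, AdjoinRoot.mk_self, map_zero]

/-- Algebra homomorphisms from the coordinate ring are the same as points. -/
noncomputable def algHomEquivPoints (Φ : k[X][X]) (Ω : Type*) [Field Ω] [Algebra k Ω] :
    (AdjoinRoot Φ →ₐ[k] Ω) ≃ {P : Ω × Ω // evalPt k P.1 P.2 Φ = 0} where
  toFun τ := ⟨(τ (coordX Φ), τ (AdjoinRoot.root Φ)), evalPt_algHom τ⟩
  invFun P := pointHom Φ P.2
  left_inv τ := by
    refine AlgHom.ext fun x => ?_
    obtain ⟨g, rfl⟩ := AdjoinRoot.mk_surjective x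
    exact (algHom_mk_eq τ g).symm
  right_inv P := by
    ext
    · exact pointHom_coordX _
    · exact pointHom_root _

lemma algHom_ext_pt {σ τ : AdjoinRoot Φ →ₐ[k] Ω} (h1 : σ (coordX Φ) = τ (coordX Φ))
    (h2 : σ (AdjoinRoot.root Φ) = τ (AdjoinRoot.root Φ)) : σ = τ :=
  (algHomEquivPoints Φ Ω).injective (Subtype.ext (Prod.ext h1 h2))

lemma natDegree_map_aeval (hm : Φ.Monic) (z : Ω) :
    (Φ.map ((aeval z : k[X] →ₐ[k] Ω) : k[X] →+* Ω)).natDegree = Φ.natDegree :=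
  hm.natDegree_map _

lemma infinite_algHom [IsAlgClosed Ω] (hm : Φ.Monic) (h0 : Φ.natDegree ≠ 0) :
    Infinite (AdjoinRoot Φ →ₐ[k] Ω) := by
  have : Infinite Ω := IsAlgClosed.instInfinite
  refine Infinite.of_surjective (fun τ => τ (coordX Φ)) fun z => ?_
  obtain ⟨y, hy⟩ := IsAlgClosed.exists_root (Φ.map ((aeval z : k[X] →ₐ[k] Ω) : k[X] →+* Ω)) (by
    rw [degree_eq_natDegree (hm.map _).ne_zero, natDegree_map_aeval hm]
    exact_mod_cast h0)
  have h : evalPt k z y Φ = 0 := by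
    rwa [IsRoot, eval_map] at hy
  exact ⟨pointHom Φ h, pointHom_coordX h⟩

end Homs

section PowerDim

/-- The powers of a maximal ideal in a noetherian domain are strictly decreasing. -/
lemma Ideal.pow_succ_lt_of_ne_bot {O : Type*} [CommRing O] [IsDomain O] [IsNoetherianRing O]
    {I : Ideal O} (h1 : I ≠ ⊤) (h0 : I ≠ ⊥) (n : ℕ) : I ^ (n + 1) < I ^ n := by
  refine lt_of_le_of_ne (Ideal.pow_le_pow_right n.le_succ) fun h => ?_
  obtain ⟨r, hr, hz⟩ := Submodule.exists_sub_one_mem_and_smul_eq_zero_of_fg_of_le_smul I (I ^ n)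
    (IsNoetherian.noetherian _) (by rw [smul_eq_mul, ← pow_succ', h])
  obtain ⟨x, hx, hx0⟩ := Submodule.exists_mem_ne_zero_of_ne_bot h0
  have := hz (x ^ n) (Ideal.pow_mem_pow hx n)
  rcases mul_eq_zero.1 this with h | h
  · exact h1 ((Ideal.eq_top_iff_one _).2 (by simpa [h] using neg_mem hr))
  · exact hx0 (eq_zero_of_pow_eq_zero h)

/-- If a nonzero `g` lies in the `n`-th power of a proper ideal then `O/(g)` has dimension
at least `n`. -/
lemma le_finrank_of_mem_pow {k O : Type*} [Field k] [CommRing O] [Algebra k O] [IsDomain O]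
    [IsNoetherianRing O] {I : Ideal O} (h1 : I ≠ ⊤) {g : O} (hg : g ≠ 0) {n : ℕ}
    (hgn : g ∈ I ^ n) [FiniteDimensional k (O ⧸ Ideal.span {g})] :
    n ≤ Module.finrank k (O ⧸ Ideal.span {g}) := by
  rcases Nat.eq_zero_or_pos n with rfl | hn
  · simp
  have h0 : I ≠ ⊥ := by
    rintro rfl
    rw [Ideal.bot_pow hn.ne'] at hgn
    exact hg hgn
  let q := (Ideal.Quotient.mkₐ k (Ideal.span {g})).toLinearMap
  let S : ℕ → Submodule k (O ⧸ Ideal.span {g}) := fun i => ((I ^ i).restrictScalars k).map q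
  have hS : ∀ i < n, S (i + 1) < S i := by
    intro i hi
    obtain ⟨x, hx, hx'⟩ := SetLike.exists_of_lt (Ideal.pow_succ_lt_of_ne_bot h1 h0 i)
    refine lt_of_le_of_ne (Submodule.map_mono fun x hx => Ideal.pow_le_pow_right i.le_succ hx)
      fun h => ?_
    have : q x ∈ S (i + 1) := h ▸ ⟨x, hx, rfl⟩
    obtain ⟨y, hy, hxy⟩ := this
    have hd : y - x ∈ Ideal.span {g} := Ideal.Quotient.eq.1 hxy
    have : y - x ∈ I ^ (i + 1) :=
      (Ideal.span_le.2 (by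
        simpa using Ideal.pow_le_pow_right (Nat.succ_le_of_lt hi) hgn)) hd
    exact hx' (by simpa using sub_mem hy this)
  have key : ∀ i ≤ n, Module.finrank k (S i) + i ≤ Module.finrank k (O ⧸ Ideal.span {g}) := by
    intro i
    induction i with
    | zero => intro _; simpa using Submodule.finrank_le _
    | succ i ih =>
      intro hi
      have := Submodule.finrank_lt_finrank_of_lt (hS i hi)
      have := ih (by omega)
      omega
  have := key n le_rfl
  omega

end PowerDim

section Frob

variable {E : Type*} [Field E] [IsAlgClosed E] {p : ℕ} [Fact p.Prime] [CharP E p]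
  {Φ : E[X][X]} {δ : ℕ}

lemma frob_sum {O : Type*} [CommRing O] [CharP O p] {ι : Type*} (s : Finset ι) (f : ι → O) (μ : ℕ) :
    (∑ i ∈ s, f i) ^ p ^ μ = ∑ i ∈ s, f i ^ p ^ μ := sum_pow_char_pow _ _ s f

/-- Linear independence of products `e_a t_b^Q` for `Q` large with respect to the weight
of the `e_a`. -/
lemma frob_independent [IsDomain (AdjoinRoot Φ)] (hm : Φ.Monic) (h0 : Φ.natDegree ≠ 0)
    (hΦ : DegBound δ Φ) {L M μ : ℕ} (hL : Φ.natDegree * L < p ^ μ)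
    {α β : Type*} [Fintype α] [Fintype β] (e : α → AdjoinRoot Φ) (t : β → AdjoinRoot Φ)
    (he : LinearIndependent E e) (ht : LinearIndependent E t)
    (heL : ∀ a, e a ∈ (curveFilt δ Φ).F L) (htM : ∀ b, t b ∈ (curveFilt δ Φ).F M)
    (c : α → β → E) (hc : ∑ a, ∑ b, c a b • (e a * t b ^ p ^ μ) = 0) : c = 0 := by
  have : CharP (AdjoinRoot Φ) p := charP_of_injective_algebraMap (algebraMap E _).injective p
  have hg : ∀ τ : AdjoinRoot Φ →ₐ[E] E, ∀ a, ∑ b, c a b * τ (t b) ^ p ^ μ = 0 := by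
    intro τ
    set g := ∑ a, (∑ b, c a b * τ (t b) ^ p ^ μ) • e a with hgdef
    have hgL : g ∈ (curveFilt δ Φ).F L :=
      Submodule.sum_mem _ fun a _ => Submodule.smul_mem _ _ (heL a)
    have hgk : g ∈ RingHom.ker τ ^ p ^ μ := by
      have : g = - ∑ a, ∑ b, c a b • (e a * (t b - algebraMap _ _ (τ (t b))) ^ p ^ μ) := by
        rw [eq_neg_iff_add_eq_zero, ← hc, hgdef]
        simp_rw [Finset.sum_smul]
        rw [← Finset.sum_add_distrib]
        refine Finset.sum_congr rfl fun a _ => ?_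
        rw [← Finset.sum_add_distrib]
        refine Finset.sum_congr rfl fun b _ => ?_
        rw [sub_pow_char_pow]
        simp only [Algebra.smul_def, map_mul, map_pow]
        ring
      rw [this]
      refine neg_mem (Ideal.sum_mem _ fun a _ => Ideal.sum_mem _ fun b _ => ?_)
      rw [Algebra.smul_def]
      refine Ideal.mul_mem_left _ _ (Ideal.mul_mem_left _ _ (Ideal.pow_mem_pow ?_ _))
      simp [RingHom.mem_ker]
    by_cases hg0 : g = 0
    · exact Fintype.linearIndependent_iff.1 he _ hg0
    · obtain ⟨h1, h2⟩ := finrank_quotient_le hm hΦ hgL hg0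
      have := le_finrank_of_mem_pow (k := E) (RingHom.ker_ne_top τ.toRingHom) hg0 hgk
      omega
  have hroot : ∀ x : E, ∃ y, y ^ p ^ μ = x := fun x =>
    IsAlgClosed.exists_pow_nat_eq x (pow_pos (Fact.out : p.Prime).pos μ)
  choose r hr using hroot
  funext a
  set h := ∑ b, r (c a b) • t b with hh
  have hτ : ∀ τ : AdjoinRoot Φ →ₐ[E] E, τ h = 0 := by
    intro τ
    have := hg τ a
    have h2 : τ h ^ p ^ μ = 0 := by
      rw [hh, map_sum, frob_sum, ← this]
      refine Finset.sum_congr rfl fun b _ => ?_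
      rw [map_smul, smul_eq_mul, mul_pow, hr]
    exact eq_zero_of_pow_eq_zero h2
  have hz : h = 0 := by
    by_contra hne
    have hM : h ∈ (curveFilt δ Φ).F M :=
      Submodule.sum_mem _ fun b _ => Submodule.smul_mem _ _ (htM b)
    have hfin := (finite_zeros (Ω := E) hm hΦ hM hne).1
    have hinf := infinite_algHom (k := E) (Ω := E) hm h0
    exact hfin.not_infinite (by simpa [hτ] using Set.infinite_univ)
  funext b
  have := Fintype.linearIndependent_iff.1 ht _ hz b
  rw [← hr (c a b), this, zero_pow (pow_pos (Fact.out : p.Prime).pos μ).ne']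
  rfl

end Frob

section Stepanov

/-- The monomials of weight at most `M` span the `M`-th step of the filtration. -/
lemma exists_monomial_basis {E : Type*} [Field E] {Φ : E[X][X]} {δ : ℕ} (hm : Φ.Monic)
    (hΦ : DegBound δ Φ) (M : ℕ) :
    ∃ s : Finset (AdjoinRoot Φ), LinearIndependent E (fun x : s => (x : AdjoinRoot Φ)) ∧
      (∀ x ∈ s, x ∈ (curveFilt δ Φ).F M ∧
        ∃ i j : ℕ, x = coordX Φ ^ i * AdjoinRoot.root Φ ^ j) ∧
      Module.finrank E ((curveFilt δ Φ).F M) = s.card := by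
  set V : Set (AdjoinRoot Φ) := {x | x ∈ (curveFilt δ Φ).F M ∧
        ∃ i j : ℕ, x = coordX Φ ^ i * AdjoinRoot.root Φ ^ j} with hV
  obtain ⟨b, hbV, hspan, hli⟩ := exists_linearIndependent E V
  have hVspan : Submodule.span E V = (curveFilt δ Φ).F M := by
    refine le_antisymm (Submodule.span_le.2 fun x hx => hx.1) ?_
    rintro _ ⟨g, hg, rfl⟩
    change AdjoinRoot.mk Φ g ∈ _
    rw [g.as_sum_range_C_mul_X_pow, map_sum]
    refine Submodule.sum_mem _ fun j _ => ?_
    rw [(g.coeff j).as_sum_range_C_mul_X_pow, map_sum, Finset.sum_mul, map_sum]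
    refine Submodule.sum_mem _ fun i _ => ?_
    have h : AdjoinRoot.mk Φ (C (C ((g.coeff j).coeff i) * X ^ i) * X ^ j) =
        (g.coeff j).coeff i • (coordX Φ ^ i * AdjoinRoot.root Φ ^ j) := by
      rw [Algebra.smul_def, C.map_mul, C.map_pow, map_mul, map_mul, map_pow, map_pow,
        AdjoinRoot.mk_C, AdjoinRoot.mk_C, AdjoinRoot.mk_X, mul_assoc]
      rfl
    rw [h]
    by_cases h0 : (g.coeff j).coeff i = 0
    · rw [h0, zero_smul]; exact zero_mem _
    refine Submodule.smul_mem _ _ (Submodule.subset_span ⟨?_, i, j, rfl⟩)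
    have hi : (i : ℤ) + δ * j ≤ M := by
      by_contra! hlt
      exact h0 (hg j i (by linarith))
    refine RingFilt.mono _ hi ?_
    refine RingFilt.mul_mem _ ?_ ?_
    · have hX : (X : E[X]) ∈ (RingFilt.deg E).F 1 := by
        have := (RingFilt.mem_deg_natCast (k := E) (n := 1) (g := X)).2 natDegree_X_le
        exact_mod_cast this
      have := (curveFilt δ Φ).pow_mem (RingFilt.of_mem_adj (δ := (δ : ℤ)) (Φ := Φ) hX) i
      simpa using this
    · have := (curveFilt δ Φ).pow_mem (RingFilt.root_mem_adj (RingFilt.deg E) δ Φ) j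
      rwa [mul_comm] at this
  have hfd := (finrank_curveFilt_le hm hΦ (M : ℤ)).1
  have hbfin : b.Finite := by
    have : FiniteDimensional E (Submodule.span E b) := by
      rw [hspan, hVspan]; exact hfd
    have h2 : LinearIndependent E (fun x : b => (⟨x, Submodule.subset_span x.2⟩ :
        Submodule.span E b)) := by
      refine LinearIndependent.of_comp (Submodule.span E b).subtype ?_
      exact hli
    exact Set.finite_coe_iff.1 h2.finite_of_isNoetherian
  refine ⟨hbfin.toFinset, ?_, fun x hx => hbV (hbfin.mem_toFinset.1 hx), ?_⟩
  · have : LinearIndepOn E id (hbfin.toFinset : Set (AdjoinRoot Φ)) := by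
      rw [hbfin.coe_toFinset]; exact hli
    exact this
  · have := finrank_span_finset_eq_card (R := E) (s := hbfin.toFinset)
      (by rw [hbfin.coe_toFinset]; exact hli)
    rwa [hbfin.coe_toFinset, hspan, hVspan] at this

/-- The dimension count behind the choice of the degrees of the auxiliary function. -/
lemma auxiliary_dimension_count {m ρ D Q : ℕ} (hm : 0 < m)
    (hQ : (D + ρ) * (D + D * ρ + ρ ^ 2 + 1 + 2 * m) + 1 ≤ Q) :
    ∃ L M : ℕ, m * L < Q ∧
      m * (L + M * Q) ≤ ρ * Q ^ 2 + (D + D * ρ + ρ ^ 2 + 1 + m + 1) * Q ∧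
      ∀ u v : ℕ, m * (L + 1) ≤ u + D → m * (M + 1) ≤ v + D →
        m * ρ * (L * Q + M + 1) < u * v := by
  obtain ⟨F, hF⟩ : ∃ F, F = D + D * ρ + ρ ^ 2 + 1 := ⟨_, rfl⟩
  rw [← hF] at hQ ⊢
  set X := ρ * Q + F with hX
  have hM1 : X ≤ m * ((X + m - 1) / m) := by
    have := Nat.div_add_mod (X + m - 1) m
    have := Nat.mod_lt (X + m - 1) hm
    omega
  have hM2 : m * ((X + m - 1) / m) ≤ X + m - 1 := Nat.mul_div_le _ _
  have hL1 : Q ≤ m * ((Q - 1) / m) + m := by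
    have := Nat.div_add_mod (Q - 1) m
    have := Nat.mod_lt (Q - 1) hm
    omega
  have hL2 : m * ((Q - 1) / m) ≤ Q - 1 := Nat.mul_div_le _ _
  set L := (Q - 1) / m
  set M := (X + m - 1) / m
  refine ⟨L, M, by omega, ?_, ?_⟩
  · have : m * M ≤ X + m := by omega
    have h2 : m * M * Q ≤ (X + m) * Q := Nat.mul_le_mul_right _ this
    have h3 : m * L ≤ Q := by omega
    rw [hX] at h2
    nlinarith
  · intro u v hu hv
    zify at *
    set a : ℤ := m * L + m
    set Y : ℤ := m * M
    have hYX : (ρ : ℤ) * Q + F ≤ Y := hM1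
    have hua : a - D ≤ u := by linarith
    have hvY : Y + m - D ≤ v := by linarith
    have hD : (0 : ℤ) ≤ D := by positivity
    have hρ : (0 : ℤ) ≤ ρ := by positivity
    have hm0 : (0 : ℤ) < m := by positivity
    have hFpos : (D : ℤ) + 1 ≤ F := by rw [hF]; nlinarith [mul_nonneg hD hρ]
    have hQbig : (D : ℤ) + ρ ≤ Q := by nlinarith [mul_nonneg hD hρ]
    have haQ : (Q : ℤ) ≤ a := by linarith
    have hYm : 0 ≤ Y + m - D := by nlinarith [mul_nonneg hρ (show (0:ℤ) ≤ Q by positivity)]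
    have h1 : (a - D) * (Y + m - D) ≤ u * v :=
      mul_le_mul hua hvY hYm (by positivity)
    refine lt_of_lt_of_le ?_ h1
    have e1 : (m : ℤ) * ρ * (L * Q + M + 1) = ρ * ((a - m) * Q + Y + m) := by
      simp only [a, Y]; ring
    rw [e1]
    have h2 : 0 ≤ (a - D - ρ) * (Y - (ρ * Q + F)) :=
      mul_nonneg (by linarith) (by linarith)
    have h3 : 0 ≤ (a - Q) * (F - D) := mul_nonneg (by linarith) (by linarith)
    have h4 : 0 ≤ (a : ℤ) * m := mul_nonneg (by linarith) hm0.le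
    have h5 : 0 ≤ (ρ : ℤ) * m * Q := by positivity
    have h6 : 0 ≤ (D : ℤ) * D := by positivity
    nlinarith

variable {E : Type*} [Field E] [IsAlgClosed E] {p : ℕ} [Fact p.Prime] [CharP E p]
  {Φ : E[X][X]} {δ : ℕ}

/-- Stepanov's method on the curve `Φ = 0`: bound for points at which Frobenius is given by an
algebraic correspondence of degree `ρ`. -/
lemma stepanov_bound [IsDomain (AdjoinRoot Φ)] (hm : Φ.Monic) (h0 : Φ.natDegree ≠ 0)
    (hΦ : DegBound δ Φ) {T : Type*} [CommRing T] [Algebra E T] (S : RingFilt E T) (ρ : ℕ)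
    (hS : ∀ n : ℕ, FiniteDimensional E (S.F n) ∧
      Module.finrank E (S.F n) ≤ Φ.natDegree * ρ * (n + 1))
    (ι σ : AdjoinRoot Φ →ₐ[E] T) (hι : ∀ n : ℕ, ∀ x ∈ (curveFilt δ Φ).F n, ι x ∈ S.F n)
    (hσ : ∀ n : ℕ, ∀ x ∈ (curveFilt δ Φ).F n, σ x ∈ S.F n)
    {D : ℕ} (hD : D = δ * Φ.natDegree ^ 2) (μ : ℕ)
    (hQ : (D + ρ) * (D + D * ρ + ρ ^ 2 + 1 + 2 * Φ.natDegree) + 1 ≤ p ^ μ)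
    (P : Finset (AdjoinRoot Φ →ₐ[E] E))
    (hP : ∀ τ ∈ P, ∃ τ' : T →ₐ[E] E, (∀ x, τ' (ι x) = τ x) ∧
      τ' (σ (coordX Φ)) = τ (coordX Φ) ^ p ^ (2 * μ) ∧
      τ' (σ (AdjoinRoot.root Φ)) = τ (AdjoinRoot.root Φ) ^ p ^ (2 * μ)) :
    P.card ≤ ρ * p ^ (2 * μ) + (D + D * ρ + ρ ^ 2 + 1 + Φ.natDegree + 1) * p ^ μ := by
  classical
  have hppos : 0 < p ^ μ := pow_pos (Fact.out : p.Prime).pos μ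
  obtain ⟨L, M, hL, hLM, hdim⟩ := auxiliary_dimension_count (Nat.pos_of_ne_zero h0) hQ
  obtain ⟨s, hsli, hsM, hsc⟩ := exists_monomial_basis hm hΦ L
  obtain ⟨t, htli, htM, htc⟩ := exists_monomial_basis hm hΦ M
  have hcard := hdim s.card t.card
    (by rw [← hsc, hD]; exact le_finrank_curveFilt hm hΦ L)
    (by rw [← htc, hD]; exact le_finrank_curveFilt hm hΦ M)
  set n := L * p ^ μ + M
  have hfd := (hS n).1
  have hmemST : ∀ a : s × t, ι a.1 ^ p ^ μ * σ a.2 ∈ S.F n := by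
    intro a
    have h1 := S.pow_mem (hι L _ (hsM a.1 a.1.2).1) (p ^ μ)
    have h2 := S.mul_mem h1 (hσ M _ (htM a.2 a.2.2).1)
    convert h2 using 2
    simp only [n]; push_cast; ring
  have hnli : ¬ LinearIndependent E
      (fun a : s × t => (⟨ι a.1 ^ p ^ μ * σ a.2, hmemST a⟩ : S.F n)) := by
    intro hli
    have h1 := hli.fintype_card_le_finrank
    have h2 := (hS n).2
    simp only [Fintype.card_prod, Fintype.card_coe] at h1
    exact absurd (h1.trans h2) (not_le.2 hcard)
  obtain ⟨d, hd, a₀, ha₀⟩ := Fintype.not_linearIndependent_iff.1 hnli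
  have hd' : ∑ a : s × t, d a • (ι a.1 ^ p ^ μ * σ a.2) = 0 := by
    have := congrArg (S.F n).subtype hd
    simpa using this
  have hroot : ∀ x : E, ∃ y, y ^ p ^ μ = x := fun x => IsAlgClosed.exists_pow_nat_eq x hppos
  choose r hr using hroot
  set θ : AdjoinRoot Φ := ∑ a : s, ∑ b : t, r (d (a, b)) • ((a : AdjoinRoot Φ) *
    (b : AdjoinRoot Φ) ^ p ^ μ) with hθ
  have hθ0 : θ ≠ 0 := by
    intro h
    have := frob_independent hm h0 hΦ hL (fun a : s => (a : AdjoinRoot Φ))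
      (fun b : t => (b : AdjoinRoot Φ)) hsli htli (fun a => (hsM a a.2).1)
      (fun b => (htM b b.2).1) (fun a b => r (d (a, b))) h
    have h2 := congrFun (congrFun this a₀.1) a₀.2
    apply ha₀
    rw [← hr (d a₀)]
    simp only [Pi.zero_apply] at h2
    rw [h2, zero_pow hppos.ne']
  have hθF : θ ∈ (curveFilt δ Φ).F ((L + M * p ^ μ : ℕ) : ℤ) := by
    refine Submodule.sum_mem _ fun a _ => Submodule.sum_mem _ fun b _ =>
      Submodule.smul_mem _ _ ?_
    have := RingFilt.mul_mem _ (hsM a a.2).1 ((curveFilt δ Φ).pow_mem (htM b b.2).1 (p ^ μ))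
    convert this using 2
    push_cast; ring
  have hzero : ∀ τ ∈ P, τ θ = 0 := by
    intro τ hτ
    obtain ⟨τ', h1, h2, h3⟩ := hP τ hτ
    have key : τ θ ^ p ^ μ = τ' (∑ a : s × t, d a • (ι a.1 ^ p ^ μ * σ a.2)) := by
      rw [hθ, ← Fintype.sum_prod_type' (fun (a : s) (b : t) => r (d (a, b)) •
        ((a : AdjoinRoot Φ) * (b : AdjoinRoot Φ) ^ p ^ μ)), map_sum, frob_sum, map_sum]
      refine Finset.sum_congr rfl fun a _ => ?_
      obtain ⟨i, j, hij⟩ := (htM a.2 a.2.2).2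
      rw [map_smul, map_smul, smul_eq_mul, smul_eq_mul, mul_pow, hr, map_mul, map_mul, mul_pow,
        map_pow, map_pow, h1]
      congr 2
      rw [hij]
      simp only [map_mul, map_pow, h2, h3]
      rw [two_mul, pow_add]
      ring
    rw [hd', map_zero] at key
    exact eq_zero_of_pow_eq_zero key
  obtain ⟨hf1, hf2⟩ := finite_zeros (Ω := E) hm hΦ hθF hθ0
  have h4 : P.card ≤ {τ : AdjoinRoot Φ →ₐ[E] E | τ θ = 0}.ncard := by
    rw [← Set.ncard_coe_finset]
    exact Set.ncard_le_ncard (fun τ hτ => hzero τ hτ) hf1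
  calc P.card ≤ _ := h4.trans (hf2.trans hLM)
    _ = _ := by rw [← pow_mul, mul_comm μ 2]

end Stepanov

section ArtinSchreier

variable {E : Type*} [Field E] {p : ℕ} [Fact p.Prime] [Algebra (ZMod p) E]

/-- The Artin–Schreier polynomial. -/
noncomputable def wp (E : Type*) [Field E] (p : ℕ) : E[X] := X ^ p - X

lemma natDegree_wp : (wp E p).natDegree = p :=
  FiniteField.X_pow_card_sub_X_natDegree_eq E (Fact.out : p.Prime).one_lt

lemma monic_wp : (wp E p).Monic := by
  refine monic_X_pow_sub ?_
  simpa using (Fact.out : p.Prime).one_lt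

lemma wp_comp_add (β : ZMod p) : (wp E p).comp (X + C (algebraMap (ZMod p) E β)) = wp E p := by
  have : CharP E p := charP_of_injective_algebraMap (algebraMap (ZMod p) E).injective p
  simp only [wp, sub_comp, pow_comp, X_comp]
  rw [add_pow_char, ← C_pow, ← map_pow, ZMod.pow_card]
  ring

lemma taylor_wp_comp (g : E[X]) (β : ZMod p) :
    taylor (algebraMap (ZMod p) E β) (g.comp (wp E p)) = g.comp (wp E p) := by
  rw [taylor_apply, comp_assoc, wp_comp_add]

/-- A polynomial invariant under `X ↦ X + 1` is a polynomial in `X ^ p - X`. -/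
lemma exists_comp_wp {f : E[X]} (hf : taylor (1 : E) f = f) : ∃ g : E[X], f = g.comp (wp E p) := by
  induction hn : f.natDegree using Nat.strong_induction_on generalizing f with
  | _ n ih =>
  have hp := (Fact.out : p.Prime)
  set f' := f - C (f.eval 0) with hf'
  have hev : ∀ i : ℕ, f.eval (i : E) = f.eval 0 := by
    intro i
    induction i with
    | zero => simp
    | succ i ihi => rw [Nat.cast_succ, ← taylor_eval, hf, ihi]
  have hwe : ∀ i : ℕ, (wp E p).eval (i : E) = 0 := by
    intro i
    have : ((i : ZMod p) ^ p - i) = 0 := by rw [ZMod.pow_card, sub_self]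
    have h2 := congrArg (algebraMap (ZMod p) E) this
    rw [map_sub, map_pow, map_natCast, map_zero] at h2
    simpa only [wp, eval_sub, eval_pow, eval_X] using h2
  have hdvd : wp E p ∣ f' := by
    rw [← modByMonic_eq_zero_iff_dvd monic_wp]
    refine eq_zero_of_natDegree_lt_card_of_eval_eq_zero (ι := ZMod p) _
      (algebraMap (ZMod p) E).injective (fun i => ?_) ?_
    · obtain ⟨j, rfl⟩ := ZMod.natCast_zmod_surjective i
      have h1 := congrArg (eval (j : E)) (modByMonic_add_div f' (wp E p))
      rw [eval_add, eval_mul, hwe, zero_mul, add_zero] at h1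
      rw [map_natCast, h1, hf', eval_sub, eval_C, hev, sub_self]
    · rw [ZMod.card]
      conv_rhs => rw [← natDegree_wp (E := E) (p := p)]
      refine natDegree_modByMonic_lt _ monic_wp fun h => ?_
      have := natDegree_wp (E := E) (p := p)
      rw [h, natDegree_one] at this
      exact hp.ne_zero this.symm
  obtain ⟨h, hh⟩ := hdvd
  have hfh : f = C (f.eval 0) + wp E p * h := by rw [← hh, hf']; ring
  by_cases h0 : h = 0
  · refine ⟨C (f.eval 0), ?_⟩
    rw [C_comp]; simpa [h0] using hfh
  have hinv : taylor (1 : E) h = h := by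
    have h1 : taylor (1 : E) (wp E p) = wp E p := by
      have := wp_comp_add (E := E) (1 : ZMod p)
      rwa [map_one, ← taylor_apply] at this
    have h2 : wp E p * taylor (1 : E) h = wp E p * h := by
      rw [← hh, hf']
      conv_lhs => rw [← h1, ← taylor_mul, ← hh, hf', map_sub, hf, taylor_C]
    exact mul_left_cancel₀ (monic_wp (E := E) (p := p)).ne_zero h2
  have hdeg : h.natDegree < n := by
    have h1 : f'.natDegree = p + h.natDegree := by
      rw [hh, natDegree_mul (monic_wp (E := E) (p := p)).ne_zero h0, natDegree_wp]
    have h2 : f'.natDegree = f.natDegree := by rw [hf', natDegree_sub_C]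
    have := hp.pos
    omega
  obtain ⟨g, hg⟩ := ih _ hdeg hinv rfl
  refine ⟨C (f.eval 0) + X * g, ?_⟩
  rw [add_comp, C_comp, mul_comp, X_comp, ← hg]
  exact hfh

/-- Pull back of a plane curve along `z ↦ z ^ p - z`. -/
noncomputable def asPull (p : ℕ) (Φ : E[X][X]) : E[X][X] := Φ.map (compRingHom (wp E p))

lemma asPull_monic {Φ : E[X][X]} (hm : Φ.Monic) : (asPull p Φ).Monic := hm.map _

lemma natDegree_asPull {Φ : E[X][X]} (hm : Φ.Monic) : (asPull p Φ).natDegree = Φ.natDegree :=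
  hm.natDegree_map _

lemma comp_wp_injective : Function.Injective (compRingHom (wp E p)) := by
  rw [injective_iff_map_eq_zero]
  intro f hf
  rw [coe_compRingHom_apply] at hf
  rcases comp_eq_zero_iff.1 hf with h | h
  · exact h
  · have := natDegree_wp (E := E) (p := p)
    rw [h.2, natDegree_C] at this
    exact absurd this.symm (Fact.out : p.Prime).ne_zero

/-- Translation of the inner variable. -/
noncomputable def trl (a : E) : E[X][X] →+* E[X][X] := mapRingHom (taylorEquiv a : E[X] →+* E[X])

lemma coeff_trl (a : E) (g : E[X][X]) (i : ℕ) : (trl a g).coeff i = taylor a (g.coeff i) := by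
  simp [trl]
  rfl

lemma trl_trl (a b : E) (g : E[X][X]) : trl a (trl b g) = trl (a + b) g := by
  ext1 i
  rw [coeff_trl, coeff_trl, coeff_trl, taylor_taylor]

lemma trl_zero (g : E[X][X]) : trl 0 g = g := by
  ext1 i; rw [coeff_trl, taylor_zero]

lemma trl_monic {g : E[X][X]} (a : E) (h : g.Monic) : (trl a g).Monic := h.map _

lemma natDegree_trl {g : E[X][X]} (a : E) (h : g.Monic) : (trl a g).natDegree = g.natDegree :=
  h.natDegree_map _

lemma trl_irreducible {g : E[X][X]} (a : E) (h : Irreducible g) : Irreducible (trl a g) := by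
  let e : E[X][X] ≃+* E[X][X] :=
    { trl a with
      invFun := trl (-a)
      left_inv := fun g => by change trl (-a) (trl a g) = g; rw [trl_trl]; simp [trl_zero]
      right_inv := fun g => by change trl a (trl (-a) g) = g; rw [trl_trl]; simp [trl_zero] }
  exact (MulEquiv.irreducible_iff e).2 h

lemma trl_asPull (Φ : E[X][X]) (β : ZMod p) :
    trl (algebraMap (ZMod p) E β) (asPull p Φ) = asPull p Φ := by
  ext1 i
  rw [coeff_trl, asPull, coeff_map, coe_compRingHom_apply, taylor_wp_comp]

lemma exists_asPull {Θ : E[X][X]} (hm : Θ.Monic) (h : trl (1 : E) Θ = Θ) :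
    ∃ Φ : E[X][X], Φ.Monic ∧ Θ = asPull p Φ := by
  have : ∀ i, ∃ g : E[X], Θ.coeff i = g.comp (wp E p) := by
    intro i
    refine exists_comp_wp ?_
    rw [← coeff_trl, h]
  choose g hg using this
  have hΘ : Θ = asPull p (∑ i ∈ Finset.range (Θ.natDegree + 1), C (g i) * X ^ i) := by
    conv_lhs => rw [Θ.as_sum_range_C_mul_X_pow]
    simp [asPull, Polynomial.map_sum, hg]
  refine ⟨_, ?_, hΘ⟩
  exact monic_of_injective comp_wp_injective (hΘ ▸ hm)

lemma asPull_injective : Function.Injective (asPull p : E[X][X] → E[X][X]) :=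
  map_injective _ comp_wp_injective

lemma isUnit_iff_of_monic {R : Type*} [CommRing R] [IsDomain R] {g : R[X]} (h : g.Monic) :
    IsUnit g ↔ g.natDegree = 0 := by
  rw [h.isUnit_iff, h.natDegree_eq_zero]

/-- A monic polynomial of positive degree has a monic irreducible factor. -/
lemma exists_monic_irreducible_dvd {k : Type*} [Field k] {g : k[X][X]} (hm : g.Monic)
    (h0 : g.natDegree ≠ 0) : ∃ f : k[X][X], f.Monic ∧ Irreducible f ∧ f ∣ g := by
  obtain ⟨f, hf, hfg⟩ := WfDvdMonoid.exists_irreducible_factor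
    (fun h => h0 ((isUnit_iff_of_monic hm).1 h)) hm.ne_zero
  obtain ⟨c, hc⟩ := hfg
  have h1 : f.leadingCoeff * c.leadingCoeff = 1 := by
    rw [← leadingCoeff_mul, ← hc]; exact hm
  have hmon : (C c.leadingCoeff * f).Monic := by
    rw [Monic, leadingCoeff_mul, leadingCoeff_C, mul_comm]; exact h1
  have hu : IsUnit (C c.leadingCoeff : k[X][X]) :=
    isUnit_C.2 (IsUnit.of_mul_eq_one _ (by rw [mul_comm]; exact h1))
  refine ⟨C c.leadingCoeff * f, hmon, (irreducible_isUnit_mul hu).2 hf, ?_⟩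
  exact (hu.mul_left_dvd).2 ⟨c, hc⟩

lemma irreducible_asPull {Φ : E[X][X]} (hm : Φ.Monic) (hirr : Irreducible Φ)
    (hlt : Φ.natDegree < p) : Irreducible (asPull p Φ) := by
  classical
  have hΘm := asPull_monic (p := p) hm
  have h0 : (asPull p Φ).natDegree ≠ 0 := by
    rw [natDegree_asPull hm]
    intro h
    exact hirr.not_isUnit ((isUnit_iff_of_monic hm).2 h)
  obtain ⟨f, hfm, hfi, hfd⟩ := exists_monic_irreducible_dvd hΘm h0
  have hf0 : f.natDegree ≠ 0 := fun h => hfi.not_isUnit ((isUnit_iff_of_monic hfm).2 h)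
  let s : ZMod p → E[X][X] := fun i => trl (algebraMap (ZMod p) E i) f
  have hsm : ∀ i, (s i).Monic := fun i => trl_monic _ hfm
  have hsi : ∀ i, Irreducible (s i) := fun i => trl_irreducible _ hfi
  have hsd : ∀ i, s i ∣ asPull p Φ := by
    intro i
    rw [← trl_asPull Φ i]
    exact _root_.map_dvd (trl (algebraMap (ZMod p) E i)) hfd
  have hninj : ¬ Function.Injective s := by
    intro hinj
    have hpair : Pairwise (Function.onFun IsRelPrime s) := by
      intro i j hij
      refine ((hsi i).isRelPrime_iff_not_dvd).2 fun hd => ?_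
      refine hij (hinj ?_)
      exact eq_of_monic_of_associated (hsm i) (hsm j) ((hsi i).associated_of_dvd (hsi j) hd)
    have hprod := Fintype.prod_dvd_of_isRelPrime hpair hsd
    have h1 := natDegree_le_of_dvd hprod hΘm.ne_zero
    rw [natDegree_prod_of_monic _ _ (fun i _ => hsm i), natDegree_asPull hm] at h1
    simp only [s, natDegree_trl _ hfm, Finset.sum_const, Finset.card_univ, ZMod.card,
      smul_eq_mul] at h1
    have : p * 1 ≤ p * f.natDegree := Nat.mul_le_mul_left _ (Nat.pos_of_ne_zero hf0)
    omega
  obtain ⟨i, j, hij, hne⟩ : ∃ i j, s i = s j ∧ i ≠ j := by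
    simpa [Function.Injective] using hninj
  have hfix : s (i - j) = f := by
    have h1 := congrArg (trl (algebraMap (ZMod p) E (-j))) hij
    simp only [s, trl_trl] at h1 ⊢
    rw [← map_add, ← map_add, neg_add_cancel, map_zero, trl_zero] at h1
    rwa [sub_eq_add_neg, add_comm]
  have hfixn : ∀ n : ℕ, s (n * (i - j)) = f := by
    intro n
    induction n with
    | zero => simp [s, trl_zero]
    | succ n ih =>
      have : ((n + 1 : ℕ) : ZMod p) * (i - j) = (i - j) + n * (i - j) := by push_cast; ring
      rw [this]
      simp only [s] at ih hfix ⊢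
      rw [map_add, ← trl_trl, ih, hfix]
  have hone : trl (1 : E) f = f := by
    obtain ⟨n, hn⟩ := ZMod.natCast_zmod_surjective ((i - j)⁻¹)
    have := hfixn n
    rw [hn, inv_mul_cancel₀ (sub_ne_zero.2 hne)] at this
    simpa [s] using this
  obtain ⟨Φ1, hΦ1m, rfl⟩ := exists_asPull (p := p) hfm hone
  obtain ⟨c, hc⟩ := hfd
  have hcm : c.Monic := hfm.of_mul_monic_left (hc ▸ hΘm)
  have hcone : trl (1 : E) c = c := by
    have h1 := trl_asPull Φ (1 : ZMod p)
    rw [hc, map_mul, map_one, hone] at h1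
    exact mul_left_cancel₀ hfm.ne_zero h1
  obtain ⟨Φ2, hΦ2m, rfl⟩ := exists_asPull (p := p) hcm hcone
  have hprod : Φ = Φ1 * Φ2 := by
    apply asPull_injective (p := p)
    rw [hc]; simp [asPull]
  rcases hirr.isUnit_or_isUnit hprod with h | h
  · rw [isUnit_iff_of_monic hΦ1m] at h
    exact absurd (by rw [natDegree_asPull hΦ1m, h]) hf0
  · rw [hprod, hΦ2m.isUnit_iff.1 h, mul_one]
    exact hfi

lemma exists_degBound {Φ : E[X][X]} (hm : Φ.Monic) : ∃ δ, DegBound δ Φ := by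
  refine ⟨∑ i ∈ Finset.range (Φ.natDegree + 1), (Φ.coeff i).natDegree, fun i => ?_⟩
  rcases lt_trichotomy i Φ.natDegree with hi | hi | hi
  · have h1 := (RingFilt.mem_deg_natCast (g := Φ.coeff i)).2 le_rfl
    refine RingFilt.mono _ ?_ h1
    have h2 : (Φ.coeff i).natDegree ≤ ∑ i ∈ Finset.range (Φ.natDegree + 1),
        (Φ.coeff i).natDegree :=
      Finset.single_le_sum (f := fun i => (Φ.coeff i).natDegree) (fun _ _ => Nat.zero_le _)
        (Finset.mem_range.2 (by omega))
    set d := ∑ i ∈ Finset.range (Φ.natDegree + 1), (Φ.coeff i).natDegree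
    have h3 : (d : ℤ) * 1 ≤ d * (Φ.natDegree - i) :=
      mul_le_mul_of_nonneg_left (by omega) (by positivity)
    have h4 : ((Φ.coeff i).natDegree : ℤ) ≤ d := by exact_mod_cast h2
    linarith
  · rw [hi, coeff_natDegree, hm.leadingCoeff, sub_self]
    exact RingFilt.one_mem _
  · rw [coeff_eq_zero_of_natDegree_lt hi]
    exact zero_mem _

end ArtinSchreier

section PointCount

lemma algHom_mem_filt {E : Type*} [Field E] {Φ : E[X][X]} {δ : ℕ} {T : Type*} [CommRing T]
    [Algebra E T] (S : RingFilt E T) (σ : AdjoinRoot Φ →ₐ[E] T) (h1 : σ (coordX Φ) ∈ S.F 1)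
    (h2 : σ (AdjoinRoot.root Φ) ∈ S.F δ) (n : ℕ) (x : AdjoinRoot Φ)
    (hx : x ∈ (curveFilt δ Φ).F n) : σ x ∈ S.F n := by
  obtain ⟨g, hg, rfl⟩ := hx
  change σ (AdjoinRoot.mk Φ g) ∈ _
  rw [g.as_sum_range_C_mul_X_pow, map_sum, map_sum]
  refine Submodule.sum_mem _ fun j _ => ?_
  rw [(g.coeff j).as_sum_range_C_mul_X_pow, map_sum, Finset.sum_mul, map_sum, map_sum]
  refine Submodule.sum_mem _ fun i _ => ?_
  have h : AdjoinRoot.mk Φ (C (C ((g.coeff j).coeff i) * X ^ i) * X ^ j) =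
      (g.coeff j).coeff i • (coordX Φ ^ i * AdjoinRoot.root Φ ^ j) := by
    rw [Algebra.smul_def, C.map_mul, C.map_pow, map_mul, map_mul, map_pow, map_pow,
      AdjoinRoot.mk_C, AdjoinRoot.mk_C, AdjoinRoot.mk_X, mul_assoc]
    rfl
  rw [h, map_smul]
  by_cases h0 : (g.coeff j).coeff i = 0
  · rw [h0, zero_smul]; exact zero_mem _
  refine Submodule.smul_mem _ _ ?_
  have hi : (i : ℤ) + δ * j ≤ n := by
    by_contra! hlt
    exact h0 (hg j i (by linarith))
  rw [map_mul, map_pow, map_pow]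
  refine RingFilt.mono _ hi (RingFilt.mul_mem _ ?_ ?_)
  · have := S.pow_mem h1 i
    simpa using this
  · have := S.pow_mem h2 j
    rwa [mul_comm] at this

variable {E : Type*} [Field E] [IsAlgClosed E] {p : ℕ} [Fact p.Prime] [Algebra (ZMod p) E]

/-- Points of the curve `Ψ = 0` with coordinates fixed by the `p ^ r`-Frobenius and first
coordinate of absolute trace `β`. -/
def tracePts (β : ZMod p) (r : ℕ) (Ψ : E[X][X]) : Set (E × E) :=
  {P | P.1 ^ p ^ r = P.1 ∧ P.2 ^ p ^ r = P.2 ∧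
    ∑ i ∈ Finset.range r, P.1 ^ p ^ i = algebraMap (ZMod p) E β ∧ evalPt E P.1 P.2 Ψ = 0}

lemma finite_frobFixed {r : ℕ} (hr : r ≠ 0) : {t : E | t ^ p ^ r = t}.Finite ∧
    {t : E | t ^ p ^ r = t}.ncard = p ^ r := by
  classical
  have : CharP E p := charP_of_injective_algebraMap (algebraMap (ZMod p) E).injective p
  have hp := (Fact.out : p.Prime)
  have h1 : {t : E | t ^ p ^ r = t} = ((X ^ p ^ r - X : E[X]).rootSet E : Set E) := by
    ext t
    rw [mem_rootSet]
    have hne : (X ^ p ^ r - X : E[X]) ≠ 0 :=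
      FiniteField.X_pow_card_pow_sub_X_ne_zero E hr hp.one_lt
    simp [sub_eq_zero, hne]
  refine ⟨h1 ▸ rootSet_finite _ _, ?_⟩
  rw [h1, ← Nat.card_coe_set_eq, Nat.card_eq_fintype_card,
    card_rootSet_eq_natDegree (galois_poly_separable p (p ^ r) (dvd_pow_self p hr))
      (IsAlgClosed.splits _), FiniteField.X_pow_card_pow_sub_X_natDegree_eq E hr hp.one_lt]

lemma finite_tracePts (β : ZMod p) {r : ℕ} (hr : r ≠ 0) (Ψ : E[X][X]) :
    (tracePts β r Ψ).Finite := by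
  have h := (finite_frobFixed (E := E) (p := p) hr).1
  exact (h.prod h).subset fun P hP => ⟨hP.1, hP.2.1⟩

/-- Upper bound for the number of points of given trace. -/
lemma ncard_tracePts_le {Φ : E[X][X]} (hm : Φ.Monic) (hirr : Irreducible Φ)
    (hlt : Φ.natDegree < p) : ∃ C Q : ℕ, ∀ μ : ℕ, μ ≠ 0 → Q ≤ p ^ μ → ∀ β : ZMod p,
      p * (tracePts β (2 * μ) Φ).ncard ≤ p ^ (2 * μ) + C * p ^ μ := by
  classical
  have : CharP E p := charP_of_injective_algebraMap (algebraMap (ZMod p) E).injective p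
  have hp := (Fact.out : p.Prime)
  set Θ := asPull p Φ with hΘ
  have hΘm : Θ.Monic := asPull_monic hm
  have hΘi : Irreducible Θ := irreducible_asPull hm hirr hlt
  have hdom := isDomain_adjoinRoot_of_irreducible hΘi
  obtain ⟨δ, hδ⟩ := exists_degBound hΘm
  have h0 : Θ.natDegree ≠ 0 := fun h => hΘi.not_isUnit ((isUnit_iff_of_monic hΘm).2 h)
  obtain ⟨D, hD⟩ : ∃ D, D = δ * Θ.natDegree ^ 2 := ⟨_, rfl⟩
  refine ⟨D + D * 1 + 1 ^ 2 + 1 + Θ.natDegree + 1,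
    (D + 1) * (D + D * 1 + 1 ^ 2 + 1 + 2 * Θ.natDegree) + 1, fun μ hμ hQ β => ?_⟩
  have hroots : ∀ t : E, ∃ z : E, z ^ p - z = t := by
    intro t
    obtain ⟨z, hz⟩ := IsAlgClosed.exists_root (wp E p - C t) (by
      rw [degree_sub_C] <;> rw [degree_eq_natDegree monic_wp.ne_zero, natDegree_wp]
      · exact_mod_cast hp.ne_zero
      · exact_mod_cast hp.pos)
    refine ⟨z, ?_⟩
    simpa [wp, sub_eq_zero, IsRoot] using hz
  choose z hz using hroots
  have hev : ∀ a b : E, evalPt E a b Θ = evalPt E (a ^ p - a) b Φ := by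
    intro a b
    rw [evalPt_apply, evalPt_apply, hΘ, asPull, eval₂_map]
    congr 1
    ext <;> simp [wp]
  have hzfrob : ∀ t : E, ∀ r : ℕ, z t ^ p ^ r = z t + ∑ i ∈ Finset.range r, t ^ p ^ i := by
    intro t r
    induction r with
    | zero => simp
    | succ r ih =>
      rw [Finset.sum_range_succ, ← add_assoc, ← ih, ← sub_eq_iff_eq_add', pow_succ', pow_mul,
        ← sub_pow_char_pow, hz]
  let f : ZMod p × (tracePts β (2 * μ) Φ) → (AdjoinRoot Θ →ₐ[E] E) := fun a =>
    pointHom Θ (z := z a.2.1.1 + algebraMap (ZMod p) E a.1) (y := a.2.1.2) (by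
      rw [hev, add_pow_char, ← map_pow, ZMod.pow_card, add_sub_add_right_eq_sub, hz]
      exact a.2.2.2.2.2)
  have hfin : Finite (tracePts β (2 * μ) Φ) := finite_tracePts β (by omega) Φ
  have hfi : Function.Injective f := by
    rintro ⟨i, ⟨⟨t, y⟩, hP⟩⟩ ⟨i', ⟨⟨t', y'⟩, hP'⟩⟩ h
    have h1 := congrArg (fun τ => τ (coordX Θ)) h
    have h2 := congrArg (fun τ => τ (AdjoinRoot.root Θ)) h
    simp only [f, pointHom_coordX, pointHom_root] at h1 h2
    have h3 : t = t' := by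
      have := congrArg (fun x : E => x ^ p - x) h1
      simpa [add_pow_char, ← map_pow, ZMod.pow_card, add_sub_add_right_eq_sub, hz] using this
    subst h3 h2
    have := (algebraMap (ZMod p) E).injective (add_left_cancel h1)
    subst this
    rfl
  have := Fintype.ofFinite (ZMod p × (tracePts β (2 * μ) Φ))
  let P := Finset.univ.image f
  have hPcard : P.card = p * (tracePts β (2 * μ) Φ).ncard := by
    rw [Finset.card_image_of_injective _ hfi, Finset.card_univ, ← Nat.card_eq_fintype_card,
      Nat.card_prod, Nat.card_zmod, Nat.card_coe_set_eq]
  let σ : AdjoinRoot Θ →ₐ[E] AdjoinRoot Θ := AdjoinRoot.liftAlgHom Θ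
    (aeval (coordX Θ + algebraMap E _ (algebraMap (ZMod p) E β))) (AdjoinRoot.root Θ) (by
      have h1 : ((aeval (coordX Θ + algebraMap E _ (algebraMap (ZMod p) E β)) : E[X] →ₐ[E] _) :
          E[X] →+* AdjoinRoot Θ) = (AdjoinRoot.of Θ).comp
            (taylorEquiv (algebraMap (ZMod p) E β) : E[X] →+* E[X]) := by
        refine Polynomial.ringHom_ext (fun a => ?_) ?_
        · simp [taylorEquiv]
          rfl
        · simp [taylorEquiv]
          rfl
      rw [h1, ← eval₂_map]
      have h2 : Θ.map (taylorEquiv (algebraMap (ZMod p) E β) : E[X] →+* E[X]) = Θ :=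
        trl_asPull Φ β
      rw [h2, AdjoinRoot.eval₂_root])
  have hσX : σ (coordX Θ) = coordX Θ + algebraMap E _ (algebraMap (ZMod p) E β) := by
    have : σ (AdjoinRoot.of Θ X) = aeval _ X := AdjoinRoot.liftAlgHom_of ..
    rw [this, aeval_X]
  have hσr : σ (AdjoinRoot.root Θ) = AdjoinRoot.root Θ := AdjoinRoot.liftAlgHom_root ..
  have hX : coordX Θ ∈ (curveFilt δ Θ).F 1 := by
    refine RingFilt.of_mem_adj ?_
    have := (RingFilt.mem_deg_natCast (k := E) (n := 1) (g := X)).2 natDegree_X_le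
    exact_mod_cast this
  have hσF := algHom_mem_filt (curveFilt δ Θ) σ (by
    rw [hσX]
    refine add_mem hX ?_
    rw [Algebra.algebraMap_eq_smul_one]
    exact RingFilt.mono _ zero_le_one (Submodule.smul_mem _ _ (RingFilt.one_mem _)))
    (by rw [hσr]; exact RingFilt.root_mem_adj _ _ _)
  have key := stepanov_bound hΘm h0 hδ (curveFilt δ Θ) 1
    (fun n => by simpa using finrank_curveFilt_le hΘm hδ n) (AlgHom.id E _) σ
    (fun n x hx => hx) hσF hD μ hQ P (by
      intro τ hτ
      obtain ⟨⟨i, ⟨⟨t, y⟩, hP⟩⟩, -, rfl⟩ := Finset.mem_image.1 hτ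
      refine ⟨_, fun x => rfl, ?_, ?_⟩
      · rw [hσX, map_add, AlgHom.commutes]
        simp only [f, pointHom_coordX, Algebra.algebraMap_self, RingHom.id_apply]
        rw [add_pow_char_pow, ← map_pow, ZMod.pow_card_pow, hzfrob, hP.2.2.1]
        ring
      · rw [hσr]
        simp only [f, pointHom_root]
        exact hP.2.1.symm)
  rw [hPcard, one_mul] at key
  exact key

end PointCount

section Residual

variable {E : Type*} [Field E] [IsAlgClosed E] {p : ℕ} [Fact p.Prime] [Algebra (ZMod p) E]

/-- The polynomial has coefficients fixed by the `q`-power map. -/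
def FrobFixed (q : ℕ) (Φ : E[X][X]) : Prop := ∀ i j, ((Φ.coeff i).coeff j) ^ q = (Φ.coeff i).coeff j

lemma evalPt_frob {Φ : E[X][X]} {r : ℕ} (h : FrobFixed (p ^ r) Φ) (z y : E) :
    evalPt E (z ^ p ^ r) (y ^ p ^ r) Φ = evalPt E z y Φ ^ p ^ r := by
  have : CharP E p := charP_of_injective_algebraMap (algebraMap (ZMod p) E).injective p
  have hφ : ∀ x : E, x ^ p ^ r = iterateFrobenius E p r x := fun x => rfl
  rw [hφ, hφ, hφ, evalPt_apply, evalPt_apply, hom_eval₂, eval₂_eq_sum_range, eval₂_eq_sum_range]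
  refine Finset.sum_congr rfl fun i _ => ?_
  congr 1
  simp only [RingHom.coe_coe, RingHom.comp_apply, aeval_eq_sum_range, map_sum, map_mul, map_pow,
    smul_eq_mul]
  refine Finset.sum_congr rfl fun j _ => ?_
  congr 1
  exact (h i j).symm

/-- The complementary factor of `Φ` over its own coordinate ring. -/
noncomputable def residualFactor (Φ : E[X][X]) : (AdjoinRoot Φ)[X] :=
  Φ.map (AdjoinRoot.of Φ) /ₘ (X - C (AdjoinRoot.root Φ))

lemma mul_residualFactor (Φ : E[X][X]) :
    (X - C (AdjoinRoot.root Φ)) * residualFactor Φ = Φ.map (AdjoinRoot.of Φ) :=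
  mul_divByMonic_eq_iff_isRoot.2 (AdjoinRoot.isRoot_root Φ)

lemma residualFactor_monic {Φ : E[X][X]} (hm : Φ.Monic) : (residualFactor Φ).Monic :=
  (monic_X_sub_C _).of_mul_monic_left (by rw [mul_residualFactor]; exact hm.map _)

lemma natDegree_residualFactor {Φ : E[X][X]} (hm : Φ.Monic) [Nontrivial (AdjoinRoot Φ)] :
    (residualFactor Φ).natDegree = Φ.natDegree - 1 := by
  rw [residualFactor, natDegree_divByMonic _ (monic_X_sub_C _), natDegree_X_sub_C, hm.natDegree_map]

lemma residualFactor_mem {Φ : E[X][X]} {δ : ℕ} (hm : Φ.Monic) [Nontrivial (AdjoinRoot Φ)]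
    (h0 : Φ.natDegree ≠ 0)
    (hΦ : DegBound δ Φ) : residualFactor Φ ∈
      ((curveFilt δ Φ).poly δ).F (δ * (residualFactor Φ).natDegree) := by
  intro n
  rw [natDegree_residualFactor hm, residualFactor, coeff_divByMonic_X_sub_C, hm.natDegree_map]
  refine Submodule.sum_mem _ fun i hi => ?_
  rw [Finset.mem_Icc] at hi
  rw [coeff_map]
  have h1 := (curveFilt δ Φ).pow_mem (RingFilt.root_mem_adj (RingFilt.deg E) δ Φ) (i - (n + 1))
  have h2 : AdjoinRoot.of Φ (Φ.coeff i) ∈ (curveFilt δ Φ).F _ := RingFilt.of_mem_adj (hΦ i)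
  have h3 := (curveFilt δ Φ).mul_mem h1 h2
  convert h3 using 2
  push_cast [Nat.cast_sub hi.1, Nat.cast_sub (Nat.one_le_iff_ne_zero.2 h0)]
  ring

/-- Points with first coordinate, but not the second, fixed by Frobenius. -/
def residualPts (q : ℕ) (Φ : E[X][X]) : Set (E × E) :=
  {P | P.1 ^ q = P.1 ∧ P.2 ^ q ≠ P.2 ∧ evalPt E P.1 P.2 Φ = 0}

lemma finite_pts_over {s : Set E} (hs : s.Finite) {Φ : E[X][X]} (hm : Φ.Monic) :
    {P : E × E | P.1 ∈ s ∧ evalPt E P.1 P.2 Φ = 0}.Finite := by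
  have : {P : E × E | P.1 ∈ s ∧ evalPt E P.1 P.2 Φ = 0} ⊆
      ⋃ t ∈ s, (fun y => (t, y)) ''
        ((Φ.map ((aeval t : E[X] →ₐ[E] E) : E[X] →+* E)).rootSet E) := by
    rintro ⟨t, y⟩ ⟨ht, hy⟩
    refine Set.mem_biUnion ht ⟨y, ?_, rfl⟩
    rw [mem_rootSet]
    refine ⟨(hm.map _).ne_zero, ?_⟩
    rw [evalPt_apply, ← eval_map] at hy
    simpa using hy
  refine (hs.biUnion fun t _ => ?_).subset this
  exact (rootSet_finite _ _).image _

lemma ncard_residualPts_le {Φ : E[X][X]} (hm : Φ.Monic) (hirr : Irreducible Φ) :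
    ∃ C Q : ℕ, ∀ μ : ℕ, μ ≠ 0 → Q ≤ p ^ μ → FrobFixed (p ^ (2 * μ)) Φ →
      (residualPts (p ^ (2 * μ)) Φ).ncard ≤ (Φ.natDegree - 1) * p ^ (2 * μ) + C * p ^ μ := by
  classical
  have : CharP E p := charP_of_injective_algebraMap (algebraMap (ZMod p) E).injective p
  have hp := (Fact.out : p.Prime)
  have hdom := isDomain_adjoinRoot_of_irreducible hirr
  obtain ⟨δ, hδ⟩ := exists_degBound hm
  have h0 : Φ.natDegree ≠ 0 := fun h => hirr.not_isUnit ((isUnit_iff_of_monic hm).2 h)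
  obtain ⟨D, hD⟩ : ∃ D, D = δ * Φ.natDegree ^ 2 := ⟨_, rfl⟩
  obtain ⟨ρ, hρ⟩ : ∃ ρ, ρ = Φ.natDegree - 1 := ⟨_, rfl⟩
  refine ⟨D + D * ρ + ρ ^ 2 + 1 + Φ.natDegree + 1,
    (D + ρ) * (D + D * ρ + ρ ^ 2 + 1 + 2 * Φ.natDegree) + 1, fun μ hμ hQ hfix => ?_⟩
  rw [← hρ]
  set q := p ^ (2 * μ) with hq
  have hfin : (residualPts q Φ).Finite :=
    (finite_pts_over (finite_frobFixed (E := E) (p := p) (r := 2 * μ) (by omega)).1 hm).subset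
      fun P hP => ⟨hP.1, hP.2.2⟩
  set G := residualFactor Φ with hG
  have hGm : G.Monic := residualFactor_monic hm
  have hGd : G.natDegree = ρ := by rw [hG, natDegree_residualFactor hm, hρ]
  have hGmem := residualFactor_mem hm h0 hδ
  let S : RingFilt E (AdjoinRoot G) := (curveFilt δ Φ).adj δ G
  let ι : AdjoinRoot Φ →ₐ[E] AdjoinRoot G := AdjoinRoot.ofAlgHom E G
  let σ : AdjoinRoot Φ →ₐ[E] AdjoinRoot G := AdjoinRoot.liftAlgHom Φ
    (ι.comp (AdjoinRoot.ofAlgHom E Φ)) (AdjoinRoot.root G) (by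
      have h1 : ((ι.comp (AdjoinRoot.ofAlgHom E Φ) : E[X] →ₐ[E] _) : E[X] →+* AdjoinRoot G) =
        (AdjoinRoot.of G).comp (AdjoinRoot.of Φ) := rfl
      rw [h1, ← eval₂_map, ← mul_residualFactor, eval₂_mul, ← hG, AdjoinRoot.eval₂_root, mul_zero])
  have hσX : σ (coordX Φ) = ι (coordX Φ) := AdjoinRoot.liftAlgHom_of ..
  have hσr : σ (AdjoinRoot.root Φ) = AdjoinRoot.root G := AdjoinRoot.liftAlgHom_root ..
  have hX : coordX Φ ∈ (curveFilt δ Φ).F 1 := by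
    refine RingFilt.of_mem_adj ?_
    have := (RingFilt.mem_deg_natCast (k := E) (n := 1) (g := X)).2 natDegree_X_le
    exact_mod_cast this
  have hσF := algHom_mem_filt S σ (by rw [hσX]; exact RingFilt.of_mem_adj hX)
    (by rw [hσr]; exact RingFilt.root_mem_adj _ _ _)
  have := hfin.fintype
  let f : residualPts q Φ → (AdjoinRoot Φ →ₐ[E] E) := fun a => pointHom Φ a.2.2.2
  have hfi : Function.Injective f := by
    intro a b h
    have h1 := congrArg (fun τ => τ (coordX Φ)) h
    have h2 := congrArg (fun τ => τ (AdjoinRoot.root Φ)) h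
    simp only [f, pointHom_coordX, pointHom_root] at h1 h2
    exact Subtype.ext (Prod.ext h1 h2)
  let P := Finset.univ.image f
  have hPcard : P.card = (residualPts q Φ).ncard := by
    rw [Finset.card_image_of_injective _ hfi, Finset.card_univ, ← Nat.card_eq_fintype_card,
      Nat.card_coe_set_eq]
  have key := stepanov_bound hm h0 hδ S ρ
    (fun n => by
      have h1 := finrank_curveFilt_le hm hδ n
      have := h1.1
      have h2 := RingFilt.finrank_adj_le (n := (n : ℤ)) (by positivity) hGm hGmem
      refine ⟨h2.1, h2.2.trans ?_⟩
      rw [hGd]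
      calc _ ≤ ρ * (Φ.natDegree * (n + 1)) := Nat.mul_le_mul_left _ (by simpa using h1.2)
        _ = _ := by ring) ι σ
    (fun n x hx => RingFilt.of_mem_adj hx) hσF hD μ hQ P (by
      intro τ hτ
      obtain ⟨a, -, rfl⟩ := Finset.mem_image.1 hτ
      set τ := f a with hτdef
      have hτX : τ (coordX Φ) = a.1.1 := pointHom_coordX _
      have hτr : τ (AdjoinRoot.root Φ) = a.1.2 := pointHom_root _
      have hG0 : G.eval₂ (τ : AdjoinRoot Φ →+* E) (a.1.2 ^ q) = 0 := by
        have h1 : (Φ.map (AdjoinRoot.of Φ)).eval₂ (τ : AdjoinRoot Φ →+* E) (a.1.2 ^ q) = 0 := by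
          have h2 := evalPt_frob hfix a.1.1 a.1.2
          rw [← hq, a.2.2.2, zero_pow (pow_pos hp.pos _).ne', a.2.1, evalPt_apply] at h2
          rw [eval₂_map, ← h2]
          congr 1
          refine Polynomial.ringHom_ext (fun c => ?_) ?_
          · have : τ (algebraMap E _ c) = c := τ.commutes c
            simp only [RingHom.comp_apply, RingHom.coe_coe, aeval_C, Algebra.algebraMap_self,
              RingHom.id_apply]
            exact this
          · simpa using hτX
        rw [← mul_residualFactor, eval₂_mul, ← hG, eval₂_sub, eval₂_X, eval₂_C] at h1
        refine (mul_eq_zero.1 h1).resolve_left ?_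
        refine sub_ne_zero.2 ?_
        have : (τ : AdjoinRoot Φ →+* E) (AdjoinRoot.root Φ) = a.1.2 := hτr
        rw [this]
        exact a.2.2.1
      refine ⟨AdjoinRoot.liftAlgHom G τ (a.1.2 ^ q) hG0,
        fun x => AdjoinRoot.liftAlgHom_of .., ?_, ?_⟩
      · rw [hσX, hτX, ← hq, a.2.1, ← hτX]
        exact AdjoinRoot.liftAlgHom_of ..
      · rw [hσr, hτr]
        exact AdjoinRoot.liftAlgHom_root ..)
  rw [hPcard] at key
  exact key

end Residual

section CommonZeros

variable {k Ω : Type*} [Field k] [Field Ω] [Algebra k Ω] {Φ g : k[X][X]} {δ n : ℕ}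

/-- Bezout-type bound for the common zeros of an irreducible curve and another curve. -/
lemma common_zeros (hm : Φ.Monic) (hirr : Irreducible Φ) (hΦ : DegBound δ Φ)
    (hg : g ∈ ((RingFilt.deg k).poly δ).F n) (hd : ¬ Φ ∣ g) :
    {P : Ω × Ω | evalPt k P.1 P.2 Φ = 0 ∧ evalPt k P.1 P.2 g = 0}.Finite ∧
    {P : Ω × Ω | evalPt k P.1 P.2 Φ = 0 ∧ evalPt k P.1 P.2 g = 0}.ncard ≤ Φ.natDegree * n := by
  have hdom := isDomain_adjoinRoot_of_irreducible hirr
  have hθ : AdjoinRoot.mk Φ g ≠ 0 := fun h => hd (AdjoinRoot.mk_eq_zero.1 h)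
  obtain ⟨h1, h2⟩ := finite_zeros (Ω := Ω) hm hΦ (RingFilt.mk_mem_adj hg) hθ
  have hsub : {P : Ω × Ω | evalPt k P.1 P.2 Φ = 0 ∧ evalPt k P.1 P.2 g = 0} ⊆
      (fun τ : AdjoinRoot Φ →ₐ[k] Ω => (τ (coordX Φ), τ (AdjoinRoot.root Φ))) ''
        {τ | τ (AdjoinRoot.mk Φ g) = 0} := by
    rintro ⟨z, y⟩ ⟨hz, hy⟩
    refine ⟨pointHom Φ hz, ?_, Prod.ext (pointHom_coordX hz) (pointHom_root hz)⟩
    change pointHom Φ hz _ = 0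
    rw [pointHom_mk]
    exact hy
  exact ⟨(h1.image _).subset hsub,
    (Set.ncard_le_ncard hsub (h1.image _)).trans ((Set.ncard_image_le h1).trans h2)⟩

lemma exists_mem_poly (δ : ℕ) (g : k[X][X]) : ∃ n : ℕ, g ∈ ((RingFilt.deg k).poly δ).F n := by
  refine ⟨∑ i ∈ Finset.range (g.natDegree + 1), ((g.coeff i).natDegree + δ * i), fun i => ?_⟩
  by_cases hi : i ≤ g.natDegree
  · have h1 := (RingFilt.mem_deg_natCast (g := g.coeff i)).2 le_rfl
    refine RingFilt.mono _ ?_ h1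
    have h2 := Finset.single_le_sum (f := fun i => (g.coeff i).natDegree + δ * i)
      (fun _ _ => Nat.zero_le _) (Finset.mem_range.2 (Nat.lt_succ_of_le hi))
    have h3 : (((g.coeff i).natDegree + δ * i : ℕ) : ℤ) ≤
      (∑ i ∈ Finset.range (g.natDegree + 1), ((g.coeff i).natDegree + δ * i) : ℕ) := by
      exact_mod_cast h2
    push_cast at h3 ⊢
    linarith
  · rw [coeff_eq_zero_of_natDegree_lt (by omega)]
    exact zero_mem _

lemma finite_common_zeros (hm : Φ.Monic) (hirr : Irreducible Φ) (hd : ¬ Φ ∣ g) :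
    {P : Ω × Ω | evalPt k P.1 P.2 Φ = 0 ∧ evalPt k P.1 P.2 g = 0}.Finite := by
  obtain ⟨δ, hδ⟩ := exists_degBound hm
  obtain ⟨n, hn⟩ := exists_mem_poly δ g
  exact (common_zeros hm hirr hδ hn hd).1

lemma not_dvd_derivative {p : ℕ} [CharP k p] (hm : Φ.Monic) (h0 : Φ.natDegree ≠ 0)
    (hlt : Φ.natDegree < p) : ¬ Φ ∣ derivative Φ := by
  intro h
  have h1 : derivative Φ ≠ 0 := by
    intro h2
    have := congrArg (fun f => coeff f (Φ.natDegree - 1)) h2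
    simp only [coeff_derivative, coeff_zero] at this
    rw [Nat.sub_add_cancel (Nat.one_le_iff_ne_zero.2 h0), coeff_natDegree, hm.leadingCoeff,
      one_mul] at this
    have h3 : ((Φ.natDegree : ℕ) : k[X]) = 0 := by
      rw [← this]
      have h4 := Nat.sub_add_cancel (Nat.one_le_iff_ne_zero.2 h0)
      conv_lhs => rw [← h4]
      push_cast; rfl
    rw [CharP.cast_eq_zero_iff k[X] p] at h3
    exact absurd (Nat.le_of_dvd (Nat.pos_of_ne_zero h0) h3) (by omega)
  exact absurd (degree_le_of_dvd h h1) (not_le.2 (degree_derivative_lt hm.ne_zero))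

end CommonZeros

section Total

variable {E : Type*} [Field E] [IsAlgClosed E] {p : ℕ} [Fact p.Prime] [Algebra (ZMod p) E]

lemma le_ncard_total {Φ : E[X][X]} (hm : Φ.Monic) (hirr : Irreducible Φ)
    (hlt : Φ.natDegree < p) : ∃ C : ℕ, ∀ s : Finset E,
      Φ.natDegree * s.card ≤ {P : E × E | P.1 ∈ s ∧ evalPt E P.1 P.2 Φ = 0}.ncard + C := by
  classical
  have : CharP E p := charP_of_injective_algebraMap (algebraMap (ZMod p) E).injective p
  have h0 : Φ.natDegree ≠ 0 := fun h => hirr.not_isUnit ((isUnit_iff_of_monic hm).2 h)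
  have hZ := finite_common_zeros (Ω := E) hm hirr (not_dvd_derivative (p := p) hm h0 hlt)
  set Z := {P : E × E | evalPt E P.1 P.2 Φ = 0 ∧ evalPt E P.1 P.2 (derivative Φ) = 0}
  refine ⟨Φ.natDegree * Z.ncard, fun s => ?_⟩
  let Φt : E → E[X] := fun t => Φ.map ((aeval t : E[X] →ₐ[E] E) : E[X] →+* E)
  have hΦt : ∀ t y, (Φt t).eval y = evalPt E t y Φ := fun t y => by
    rw [evalPt_apply, ← eval_map]
  have hΦt' : ∀ t y, (derivative (Φt t)).eval y = evalPt E t y (derivative Φ) := fun t y => by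
    rw [evalPt_apply, ← eval_map, derivative_map]
  have hne : ∀ t, Φt t ≠ 0 := fun t => (hm.map _).ne_zero
  let A : E → Finset E := fun t => (Φt t).roots.toFinset
  let B : E → Finset E := fun t => (A t).filter fun y => (derivative (Φt t)).eval y = 0
  have hAB : ∀ t, Φ.natDegree ≤ (A t).card + Φ.natDegree * (B t).card := by
    intro t
    have hcard : (Φt t).roots.card = Φ.natDegree := by
      rw [← (IsAlgClosed.splits (Φt t)).natDegree_eq_card_roots, natDegree_map_aeval hm]
    by_cases hB : (B t).card = 0
    · have hnd : (Φt t).roots.Nodup := by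
        rw [Multiset.nodup_iff_count_le_one]
        intro y
        rw [count_roots]
        by_contra! hlt
        have h1 := (one_lt_rootMultiplicity_iff_isRoot (hne t)).1 hlt
        have : y ∈ B t := by
          simp only [B, A, Finset.mem_filter, Multiset.mem_toFinset, mem_roots (hne t)]
          exact ⟨h1.1, h1.2⟩
        rw [Finset.card_eq_zero.1 hB] at this
        simp at this
      rw [hB, mul_zero, add_zero, ← hcard]
      exact (Multiset.toFinset_card_of_nodup hnd).ge
    · have := Nat.mul_le_mul_left Φ.natDegree (Nat.one_le_iff_ne_zero.2 hB)
      omega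
  have hA : ∑ t ∈ s, (A t).card ≤ {P : E × E | P.1 ∈ s ∧ evalPt E P.1 P.2 Φ = 0}.ncard := by
    rw [← Finset.card_sigma]
    have hinj : Function.Injective (fun P : (_ : E) × E => (P.1, P.2)) := by
      rintro ⟨a, b⟩ ⟨c, d⟩ h
      simpa using h
    rw [← Finset.card_image_of_injective _ hinj, ← Set.ncard_coe_finset]
    refine Set.ncard_le_ncard ?_ (finite_pts_over s.finite_toSet hm)
    intro P hP
    simp only [Finset.coe_image, Set.mem_image, Finset.mem_coe, Finset.mem_sigma] at hP
    obtain ⟨Q, ⟨h1, h2⟩, rfl⟩ := hP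
    refine ⟨h1, ?_⟩
    rw [← hΦt]
    simpa [A, hne] using h2
  have hB : ∑ t ∈ s, (B t).card ≤ Z.ncard := by
    rw [← Finset.card_sigma]
    have hinj : Function.Injective (fun P : (_ : E) × E => (P.1, P.2)) := by
      rintro ⟨a, b⟩ ⟨c, d⟩ h
      simpa using h
    rw [← Finset.card_image_of_injective _ hinj, ← Set.ncard_coe_finset]
    refine Set.ncard_le_ncard ?_ hZ
    intro P hP
    simp only [Finset.coe_image, Set.mem_image, Finset.mem_coe, Finset.mem_sigma] at hP
    obtain ⟨Q, ⟨h1, h2⟩, rfl⟩ := hP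
    simp only [B, A, Finset.mem_filter, Multiset.mem_toFinset, mem_roots (hne _)] at h2
    exact ⟨by rw [← hΦt]; exact h2.1, by rw [← hΦt']; exact h2.2⟩
  calc Φ.natDegree * s.card = ∑ t ∈ s, Φ.natDegree := by simp [mul_comm]
    _ ≤ ∑ t ∈ s, ((A t).card + Φ.natDegree * (B t).card) := Finset.sum_le_sum fun t _ => hAB t
    _ = ∑ t ∈ s, (A t).card + Φ.natDegree * ∑ t ∈ s, (B t).card := by
      rw [Finset.sum_add_distrib, Finset.mul_sum]
    _ ≤ _ := Nat.add_le_add hA (Nat.mul_le_mul_left _ hB)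

end Total

section TraceDistribution

variable {E : Type*} [Field E] [IsAlgClosed E] {p : ℕ} [Fact p.Prime] [Algebra (ZMod p) E]

lemma exists_trace_eq {r : ℕ} {t : E} (ht : t ^ p ^ r = t) :
    ∃ β : ZMod p, ∑ i ∈ Finset.range r, t ^ p ^ i = algebraMap (ZMod p) E β := by
  have : CharP E p := charP_of_injective_algebraMap (algebraMap (ZMod p) E).injective p
  have h : (∑ i ∈ Finset.range r, t ^ p ^ i) ^ p = ∑ i ∈ Finset.range r, t ^ p ^ i := by
    rw [sum_pow_char p]
    have h1 := Finset.sum_range_succ (fun i => t ^ p ^ i) r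
    rw [Finset.sum_range_succ', ht, pow_zero, pow_one, add_left_inj] at h1
    rw [← h1]
    exact Finset.sum_congr rfl fun i _ => by rw [← pow_mul, pow_succ]
  rw [← Subfield.mem_bot_iff_pow_eq_self E p] at h
  obtain ⟨n, hn⟩ := (mem_bot_iff_intCast p E).1 h
  exact ⟨n, by rw [← hn]; simp⟩

lemma abs_sub_le_of_counts {m p q s A B C1 C2 C3 : ℕ} {q' : ℤ} (h0 : m ≠ 0) (hp : 1 ≤ p)
    (hs : 1 ≤ s) (hq' : (q : ℤ) = q') (h7 : p * B ≤ (p - 1) * (q + C1 * s))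
    (h8 : p * A ≤ q + C1 * s) (hq : m * q ≤ (m - 1) * q + C2 * s + (A + B) + C3) :
    |(p : ℤ) * A - q'| ≤ ((p * (C1 + C2 + C3) : ℕ) : ℤ) * s := by
  subst hq'
  obtain ⟨d, rfl⟩ := Nat.exists_eq_add_of_le (Nat.one_le_iff_ne_zero.2 h0)
  obtain ⟨e, rfl⟩ := Nat.exists_eq_add_of_le hp
  rw [Nat.add_sub_cancel_left] at hq h7
  rw [add_mul, one_mul] at hq
  have h1 : q ≤ C2 * s + (A + B) + C3 := by omega
  have h2 : C3 ≤ C3 * s := Nat.le_mul_of_pos_right _ hs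
  have h3 := Nat.mul_le_mul_left (1 + e) (h1.trans (Nat.add_le_add_left h2 _))
  have e1 := Nat.zero_le (C1 * s)
  have e2 := Nat.zero_le (e * (C1 * s))
  have e3 := Nat.zero_le (C2 * s)
  have e4 := Nat.zero_le (e * (C2 * s))
  have e5 := Nat.zero_le (C3 * s)
  have e6 := Nat.zero_le (e * (C3 * s))
  zify at *
  rw [abs_le]
  constructor
  · linarith
  · linarith

lemma abs_tracePts_irreducible {Φ : E[X][X]} (hm : Φ.Monic) (hirr : Irreducible Φ)
    (hlt : Φ.natDegree < p) : ∃ C Q : ℕ, ∀ μ : ℕ, μ ≠ 0 → Q ≤ p ^ μ →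
      FrobFixed (p ^ (2 * μ)) Φ → ∀ β : ZMod p,
      |(p : ℤ) * (tracePts β (2 * μ) Φ).ncard - p ^ (2 * μ)| ≤ C * p ^ μ := by
  classical
  have hp := (Fact.out : p.Prime)
  have h0 : Φ.natDegree ≠ 0 := fun h => hirr.not_isUnit ((isUnit_iff_of_monic hm).2 h)
  obtain ⟨C1, Q1, h1⟩ := ncard_tracePts_le (p := p) hm hirr hlt
  obtain ⟨C2, Q2, h2⟩ := ncard_residualPts_le (p := p) hm hirr
  obtain ⟨C3, h3⟩ := le_ncard_total (p := p) hm hirr hlt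
  refine ⟨p * (C1 + C2 + C3), Q1 + Q2, fun μ hμ hQ hF β => ?_⟩
  have h1 := h1 μ hμ (by omega)
  have h2 := h2 μ hμ (by omega) hF
  obtain ⟨hfin, hcard⟩ := finite_frobFixed (E := E) (p := p) (r := 2 * μ) (by omega)
  have h3 := h3 hfin.toFinset
  rw [← Set.ncard_eq_toFinset_card _ hfin, hcard] at h3
  have hsub : {P : E × E | P.1 ∈ hfin.toFinset ∧ evalPt E P.1 P.2 Φ = 0} ⊆
      residualPts (p ^ (2 * μ)) Φ ∪ ⋃ β : ZMod p, tracePts β (2 * μ) Φ := by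
    rintro P ⟨hP1, hP2⟩
    rw [Set.Finite.mem_toFinset] at hP1
    by_cases hy : P.2 ^ p ^ (2 * μ) = P.2
    · obtain ⟨b, hb⟩ := exists_trace_eq hP1
      exact Or.inr (Set.mem_iUnion.2 ⟨b, hP1, hy, hb, hP2⟩)
    · exact Or.inl ⟨hP1, hy, hP2⟩
  have hfr : (residualPts (p ^ (2 * μ)) Φ).Finite :=
    (finite_pts_over hfin hm).subset fun P hP => ⟨hP.1, hP.2.2⟩
  have hfu : (⋃ β : ZMod p, tracePts β (2 * μ) Φ).Finite :=
    Set.finite_iUnion fun b => finite_tracePts b (by omega) Φ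
  have h4 := (Set.ncard_le_ncard hsub (hfr.union hfu)).trans (Set.ncard_union_le _ _)
  have h5 : (⋃ b : ZMod p, tracePts b (2 * μ) Φ).ncard ≤
      ∑ b : ZMod p, (tracePts b (2 * μ) Φ).ncard := by
    have := Finset.set_ncard_biUnion_le (Finset.univ : Finset (ZMod p))
      (fun b => tracePts b (2 * μ) Φ)
    simpa using this
  have h6 : ∑ b : ZMod p, (tracePts b (2 * μ) Φ).ncard =
      (tracePts β (2 * μ) Φ).ncard + ∑ b ∈ Finset.univ.erase β, (tracePts b (2 * μ) Φ).ncard :=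
    (Finset.add_sum_erase _ _ (Finset.mem_univ β)).symm
  have h7 : p * ∑ b ∈ Finset.univ.erase β, (tracePts b (2 * μ) Φ).ncard ≤
      (p - 1) * (p ^ (2 * μ) + C1 * p ^ μ) := by
    rw [Finset.mul_sum]
    refine (Finset.sum_le_card_nsmul _ _ _ fun b _ => h1 b).trans ?_
    rw [Finset.card_erase_of_mem (Finset.mem_univ _), Finset.card_univ, ZMod.card, smul_eq_mul]
  have h8 := h1 β
  have hp1 : 1 ≤ p ^ μ := Nat.one_le_pow _ _ hp.pos
  have hq : Φ.natDegree * p ^ (2 * μ) ≤ (Φ.natDegree - 1) * p ^ (2 * μ) + C2 * p ^ μ +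
      ((tracePts β (2 * μ) Φ).ncard +
        ∑ b ∈ Finset.univ.erase β, (tracePts b (2 * μ) Φ).ncard) + C3 := by omega
  exact abs_sub_le_of_counts h0 hp.one_le hp1 (by exact_mod_cast rfl) h7 h8 hq

lemma exists_frob_fixed [Algebra.IsAlgebraic (ZMod p) E] (s : Finset E) :
    ∃ r : ℕ, 0 < r ∧ ∀ μ, r ∣ μ → ∀ x ∈ s, x ^ p ^ μ = x := by
  classical
  induction s using Finset.induction_on with
  | empty => exact ⟨1, one_pos, by simp⟩
  | insert a s _ ih =>
    obtain ⟨r, hr, h⟩ := ih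
    have ha : IsIntegral (ZMod p) a := Algebra.IsIntegral.isIntegral a
    have : FiniteDimensional (ZMod p) (IntermediateField.adjoin (ZMod p) {a}) :=
      IntermediateField.adjoin.finiteDimensional ha
    have : Finite (IntermediateField.adjoin (ZMod p) {a}) := Module.finite_of_finite (ZMod p)
    have := Fintype.ofFinite (IntermediateField.adjoin (ZMod p) {a})
    set d := Module.finrank (ZMod p) (IntermediateField.adjoin (ZMod p) {a})
    have hd : 0 < d := Module.finrank_pos
    have hcard : Fintype.card (IntermediateField.adjoin (ZMod p) {a}) = p ^ d := by
      rw [Module.card_eq_pow_finrank (K := ZMod p), ZMod.card]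
    have hfix : ∀ n, a ^ (p ^ d) ^ n = a := fun n => by
      have := FiniteField.pow_card_pow n (⟨a, IntermediateField.mem_adjoin_simple_self _ a⟩ :
        IntermediateField.adjoin (ZMod p) {a})
      rw [hcard] at this
      exact congrArg Subtype.val this
    refine ⟨r * d, Nat.mul_pos hr hd, fun μ hμ x hx => ?_⟩
    rcases Finset.mem_insert.1 hx with rfl | hx
    · obtain ⟨n, rfl⟩ := (Dvd.intro_left r rfl : d ∣ r * d).trans hμ
      rw [pow_mul]; exact hfix n
    · exact h μ ((Dvd.intro d rfl : r ∣ r * d).trans hμ) x hx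

lemma exists_frobFixed [Algebra.IsAlgebraic (ZMod p) E] (Φ : E[X][X]) :
    ∃ r : ℕ, 0 < r ∧ ∀ μ, r ∣ μ → FrobFixed (p ^ μ) Φ := by
  classical
  obtain ⟨r, hr, h⟩ := exists_frob_fixed (p := p)
    (Φ.support.biUnion fun i => (Φ.coeff i).support.image fun j => (Φ.coeff i).coeff j)
  have hp := (Fact.out : p.Prime)
  refine ⟨r, hr, fun μ hμ i j => ?_⟩
  by_cases h1 : (Φ.coeff i).coeff j = 0
  · rw [h1, zero_pow (pow_ne_zero _ hp.ne_zero)]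
  · refine h μ hμ _ (Finset.mem_biUnion.2 ⟨i, ?_, Finset.mem_image.2 ⟨j, ?_, rfl⟩⟩)
    · rw [mem_support_iff]; rintro h2; simp [h2] at h1
    · rwa [mem_support_iff]

lemma abs_tracePts_general [Algebra.IsAlgebraic (ZMod p) E] {Ψ : E[X][X]} (hm : Ψ.Monic)
    (hlt : Ψ.natDegree < p) : ∃ C M r₀ : ℕ, 0 < r₀ ∧ ∀ μ : ℕ, μ ≠ 0 → r₀ ∣ μ → ∀ β : ZMod p,
      |(p : ℤ) * (tracePts β (2 * μ) Ψ).ncard - M * p ^ (2 * μ)| ≤ C * p ^ μ := by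
  classical
  have hp := (Fact.out : p.Prime)
  induction hd : Ψ.natDegree using Nat.strong_induction_on generalizing Ψ with
  | _ d ih =>
  rcases eq_or_ne Ψ.natDegree 0 with h0 | h0
  · refine ⟨0, 0, 1, one_pos, fun μ _ _ β => ?_⟩
    have h1 : Ψ = 1 := hm.natDegree_eq_zero.1 h0
    have : tracePts β (2 * μ) Ψ = ∅ := by
      ext P
      simp [tracePts, h1]
    simp [this]
  obtain ⟨Φ, hΦm, hΦi, Ψ', rfl⟩ := exists_monic_irreducible_dvd hm h0
  have hΨ'm : Ψ'.Monic := hΦm.of_mul_monic_left hm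
  have hΦ0 : Φ.natDegree ≠ 0 := fun h => hΦi.not_isUnit ((isUnit_iff_of_monic hΦm).2 h)
  have hdeg := hΦm.natDegree_mul hΨ'm
  obtain ⟨C', M', r', hr', h'⟩ := ih Ψ'.natDegree (by omega) hΨ'm (by omega) rfl
  by_cases hdvd : Φ ∣ Ψ'
  · refine ⟨C', M', r', hr', fun μ hμ hr β => ?_⟩
    have : tracePts β (2 * μ) (Φ * Ψ') = tracePts β (2 * μ) Ψ' := by
      ext P
      simp only [tracePts, Set.mem_ofPred_eq, map_mul, mul_eq_zero]
      obtain ⟨g, rfl⟩ := hdvd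
      simp only [map_mul, mul_eq_zero]
      tauto
    rw [this]
    exact h' μ hμ hr β
  obtain ⟨C, Q, h⟩ := abs_tracePts_irreducible (p := p) hΦm hΦi (by omega)
  obtain ⟨r, hr, hF⟩ := exists_frobFixed (p := p) Φ
  have hZ := finite_common_zeros (Ω := E) hΦm hΦi hdvd
  set Z := {P : E × E | evalPt E P.1 P.2 Φ = 0 ∧ evalPt E P.1 P.2 Ψ' = 0}
  refine ⟨C + C' + p * Z.ncard, 1 + M', r * r' * (Q + 1), by positivity, fun μ hμ hdv β => ?_⟩
  have hμQ : Q ≤ p ^ μ := by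
    have h1 := Nat.le_of_dvd (Nat.pos_of_ne_zero hμ) hdv
    have h2 := (Nat.lt_pow_self hp.one_lt : μ < p ^ μ)
    have h3 : Q + 1 ≤ r * r' * (Q + 1) := Nat.le_mul_of_pos_left _ (by positivity)
    omega
  have h1 := h μ hμ hμQ (hF _ ((Dvd.intro (r' * (Q + 1)) (mul_assoc _ _ _).symm).trans
    (hdv.trans (Dvd.intro_left 2 rfl)))) β
  have h2 := h' μ hμ ((Dvd.intro_left r rfl).trans ((Dvd.intro (Q + 1) rfl).trans hdv)) β
  have hun : tracePts β (2 * μ) (Φ * Ψ') = tracePts β (2 * μ) Φ ∪ tracePts β (2 * μ) Ψ' := by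
    ext P
    simp only [tracePts, Set.mem_ofPred_eq, map_mul, mul_eq_zero, Set.mem_union]
    tauto
  have hf1 := finite_tracePts β (by omega : 2 * μ ≠ 0) Φ
  have hf2 := finite_tracePts β (by omega : 2 * μ ≠ 0) Ψ'
  have h3 := Set.ncard_union_add_ncard_inter _ _ hf1 hf2
  rw [← hun] at h3
  have h4 : (tracePts β (2 * μ) Φ ∩ tracePts β (2 * μ) Ψ').ncard ≤ Z.ncard :=
    Set.ncard_le_ncard (fun P hP => ⟨hP.1.2.2.2, hP.2.2.2.2⟩) hZ
  have hp1 : 1 ≤ p ^ μ := Nat.one_le_pow _ _ hp.pos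
  zify at h3 h4 hp1
  have h5 : (p : ℤ) * (tracePts β (2 * μ) Φ ∩ tracePts β (2 * μ) Ψ').ncard ≤
      p * Z.ncard * p ^ μ := by
    have : (0 : ℤ) ≤ p * Z.ncard := by positivity
    have := mul_le_mul_of_nonneg_left h4 (by positivity : (0 : ℤ) ≤ p)
    nlinarith
  have h6 : (0 : ℤ) ≤ (p : ℤ) * (tracePts β (2 * μ) Φ ∩ tracePts β (2 * μ) Ψ').ncard := by
    positivity
  have h7 := congrArg (fun x : ℤ => (p : ℤ) * x) h3
  simp only [mul_add] at h7
  rw [abs_le] at h1 h2 ⊢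
  have h8 : (0 : ℤ) ≤ C * p ^ μ := by positivity
  push_cast
  constructor <;> nlinarith

/-- Square-root cancellation for exponential sums over a curve in towers of even extensions. -/
lemma norm_sum_tracePts_le [Algebra.IsAlgebraic (ZMod p) E] {Ψ : E[X][X]} (hm : Ψ.Monic)
    (hlt : Ψ.natDegree < p) {ψ : AddChar (ZMod p) ℂ} (hψ : ψ ≠ 0) :
    ∃ C r₀ : ℕ, 0 < r₀ ∧ ∀ μ : ℕ, μ ≠ 0 → r₀ ∣ μ →
      ‖∑ β : ZMod p, ψ β * (tracePts β (2 * μ) Ψ).ncard‖ ≤ C * (p : ℝ) ^ μ := by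
  have hp := (Fact.out : p.Prime)
  obtain ⟨C, M, r, hr, h⟩ := abs_tracePts_general (p := p) hm hlt
  refine ⟨C, r, hr, fun μ hμ hdv => ?_⟩
  have hp0 : (0 : ℝ) < p := by exact_mod_cast hp.pos
  have h1 : (p : ℂ) * ∑ β : ZMod p, ψ β * (tracePts β (2 * μ) Ψ).ncard =
      ∑ β : ZMod p, ψ β * (((p : ℤ) * (tracePts β (2 * μ) Ψ).ncard - M * p ^ (2 * μ) : ℤ) : ℂ) := by
    push_cast
    simp only [mul_sub, Finset.sum_sub_distrib]
    rw [← Finset.sum_mul, AddChar.sum_eq_zero_of_ne_one hψ, zero_mul, sub_zero, Finset.mul_sum]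
    exact Finset.sum_congr rfl fun _ _ => by ring
  have h2 : (p : ℝ) * ‖∑ β : ZMod p, ψ β * (tracePts β (2 * μ) Ψ).ncard‖ ≤
      p * (C * (p : ℝ) ^ μ) := by
    have h3 : (p : ℝ) = ‖(p : ℂ)‖ := by simp
    nth_rewrite 1 [h3]
    rw [← norm_mul, h1]
    refine (norm_sum_le _ _).trans ((Finset.sum_le_card_nsmul _ _ (C * (p : ℝ) ^ μ)
      fun β _ => ?_).trans ?_)
    · rw [norm_mul, AddChar.norm_apply, one_mul, Complex.norm_intCast]
      exact_mod_cast h μ hμ hdv β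
    · rw [Finset.card_univ, ZMod.card, nsmul_eq_mul]
  exact le_of_mul_le_mul_left h2 hp0

end TraceDistribution

noncomputable section SeparableNormalClosure

open Ideal Ring

variable (R S : Type*) [CommRing R] [CommRing S] [IsDomain R] [IsDomain S]
  [Algebra R S] [Module.IsTorsionFree R S]

local instance algebraFractionRing : Algebra (FractionRing R) (FractionRing S) :=
  FractionRing.liftAlgebra _ _

local notation "EE" => IntermediateField.normalClosure (FractionRing R) (FractionRing S) (AlgebraicClosure (FractionRing S))
local notation "KK" => FractionRing R
local notation "LL" => FractionRing S
local notation "TT" => Ring.NormalClosure R S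

local instance : Algebra S EE := ((algebraMap LL EE).comp (algebraMap S LL)).toAlgebra

local instance : IsScalarTower S LL EE := IsScalarTower.of_algebraMap_eq' rfl

local instance : Algebra TT EE := inferInstanceAs (Algebra (integralClosure S EE) EE)

local instance : IsScalarTower S TT EE :=
  inferInstanceAs (IsScalarTower S (integralClosure S EE) EE)

local instance : IsIntegralClosure TT S EE := integralClosure.isIntegralClosure S EE

local instance : IsScalarTower R LL EE := IsScalarTower.to₁₃₄ R KK LL EE

local instance : IsScalarTower R S EE := IsScalarTower.to₁₂₄ R S LL EE

local instance : IsScalarTower R TT EE := IsScalarTower.to₁₃₄ R S TT EE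

variable [Module.Finite R S]

local instance : FiniteDimensional LL EE := Module.Finite.right KK LL EE

local instance : IsFractionRing TT EE :=
  integralClosure.isFractionRing_of_finite_extension LL EE

variable [Algebra.IsSeparable (FractionRing R) (FractionRing S)]

lemma isSeparable_fracNormalClosure_bot : Algebra.IsSeparable KK EE := by
  rw [← le_separableClosure_iff, normalClosure_le_iff]
  rintro f _ ⟨x, rfl⟩
  exact mem_separableClosure_iff.2
    (IsSeparable.map f f.injective (Algebra.IsSeparable.isSeparable KK x))

lemma isGalois_frac_normalClosure : IsGalois KK (FractionRing TT) := by
  have := isSeparable_fracNormalClosure_bot R S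
  have : Normal KK EE := inferInstance
  have : IsGalois KK EE := ⟨⟩
  refine IsGalois.of_equiv_equiv (F := KK) (E := EE)
    (f := (FractionRing.algEquiv R KK).symm.toRingEquiv)
    (g := (FractionRing.algEquiv TT EE).symm.toRingEquiv) ?_
  ext
  simpa using! IsFractionRing.algEquiv_commutes (FractionRing.algEquiv R KK).symm
    (FractionRing.algEquiv TT EE).symm _

lemma isSeparable_fracNormalClosure : Algebra.IsSeparable LL EE :=
  have := isSeparable_fracNormalClosure_bot R S
  Algebra.isSeparable_tower_top_of_isSeparable KK LL EE

set_option linter.overlappingInstances false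

variable [IsDedekindDomain S]

lemma finite_normalClosure : Module.Finite S TT :=
  have := isSeparable_fracNormalClosure R S
  IsIntegralClosure.finite S LL EE TT

lemma isDedekindDomain_normalClosure : IsDedekindDomain TT :=
  have := isSeparable_fracNormalClosure R S
  integralClosure.isDedekindDomain S LL EE

variable {R S} in
/-- The relative norm of a prime ideal in a separable extension. -/
theorem relNorm_eq_pow_of_separable [IsDedekindDomain R] (P : Ideal S) (p : Ideal R)
    [P.LiesOver p] [P.IsMaximal] [p.IsMaximal] :
    relNorm R P = p ^ P.inertiaDeg R := by
  have := finite_normalClosure R S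
  have := isDedekindDomain_normalClosure R S
  have : Module.Finite R TT := Module.Finite.trans S TT
  have := isGalois_frac_normalClosure R S
  obtain ⟨Q, hQ₁, hQ₂⟩ : ∃ Q : Ideal TT, Q.IsMaximal ∧ Q.LiesOver P :=
    exists_maximal_ideal_liesOver_of_isIntegral P
  have : Q.LiesOver p := LiesOver.trans Q P p
  have h := relNorm_eq_pow_of_isPrime_isGalois Q p
  have : IsGalois (FractionRing S) (FractionRing TT) :=
    IsGalois.tower_top_of_isGalois (FractionRing R) (FractionRing S) (FractionRing TT)
  rwa [← relNorm_relNorm R S, relNorm_eq_pow_of_isPrime_isGalois Q P, map_pow,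
    inertiaDeg_tower (R := R) P Q, pow_mul, pow_left_inj (inertiaDeg_pos Q S).ne'] at h

end SeparableNormalClosure

section IdealNorm

variable {k R : Type*} [Field k] [CommRing R] [IsDedekindDomain R]
  [Algebra k[X] R] [Module.Finite k[X] R] [Module.IsTorsionFree k[X] R]

/-- The monic generator of the relative norm of an ideal. -/
noncomputable def normPoly (I : Ideal R) : k[X] :=
  Submodule.IsPrincipal.generator (Ideal.relNorm k[X] I) *
    C (Submodule.IsPrincipal.generator (Ideal.relNorm k[X] I)).leadingCoeff⁻¹

lemma span_normPoly (I : Ideal R) :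
    Ideal.span {(normPoly I : k[X])} = Ideal.relNorm k[X] I := by
  by_cases h : Submodule.IsPrincipal.generator (Ideal.relNorm k[X] I) = 0
  · rw [normPoly, h, zero_mul, ← h, Ideal.span_singleton_generator]
  · rw [normPoly, Ideal.span_singleton_mul_right_unit, Ideal.span_singleton_generator]
    rw [isUnit_C, isUnit_iff_ne_zero]
    simpa using h

lemma monic_normPoly {I : Ideal R} (hI : I ≠ ⊥) : (normPoly I : k[X]).Monic := by
  refine monic_mul_leadingCoeff_inv fun h => hI ?_
  rw [← Ideal.relNorm_eq_bot_iff (R := k[X]), ← Ideal.span_singleton_generator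
    (Ideal.relNorm k[X] I), h]
  simp

lemma normPoly_eq_of_span {I : Ideal R} {g : k[X]} (hg : g.Monic)
    (h : Ideal.span {g} = Ideal.relNorm k[X] I) : normPoly I = g := by
  have hI : I ≠ ⊥ := by
    rintro rfl
    rw [Ideal.relNorm_bot, Ideal.span_singleton_eq_bot] at h
    exact hg.ne_zero h
  rw [← span_normPoly, Ideal.span_singleton_eq_span_singleton] at h
  exact (eq_of_monic_of_associated hg (monic_normPoly hI) h).symm

lemma normPoly_mul {I J : Ideal R} (hI : I ≠ ⊥) (hJ : J ≠ ⊥) :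
    (normPoly (I * J) : k[X]) = normPoly I * normPoly J := by
  refine normPoly_eq_of_span ((monic_normPoly hI).mul (monic_normPoly hJ)) ?_
  rw [← Ideal.span_singleton_mul_span_singleton, span_normPoly, span_normPoly, map_mul]

lemma normPoly_top : (normPoly (⊤ : Ideal R) : k[X]) = 1 :=
  normPoly_eq_of_span monic_one (by simp)

lemma C_mul_normPoly_span (x : R) :
    normPoly (Ideal.span {x}) * C (Algebra.norm k[X] x).leadingCoeff = Algebra.norm k[X] x := by
  have : Module.Free k[X] R := inferInstance
  by_cases hx : Algebra.norm k[X] x = 0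
  · simp [hx]
  have h : (normPoly (Ideal.span {x}) : k[X]) =
      Algebra.norm k[X] x * C (Algebra.norm k[X] x).leadingCoeff⁻¹ := by
    refine normPoly_eq_of_span (monic_mul_leadingCoeff_inv hx) ?_
    rw [Ideal.relNorm_singleton, Algebra.intNorm_eq_norm, Ideal.span_singleton_mul_right_unit]
    rw [isUnit_C, isUnit_iff_ne_zero]
    simpa using hx
  rw [h, mul_assoc, ← C_mul, inv_mul_cancel₀ (by simpa using hx), C_1, mul_one]

end IdealNorm

section IdealDegree

variable {k R : Type*} [Field k] [Finite k] [CommRing R] [IsDedekindDomain R]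
  [Algebra k[X] R] [Module.Finite k[X] R] [Module.IsTorsionFree k[X] R] [Algebra k R]
  [IsScalarTower k k[X] R]

instance : Ring.HasFiniteQuotients k[X] where
  finiteQuotient {I} hI := by
    obtain ⟨f, rfl⟩ := Submodule.IsPrincipal.principal I
    have hf : f ≠ 0 := by rintro rfl; simp at hI
    have : Module.Finite k (k[X] ⧸ Ideal.span {f}) := PowerBasis.finite (AdjoinRoot.powerBasis hf)
    exact Module.finite_of_finite k (M := k[X] ⧸ Ideal.span {f})

lemma finite_quotient_ideal (k : Type*) {R : Type*} [Field k] [Finite k] [CommRing R]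
    [IsDedekindDomain R] [Algebra k[X] R] [Module.Finite k[X] R] [Module.IsTorsionFree k[X] R]
    {I : Ideal R} (hI : I ≠ ⊥) : Finite (R ⧸ I) :=
  (Ring.HasFiniteQuotients.of_module_finite k[X] R).finiteQuotient hI

variable (k) in
lemma finiteDimensional_quotient_ideal {I : Ideal R} (hI : I ≠ ⊥) :
    FiniteDimensional k (R ⧸ I) :=
  have := finite_quotient_ideal k hI
  inferInstance

lemma finrank_quotient_prime_mul {I P : Ideal R} (hI : I ≠ ⊥) (hP : P.IsMaximal) (h0 : P ≠ ⊥) :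
    Module.finrank k (R ⧸ (P * I)) = Module.finrank k (R ⧸ P) + Module.finrank k (R ⧸ I) := by
  have hlt : P * I < I := by
    refine lt_of_le_of_ne Ideal.mul_le_right fun h => hP.ne_top ?_
    rw [← Ideal.one_eq_top]
    exact mul_right_cancel₀ hI (by rw [h, one_mul])
  obtain ⟨a, haI, haPI⟩ := SetLike.exists_of_lt hlt
  have hsup : P * I ⊔ Ideal.span {a} = I := by
    have h1 : I ∣ P * I ⊔ Ideal.span {a} := by
      rw [Ideal.dvd_iff_le]
      exact sup_le hlt.le ((Ideal.span_singleton_le_iff_mem _).2 haI)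
    obtain ⟨J, hJ⟩ := h1
    have h2 : P ≤ J := by
      have : P * I ≤ J * I := by rw [mul_comm J, ← hJ]; exact le_sup_left
      rw [← Ideal.dvd_iff_le] at this ⊢
      exact (mul_dvd_mul_iff_right hI).1 this
    by_cases h : J = ⊤
    · rw [hJ, h, Ideal.mul_top]
    · refine absurd ?_ haPI
      rw [hP.eq_of_le h h2, mul_comm J, ← hJ]
      exact Ideal.mem_sup_right (Ideal.mem_span_singleton_self a)
  have := finiteDimensional_quotient_ideal k (mul_ne_zero h0 hI)
  let f : R →ₗ[k] R ⧸ (P * I) :=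
    (Ideal.Quotient.mkₐ k (P * I)).toLinearMap ∘ₗ LinearMap.mulRight k a
  let g : (R ⧸ (P * I)) →ₗ[k] R ⧸ I := (Ideal.Quotient.factorₐ k hlt.le).toLinearMap
  have hf (x : R) : f x = Ideal.Quotient.mk (P * I) (x * a) := rfl
  have hg (x : R) : g (Ideal.Quotient.mk (P * I) x) = Ideal.Quotient.mk I x := rfl
  have hker : LinearMap.ker f = P.restrictScalars k := by
    let Q : Ideal R := Submodule.comap (LinearMap.mulRight R a) (P * I)
    have hQ (x : R) : x ∈ Q ↔ x * a ∈ P * I := Iff.rfl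
    have : P = Q := by
      refine hP.eq_of_le ?_ ?_
      · rw [Ne, Ideal.eq_top_iff_one, hQ, one_mul]
        exact haPI
      · intro x hx
        exact (hQ x).2 (Ideal.mul_mem_mul hx haI)
    ext x
    rw [LinearMap.mem_ker, hf, Ideal.Quotient.eq_zero_iff_mem, ← hQ, ← this]
    rfl
  have hrange : LinearMap.range f = LinearMap.ker g := by
    ext y
    obtain ⟨y, rfl⟩ := Ideal.Quotient.mk_surjective y
    rw [LinearMap.mem_ker, hg, Ideal.Quotient.eq_zero_iff_mem, LinearMap.mem_range]
    constructor
    · rintro ⟨x, hx⟩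
      rw [hf, Ideal.Quotient.eq] at hx
      have := I.sub_mem (I.mul_mem_left x haI) (hlt.le hx)
      simpa using this
    · intro hy
      rw [← hsup] at hy
      obtain ⟨u, hu, v, hv, rfl⟩ := Submodule.mem_sup.1 hy
      obtain ⟨x, rfl⟩ := Ideal.mem_span_singleton'.1 hv
      refine ⟨x, ?_⟩
      rw [hf, Ideal.Quotient.eq]
      simpa using hu
  have hgs : LinearMap.range g = ⊤ := by
    rw [LinearMap.range_eq_top]
    intro y
    obtain ⟨y, rfl⟩ := Ideal.Quotient.mk_surjective y
    exact ⟨_, hg y⟩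
  have e1 := LinearMap.finrank_range_add_finrank_ker g
  rw [hgs, finrank_top, ← hrange, ← (LinearMap.quotKerEquivRange f).finrank_eq, hker] at e1
  rw [← e1, add_comm]
  rfl

variable (k R) in
/-- The relative norm of a maximal ideal is the expected power of the prime below. -/
def RelNormPrime : Prop :=
  ∀ P : Ideal R, P.IsMaximal → Ideal.relNorm k[X] P = (P.under k[X]) ^ P.inertiaDeg k[X]

/-- The prime polynomial below a maximal ideal. -/
lemma exists_normPoly_prime (hrel : RelNormPrime k R) {P : Ideal R} (hP : P.IsMaximal)
    (h0 : P ≠ ⊥) : ∃ π : k[X], π.Monic ∧ Irreducible π ∧ P.under k[X] = Ideal.span {π} ∧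
      normPoly P = π ^ P.inertiaDeg k[X] ∧
      Module.finrank k (R ⧸ P) = π.natDegree * P.inertiaDeg k[X] := by
  have hu : P.under k[X] ≠ ⊥ := Ideal.under_ne_bot k[X] h0
  have hum : (P.under k[X]).IsMaximal := by
    have : (P.under k[X]).IsPrime := inferInstance
    exact this.isMaximal hu
  set g := Submodule.IsPrincipal.generator (P.under k[X]) with hg
  have hgs : Ideal.span {g} = P.under k[X] := Ideal.span_singleton_generator _
  have hg0 : g ≠ 0 := by
    intro h
    rw [h, Ideal.span_singleton_eq_bot.2 rfl] at hgs
    exact hu hgs.symm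
  have hunit : IsUnit (C g.leadingCoeff⁻¹) := by
    rw [isUnit_C, isUnit_iff_ne_zero]
    simpa using hg0
  have hm := monic_mul_leadingCoeff_inv hg0
  set π := g * C g.leadingCoeff⁻¹ with hπ
  have hs : P.under k[X] = Ideal.span {π} := by
    rw [hπ, Ideal.span_singleton_mul_right_unit hunit, hgs]
  have hirr : Irreducible π := by
    have := hum.isPrime
    rw [hs, Ideal.span_singleton_prime hm.ne_zero] at this
    exact this.irreducible
  refine ⟨π, hm, hirr, hs, normPoly_eq_of_span (hm.pow _) ?_, ?_⟩
  · rw [hrel P hP, hs, Ideal.span_singleton_pow]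
  · let : Field (k[X] ⧸ P.under k[X]) := Ideal.Quotient.field _
    have := Ideal.inertiaDeg_eq_of_isMaximal (P.under k[X]) P
    rw [this, ← finrank_quotient_span_eq_natDegree (f := π), ← hs]
    exact (Module.finrank_mul_finrank k (k[X] ⧸ P.under k[X]) (R ⧸ P)).symm

lemma finrank_quotient_eq_natDegree (hrel : RelNormPrime k R) {I : Ideal R} (hI : I ≠ ⊥) :
    Module.finrank k (R ⧸ I) = (normPoly I : k[X]).natDegree := by
  induction I using UniqueFactorizationMonoid.induction_on_prime with
  | h₁ => exact absurd rfl hI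
  | h₂ I hu =>
    obtain rfl : I = ⊤ := by simpa [Ideal.isUnit_iff] using hu
    rw [normPoly_top, natDegree_one, Module.finrank_eq_zero_iff_of_free]
    infer_instance
  | h₃ I P hI0 hP ih =>
    have hm : P.IsMaximal := (Ideal.isPrime_of_prime hP).isMaximal hP.ne_zero
    obtain ⟨π, hπm, -, -, h1, h2⟩ := exists_normPoly_prime hrel hm hP.ne_zero
    rw [finrank_quotient_prime_mul hI0 hm hP.ne_zero, normPoly_mul hP.ne_zero hI0,
      (monic_normPoly hP.ne_zero).natDegree_mul (monic_normPoly hI0), ih hI0, h1,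
      hπm.natDegree_pow, h2, mul_comm]

/-- The trace of an ideal: minus the subleading coefficient of its norm. -/
noncomputable def idealTrace (I : Ideal R) : k := -(normPoly I : k[X]).nextCoeff

lemma idealTrace_mul {I J : Ideal R} (hI : I ≠ ⊥) (hJ : J ≠ ⊥) :
    (idealTrace (I * J) : k) = idealTrace I + idealTrace J := by
  rw [idealTrace, normPoly_mul hI hJ, (monic_normPoly hI).nextCoeff_mul (monic_normPoly hJ),
    neg_add]
  rfl

lemma idealTrace_prime (hrel : RelNormPrime k R) {P : Ideal R} (hP : P.IsMaximal)
    (h0 : P ≠ ⊥) :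
    (idealTrace P : k) = Algebra.trace k (R ⧸ P) (Ideal.Quotient.mk P (algebraMap k[X] R X)) := by
  obtain ⟨π, hm, hirr, hu, h1, h2⟩ := exists_normPoly_prime hrel hP h0
  let : Field (R ⧸ P) := Ideal.Quotient.field _
  have := finiteDimensional_quotient_ideal k h0
  set x : R ⧸ P := Ideal.Quotient.mk P (algebraMap k[X] R X) with hx
  have hev (g : k[X]) : aeval x g = Ideal.Quotient.mk P (algebraMap k[X] R g) := by
    have : aeval x = (Ideal.Quotient.mkₐ k P).comp (IsScalarTower.toAlgHom k k[X] R) := by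
      ext
      simp [hx]
    rw [this]
    rfl
  have hmin : minpoly k x = π := by
    refine (minpoly.eq_of_irreducible_of_monic hirr ?_ hm).symm
    rw [hev, Ideal.Quotient.eq_zero_iff_mem]
    have : π ∈ P.under k[X] := hu ▸ Ideal.mem_span_singleton_self π
    exact this
  have hxi : IsIntegral k x := .of_finite k x
  have hf : Module.finrank (IntermediateField.adjoin k {x}) (R ⧸ P) = P.inertiaDeg k[X] := by
    have e := Module.finrank_mul_finrank k (IntermediateField.adjoin k {x}) (R ⧸ P)
    rw [IntermediateField.adjoin.finrank hxi, hmin, h2] at e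
    exact Nat.eq_of_mul_eq_mul_left hirr.natDegree_pos e
  rw [trace_eq_finrank_mul_minpoly_nextCoeff, hmin, hf, idealTrace, h1, hm.nextCoeff_pow]
  simp

end IdealDegree

namespace RingFilt

section Det

variable {k B : Type*} [Field k] [CommRing B] [Algebra k B] (S : RingFilt k B)

lemma det_mem {ι : Type*} [Fintype ι] [DecidableEq ι] (M : Matrix ι ι B) (w : ι → ℤ) (n : ℤ)
    (h : ∀ i j, M i j ∈ S.F (n + w j - w i)) : M.det ∈ S.F (Fintype.card ι * n) := by
  rw [Matrix.det_apply]
  refine Submodule.sum_mem _ fun σ _ => ?_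
  have := S.prod_mem Finset.univ (fun i => M (σ i) i)
    (fun i => n + w i - w (σ i)) fun i _ => h _ _
  have hs : ∑ i, (n + w i - w (σ i)) = Fintype.card ι * n := by
    rw [Finset.sum_sub_distrib, Finset.sum_add_distrib, Equiv.sum_comp σ w]
    simp
  rw [hs] at this
  rcases Int.units_eq_one_or (Equiv.Perm.sign σ) with h | h <;> rw [h]
  · simpa using this
  · simpa using neg_mem this

lemma prod_sub_one_mem {ι : Type*} {n : ℤ} (hn : n ≤ 0) (s : Finset ι) (f : ι → B)
    (h : ∀ i ∈ s, f i - 1 ∈ S.F n) : ∏ i ∈ s, f i - 1 ∈ S.F n := by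
  classical
  induction s using Finset.induction_on with
  | empty => simp
  | insert a s ha ih =>
    rw [Finset.prod_insert ha]
    have h1 := h a (Finset.mem_insert_self a s)
    have h2 := ih fun i hi => h i (Finset.mem_insert_of_mem hi)
    have e : f a * ∏ i ∈ s, f i - 1 =
        (f a - 1) * (∏ i ∈ s, f i - 1) + (f a - 1) + (∏ i ∈ s, f i - 1) := by ring
    rw [e]
    exact add_mem (add_mem (S.mono (by linarith) (S.mul_mem h1 h2)) h1) h2

lemma det_one_add_sub_one_mem {ι : Type*} [Fintype ι] [DecidableEq ι] (M : Matrix ι ι B)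
    (w : ι → ℤ) {n : ℤ} (hn : n ≤ 0) (h : ∀ i j, M i j ∈ S.F (n + w j - w i)) :
    (1 + M).det - 1 ∈ S.F n := by
  rw [Matrix.det_apply, ← Finset.add_sum_erase _ _ (Finset.mem_univ (1 : Equiv.Perm ι)),
    add_sub_right_comm]
  refine add_mem ?_ (Submodule.sum_mem _ fun σ hσ => ?_)
  · simp only [Equiv.Perm.sign_one, Equiv.Perm.coe_one, id_eq, one_smul]
    refine S.prod_sub_one_mem hn _ _ fun i _ => ?_
    simpa using h i i
  · obtain ⟨j, hj⟩ : ∃ j, σ j ≠ j := by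
      by_contra! hh
      exact (Finset.ne_of_mem_erase hσ) (Equiv.ext hh)
    have h1 (i : ι) : (1 + M) (σ i) i ∈ S.F ((if i = j then n else 0) + w i - w (σ i)) := by
      by_cases hi : σ i = i
      · have hij : i ≠ j := by rintro rfl; exact hj hi
        rw [if_neg hij, hi]
        simp only [Matrix.add_apply, Matrix.one_apply_eq]
        refine add_mem (by simpa using S.one_mem) ?_
        exact S.mono (by linarith) (h i i)
      · simp only [Matrix.add_apply, Matrix.one_apply_ne hi, zero_add]
        refine S.mono ?_ (h _ _)
        split_ifs <;> linarith
    have := S.prod_mem Finset.univ (fun i => (1 + M) (σ i) i) _ fun i _ => h1 i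
    have hs : ∑ i, ((if i = j then n else 0) + w i - w (σ i)) = n := by
      rw [Finset.sum_sub_distrib, Finset.sum_add_distrib, Equiv.sum_comp σ w]
      simp
    rw [hs] at this
    rcases Int.units_eq_one_or (Equiv.Perm.sign σ) with h | h <;> rw [h]
    · simpa using this
    · simpa using neg_mem this

variable {S} [Nontrivial B] {δ n : ℤ} {Φ : B[X]}

lemma leftMulMatrix_adj_mem (hm : Φ.Monic) (hΦ : Φ ∈ (S.poly δ).F (δ * Φ.natDegree))
    {θ : AdjoinRoot Φ} (hθ : θ ∈ (S.adj δ Φ).F n) (i j : Fin (AdjoinRoot.powerBasis' hm).dim) :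
    Algebra.leftMulMatrix (AdjoinRoot.powerBasis' hm).basis θ i j ∈ S.F (n + δ * j - δ * i) := by
  rw [Algebra.leftMulMatrix_eq_repr_mul]
  have h : θ * (AdjoinRoot.powerBasis' hm).basis j ∈ (S.adj δ Φ).F (n + j * δ) := by
    refine RingFilt.mul_mem _ hθ ?_
    rw [PowerBasis.basis_eq_pow]
    exact (S.adj δ Φ).pow_mem (RingFilt.root_mem_adj S δ Φ) j
  obtain ⟨g, hg, -, hgx⟩ := RingFilt.exists_rep hm hΦ h
  rw [← hgx]
  have hmod := RingFilt.modByMonic_mem hm hΦ hg i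
  have hr : (AdjoinRoot.powerBasis' hm).basis.repr (AdjoinRoot.mk Φ g) i =
      (g %ₘ Φ).coeff i := by
    change (AdjoinRoot.powerBasisAux' hm).repr (AdjoinRoot.mk Φ g) i = _
    exact (AdjoinRoot.powerBasisAux'_repr_apply_to_fun hm _ _).trans
      (by rw [AdjoinRoot.modByMonicHom_mk])
  rw [hr]
  convert hmod using 2
  ring

lemma norm_adj_mem (hm : Φ.Monic) (hΦ : Φ ∈ (S.poly δ).F (δ * Φ.natDegree))
    {θ : AdjoinRoot Φ} (hθ : θ ∈ (S.adj δ Φ).F n) :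
    Algebra.norm B θ ∈ S.F (Φ.natDegree * n) := by
  rw [Algebra.norm_eq_matrix_det (AdjoinRoot.powerBasis' hm).basis]
  have := S.det_mem _ (fun i : Fin (AdjoinRoot.powerBasis' hm).dim => δ * ((i : ℕ) : ℤ)) n
    fun i j => leftMulMatrix_adj_mem hm hΦ hθ i j
  simpa using this

lemma norm_one_add_adj_mem (hm : Φ.Monic) (hΦ : Φ ∈ (S.poly δ).F (δ * Φ.natDegree))
    (hn : n ≤ 0) {θ : AdjoinRoot Φ} (hθ : θ ∈ (S.adj δ Φ).F n) :
    Algebra.norm B (1 + θ) - 1 ∈ S.F n := by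
  rw [Algebra.norm_eq_matrix_det (AdjoinRoot.powerBasis' hm).basis, map_add, map_one]
  exact S.det_one_add_sub_one_mem _
    (fun i : Fin (AdjoinRoot.powerBasis' hm).dim => δ * ((i : ℕ) : ℤ)) hn
    fun i j => leftMulMatrix_adj_mem hm hΦ hθ i j

end Det

section Rat

open RatFunc (intDegree)

variable {k : Type*} [Field k]

/-- The degree filtration on `k(X)`. -/
noncomputable def rat (k : Type*) [Field k] : RingFilt k (RatFunc k) where
  F n :=
    { carrier := {x | x ≠ 0 → intDegree x ≤ n}
      add_mem' := by
        intro x y hx hy hxy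
        by_cases h0 : y = 0
        · subst h0
          rw [add_zero] at hxy ⊢
          exact hx hxy
        by_cases h1 : x = 0
        · subst h1
          rw [zero_add] at hxy ⊢
          exact hy hxy
        exact (RatFunc.intDegree_add_le h0 hxy).trans (max_le (hx h1) (hy h0))
      zero_mem' := fun h => absurd rfl h
      smul_mem' := by
        intro c x hx h
        have hc : c ≠ 0 := by rintro rfl; simp at h
        have hx0 : x ≠ 0 := by rintro rfl; simp at h
        rw [RatFunc.smul_eq_C_mul, RatFunc.intDegree_mul (by simpa using hc) hx0,
          RatFunc.intDegree_C, zero_add]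
        exact hx hx0 }
  mono hab x hx h := (hx h).trans hab
  mul_mem {a b x y} hx hy h := by
    rw [RatFunc.intDegree_mul (left_ne_zero_of_mul h) (right_ne_zero_of_mul h)]
    exact add_le_add (hx (left_ne_zero_of_mul h)) (hy (right_ne_zero_of_mul h))
  one_mem h := by simp

lemma mem_rat {n : ℤ} {x : RatFunc k} : x ∈ (rat k).F n ↔ (x ≠ 0 → intDegree x ≤ n) := Iff.rfl

lemma mem_rat_intDegree (x : RatFunc k) : x ∈ (rat k).F (intDegree x) := fun _ => le_rfl

lemma algebraMap_mem_rat {n : ℤ} {f : k[X]} :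
    algebraMap k[X] (RatFunc k) f ∈ (rat k).F n ↔ f ∈ (deg k).F n := by
  rw [mem_rat, RatFunc.intDegree_polynomial, Ne, FaithfulSMul.algebraMap_eq_zero_iff]
  by_cases h0 : f = 0
  · simp [h0]
  constructor
  · intro h i hi
    exact coeff_eq_zero_of_natDegree_lt (by have := h h0; omega)
  · intro h _
    exact natDegree_le_of_mem_deg h h0

lemma X_zpow_mem_rat (n : ℤ) : (RatFunc.X : RatFunc k) ^ n ∈ (rat k).F n := by
  intro _
  have hX : (RatFunc.X : RatFunc k) ≠ 0 := RatFunc.X_ne_zero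
  have hnat (m : ℕ) : intDegree ((RatFunc.X : RatFunc k) ^ m) = m := by
    induction m with
    | zero => simp
    | succ m ih =>
      rw [pow_succ, RatFunc.intDegree_mul (pow_ne_zero _ hX) hX, ih]
      simp
  cases n with
  | ofNat m => exact (hnat m).le
  | negSucc m => rw [zpow_negSucc, RatFunc.intDegree_inv, hnat]; rfl

lemma exists_polynomial_approx (x : RatFunc k) :
    ∃ f : k[X], x - algebraMap k[X] (RatFunc k) f ∈ (rat k).F (-1) := by
  have hd := RatFunc.monic_denom x
  refine ⟨x.num /ₘ x.denom, ?_⟩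
  have hd0 : algebraMap k[X] (RatFunc k) x.denom ≠ 0 := by
    simpa using hd.ne_zero
  have e : x - algebraMap k[X] (RatFunc k) (x.num /ₘ x.denom) =
      algebraMap k[X] (RatFunc k) (x.num %ₘ x.denom) *
        (algebraMap k[X] (RatFunc k) x.denom)⁻¹ := by
    rw [eq_mul_inv_iff_mul_eq₀ hd0, sub_mul]
    nth_rw 1 [← RatFunc.num_div_denom x]
    rw [div_mul_cancel₀ _ hd0, ← map_mul, ← map_sub]
    congr 1
    have := modByMonic_add_div x.num x.denom
    linear_combination -this
  rw [e, mem_rat]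
  intro h0
  have hr : x.num %ₘ x.denom ≠ 0 := by
    intro h; rw [h] at h0; simp at h0
  rw [RatFunc.intDegree_mul (left_ne_zero_of_mul h0) (right_ne_zero_of_mul h0),
    RatFunc.intDegree_inv, RatFunc.intDegree_polynomial, RatFunc.intDegree_polynomial]
  have := natDegree_lt_natDegree hr (degree_modByMonic_lt x.num hd)
  omega

lemma exists_const_approx {n : ℤ} {x : RatFunc k} (hx : x ∈ (rat k).F n) :
    ∃ c : k, x - c • (RatFunc.X : RatFunc k) ^ n ∈ (rat k).F (n - 1) := by
  have hX : (RatFunc.X : RatFunc k) ≠ 0 := RatFunc.X_ne_zero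
  have hy := (rat k).mul_mem hx (X_zpow_mem_rat (-n))
  rw [add_neg_cancel] at hy
  obtain ⟨f, hf⟩ := exists_polynomial_approx (x * RatFunc.X ^ (-n))
  have hf0 : algebraMap k[X] (RatFunc k) f ∈ (rat k).F 0 := by
    have := sub_mem hy ((rat k).mono (by norm_num) hf)
    simpa using this
  rw [algebraMap_mem_rat] at hf0
  have hfc : f = C (f.coeff 0) := eq_C_of_natDegree_le_zero (mem_deg_natCast.1 (by simpa using hf0))
  refine ⟨f.coeff 0, ?_⟩
  have h1 := (rat k).mul_mem hf (X_zpow_mem_rat n)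
  rw [sub_mul, mul_assoc, ← zpow_add₀ hX, neg_add_cancel, zpow_zero, mul_one, hfc] at h1
  convert h1 using 2
  · ring
  · rw [RatFunc.smul_eq_C_mul, RatFunc.algebraMap_C]

/-- Modulo polynomials and elements of small degree, `k(X)` is spanned by few monomials. -/
lemma rat_span (r : ℕ) (x : RatFunc k) :
    x ∈ Submodule.span k ((fun j : ℕ => (RatFunc.X : RatFunc k) ^ (-(j : ℤ) - 1)) '' Set.Iio r) ⊔
      (LinearMap.range (IsScalarTower.toAlgHom k k[X] (RatFunc k)).toLinearMap ⊔
      (rat k).F (-1 - r)) := by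
  induction r with
  | zero =>
    obtain ⟨f, hf⟩ := exists_polynomial_approx x
    rw [← sub_add_cancel x (algebraMap k[X] (RatFunc k) f), add_comm]
    refine Submodule.mem_sup_right (Submodule.add_mem_sup ⟨f, rfl⟩ (by simpa using hf))
  | succ r ih =>
    obtain ⟨u, hu, v, hv, rfl⟩ := Submodule.mem_sup.1 ih
    obtain ⟨f, hf, y, hy, rfl⟩ := Submodule.mem_sup.1 hv
    obtain ⟨c, hc⟩ := exists_const_approx hy
    have e : u + (f + y) = (u + c • RatFunc.X ^ (-1 - (r : ℤ))) +
      (f + (y - c • RatFunc.X ^ (-1 - (r : ℤ)))) := by ring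
    rw [e]
    refine Submodule.add_mem_sup (add_mem ?_ ?_) (Submodule.add_mem_sup hf ?_)
    · exact Submodule.span_mono (Set.image_mono (Set.Iio_subset_Iio (Nat.le_succ r))) hu
    · refine Submodule.smul_mem _ _ (Submodule.subset_span ⟨r, by simp, ?_⟩)
      simp only
      congr 1
      ring
    · convert hc using 2
      push_cast; ring

end Rat

end RingFilt

lemma Polynomial.natDegree_nextCoeff_of_sub_mem {k : Type*} [Field k] {f g : k[X]} (hf : f.Monic)
    (hg : g.Monic) {c : k} (hc : c ≠ 0) :
    (C c * f - g ∈ (RingFilt.deg k).F (g.natDegree - 1) → f.natDegree = g.natDegree) ∧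
    (C c * f - g ∈ (RingFilt.deg k).F (g.natDegree - 2) → f.nextCoeff = g.nextCoeff) := by
  have h1 (h : C c * f - g ∈ (RingFilt.deg k).F (g.natDegree - 1)) :
      f.natDegree = g.natDegree ∧ c = 1 := by
    have hn (j : ℕ) (hj : g.natDegree ≤ j) : c * f.coeff j = g.coeff j := by
      have := h j (by omega)
      rwa [coeff_sub, coeff_C_mul, sub_eq_zero] at this
    have hd : f.natDegree = g.natDegree := by
      refine le_antisymm ?_ ?_
      · rw [natDegree_le_iff_coeff_eq_zero]
        intro j hj
        have := hn j hj.le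
        rw [coeff_eq_zero_of_natDegree_lt hj] at this
        exact (mul_eq_zero.1 this).resolve_left hc
      · refine le_natDegree_of_ne_zero fun h0 => ?_
        have := hn _ le_rfl
        rw [h0, mul_zero, hg.coeff_natDegree] at this
        exact zero_ne_one this
    refine ⟨hd, ?_⟩
    have := hn _ le_rfl
    rw [hg.coeff_natDegree, ← hd, hf.coeff_natDegree, mul_one] at this
    exact this
  refine ⟨fun h => (h1 h).1, fun h => ?_⟩
  obtain ⟨hd, rfl⟩ := h1 ((RingFilt.deg k).mono (by omega) h)
  rw [nextCoeff, nextCoeff, hd]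
  split_ifs with h0
  · rfl
  · have := h (g.natDegree - 1) (by omega)
    rwa [coeff_sub, C_1, one_mul, sub_eq_zero] at this

section Infty

variable {k R K : Type*} [Field k] [CommRing R] [IsDedekindDomain R]
  [Algebra k[X] R] [Module.Finite k[X] R] [Module.IsTorsionFree k[X] R] [Algebra k R]
  [IsScalarTower k k[X] R] [Field K] [Algebra R K] [IsFractionRing R K] [Algebra k K]
  [IsScalarTower k R K] [Algebra (RatFunc k) K] [FiniteDimensional (RatFunc k) K]

/-- Compatibility of the norms of a ring extension and of its field of fractions. -/
def NormCompat (k R K : Type*) [Field k] [CommRing R] [Algebra k[X] R] [Field K] [Algebra R K]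
    [Algebra (RatFunc k) K] : Prop :=
  ∀ x : R, Algebra.norm (RatFunc k) (algebraMap R K x) =
    algebraMap k[X] (RatFunc k) (Algebra.norm k[X] x)

/-- A filtration of a function field behaving like the order of poles at infinity. -/
structure RingFilt.IsInfty (L : RingFilt k K) : Prop where
  exhaust : ∀ x, ∃ n, x ∈ L.F n
  map_mem : ∀ {n x}, x ∈ (RingFilt.rat k).F n → algebraMap (RatFunc k) K x ∈ L.F n
  norm_mem : ∀ {n x}, x ∈ L.F n →
    Algebra.norm (RatFunc k) x ∈ (RingFilt.rat k).F (Module.finrank (RatFunc k) K * n)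
  norm_one_add : ∀ {n x}, n ≤ 0 → x ∈ L.F n →
    Algebra.norm (RatFunc k) (1 + x) - 1 ∈ (RingFilt.rat k).F n

lemma RingFilt.one_notMem_rat : (1 : RatFunc k) ∉ (RingFilt.rat k).F (-1) := by
  intro h
  have := RingFilt.mem_rat.1 h one_ne_zero
  simp at this

variable {L : RingFilt k K}

namespace RingFilt.IsInfty

lemma one_add_ne_zero (hL : L.IsInfty) {x : K} (hx : x ∈ L.F (-1)) : 1 + x ≠ 0 := by
  intro h
  have := hL.norm_one_add (by norm_num) hx
  rw [h, Algebra.norm_zero, zero_sub] at this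
  exact RingFilt.one_notMem_rat (by simpa using neg_mem this)

lemma ne_zero (hL : L.IsInfty) {x : K} (hx : x - 1 ∈ L.F (-1)) : x ≠ 0 := by
  simpa using hL.one_add_ne_zero hx

lemma inv_sub_one_mem (hL : L.IsInfty) {x : K} (hx : x - 1 ∈ L.F (-1)) :
    x⁻¹ - 1 ∈ L.F (-1) := by
  have h0 := hL.ne_zero hx
  obtain ⟨n, hn⟩ := hL.exhaust x⁻¹
  have key (j : ℕ) : x⁻¹ ∈ L.F (max 0 (n - j)) := by
    induction j with
    | zero => exact L.mono (by simp) hn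
    | succ j ih =>
      have e : x⁻¹ = 1 - x⁻¹ * (x - 1) := by
        rw [mul_sub, inv_mul_cancel₀ h0]; ring
      rw [e]
      refine sub_mem (L.mono (le_max_left _ _) L.one_mem) (L.mono ?_ (L.mul_mem ih hx))
      push_cast
      omega
  have h1 : x⁻¹ ∈ L.F 0 := L.mono (by omega) (key n.toNat)
  have e : x⁻¹ - 1 = - (x⁻¹ * (x - 1)) := by
    rw [mul_sub, inv_mul_cancel₀ h0]; ring
  rw [e]
  exact neg_mem (L.mono (by norm_num) (L.mul_mem h1 hx))

lemma mul_sub_one_mem {x y : K} (hx : x - 1 ∈ L.F (-1)) (hy : y - 1 ∈ L.F (-1)) :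
    x * y - 1 ∈ L.F (-1) := by
  have e : x * y - 1 = (x - 1) * (y - 1) + (x - 1) + (y - 1) := by ring
  rw [e]
  exact add_mem (add_mem (L.mono (by norm_num) (L.mul_mem hx hy)) hx) hy

lemma eq_zero_of_mem (hL : L.IsInfty) (hN : NormCompat k R K) {x : R}
    (hx : algebraMap R K x ∈ L.F (-1)) : x = 0 := by
  have h1 := hL.norm_mem hx
  rw [hN, RingFilt.algebraMap_mem_rat] at h1
  have hpos : 0 < Module.finrank (RatFunc k) K := Module.finrank_pos
  have h2 := RingFilt.eq_zero_of_mem_deg h1 (by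
    have : (0 : ℤ) < Module.finrank (RatFunc k) K := by exact_mod_cast hpos
    linarith)
  have h3 := hN x
  rw [h2, map_zero, Algebra.norm_eq_zero_iff] at h3
  exact (FaithfulSMul.algebraMap_eq_zero_iff R K).1 h3

end RingFilt.IsInfty

open FractionalIdeal in
/-- The norms of two ideals differing by a scaling. -/
lemma exists_norm_mul_normPoly (hN : NormCompat k R K) {I J : Ideal R} (hI : I ≠ ⊥) (hJ : J ≠ ⊥)
    {u : K} (hu : (J : FractionalIdeal R⁰ K) = spanSingleton R⁰ u * I) :
    ∃ c : k, c ≠ 0 ∧ Algebra.norm (RatFunc k) u * algebraMap k[X] (RatFunc k) (normPoly I) =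
      algebraMap k[X] (RatFunc k) (C c * normPoly J) := by
  obtain ⟨s, t, ht, rfl⟩ := IsFractionRing.div_surjective (A := R) u
  have ht0 : t ≠ 0 := nonZeroDivisors.ne_zero ht
  have hs0 : s ≠ 0 := by
    rintro rfl
    rw [map_zero, zero_div, spanSingleton_zero, zero_mul, coeIdeal_eq_zero] at hu
    exact hJ hu
  have htK : algebraMap R K t ≠ 0 := by simpa using ht0
  have hid : Ideal.span {t} * J = Ideal.span {s} * I := by
    apply coeIdeal_injective (K := K)
    simp only [coeIdeal_mul, coeIdeal_span_singleton, hu]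
    rw [← mul_assoc, spanSingleton_mul_spanSingleton, mul_div_cancel₀ _ htK]
  have hst : Ideal.span {s} ≠ ⊥ := by simpa using hs0
  have htt : Ideal.span {t} ≠ ⊥ := by simpa using ht0
  have hP := congrArg (normPoly (k := k)) hid
  rw [normPoly_mul htt hJ, normPoly_mul hst hI] at hP
  have h1 := C_mul_normPoly_span (k := k) s
  have h2 := C_mul_normPoly_span (k := k) t
  have hns : Algebra.norm k[X] s ≠ 0 := by
    rw [← h1]
    intro h0
    have h3 := hN s
    rw [← h1, h0, map_zero, Algebra.norm_eq_zero_iff] at h3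
    exact hs0 ((FaithfulSMul.algebraMap_eq_zero_iff R K).1 h3)
  have hnt : Algebra.norm k[X] t ≠ 0 := by
    intro h0
    have h3 := hN t
    rw [h0, map_zero, Algebra.norm_eq_zero_iff] at h3
    exact ht0 ((FaithfulSMul.algebraMap_eq_zero_iff R K).1 h3)
  set a := (Algebra.norm k[X] s).leadingCoeff with ha
  set b := (Algebra.norm k[X] t).leadingCoeff with hb
  have ha0 : a ≠ 0 := by rwa [ha, leadingCoeff_ne_zero]
  have hb0 : b ≠ 0 := by rwa [hb, leadingCoeff_ne_zero]
  refine ⟨a / b, div_ne_zero ha0 hb0, ?_⟩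
  have hnt' : algebraMap k[X] (RatFunc k) (Algebra.norm k[X] t) ≠ 0 := by simpa using hnt
  have hdiv : Algebra.norm (RatFunc k) (algebraMap R K s / algebraMap R K t) *
      algebraMap k[X] (RatFunc k) (Algebra.norm k[X] t) =
      algebraMap k[X] (RatFunc k) (Algebra.norm k[X] s) := by
    rw [← hN, ← hN, ← map_mul, div_mul_cancel₀ _ htK]
  refine mul_right_cancel₀ hnt' ?_
  rw [mul_right_comm, hdiv, ← map_mul, ← map_mul]
  congr 1
  rw [← h1, ← h2]
  have hab : C a = C (a / b) * C b := by rw [← C_mul, div_mul_cancel₀ _ hb0]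
  rw [hab]
  linear_combination -(C (a / b) * C b) * hP

open FractionalIdeal in
lemma natDegree_normPoly_of_norm_sub_one (hN : NormCompat k R K) {I J : Ideal R} (hI : I ≠ ⊥)
    (hJ : J ≠ ⊥) {u : K} (hu : (J : FractionalIdeal R⁰ K) = spanSingleton R⁰ u * I)
    (h1 : Algebra.norm (RatFunc k) u - 1 ∈ (RingFilt.rat k).F (-1)) :
    (normPoly J : k[X]).natDegree = (normPoly I : k[X]).natDegree := by
  obtain ⟨c, hc, h⟩ := exists_norm_mul_normPoly hN hI hJ hu
  refine (natDegree_nextCoeff_of_sub_mem (monic_normPoly hJ) (monic_normPoly hI) hc).1 ?_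
  rw [← RingFilt.algebraMap_mem_rat, map_sub, ← h, ← sub_one_mul]
  refine (RingFilt.rat k).mono ?_ ((RingFilt.rat k).mul_mem h1
    (RingFilt.algebraMap_mem_rat.2 (RingFilt.mem_deg_natCast.2 le_rfl)))
  linarith

open FractionalIdeal in
lemma idealTrace_of_norm_sub (hN : NormCompat k R K) {I J : Ideal R} (hI : I ≠ ⊥)
    (hJ : J ≠ ⊥) {u : K} (hu : (J : FractionalIdeal R⁰ K) = spanSingleton R⁰ u * I) {m : ℕ}
    (h1 : Algebra.norm (RatFunc k) u - (1 + (RatFunc.X : RatFunc k)⁻¹) ^ m ∈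
      (RingFilt.rat k).F (-2)) :
    (idealTrace J : k) = idealTrace I - m := by
  obtain ⟨c, hc, h⟩ := exists_norm_mul_normPoly hN hI hJ hu
  have hX : (RatFunc.X : RatFunc k) ≠ 0 := RatFunc.X_ne_zero
  have hm1 : (X ^ m : k[X]).Monic := monic_X_pow m
  have hm2 : ((X + C 1) ^ m : k[X]).Monic := (monic_X_add_C 1).pow m
  have hI' := monic_normPoly (k := k) hI
  have hJ' := monic_normPoly (k := k) hJ
  have key := (natDegree_nextCoeff_of_sub_mem (hm1.mul hJ') (hm2.mul hI') hc).2 (by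
    have e : algebraMap k[X] (RatFunc k) (C c * (X ^ m * normPoly J) -
        (X + C 1) ^ m * normPoly I) =
        RatFunc.X ^ m * (Algebra.norm (RatFunc k) u - (1 + (RatFunc.X : RatFunc k)⁻¹) ^ m) *
          algebraMap k[X] (RatFunc k) (normPoly I) := by
      have e2 : (RatFunc.X : RatFunc k) ^ m * (1 + (RatFunc.X : RatFunc k)⁻¹) ^ m =
          (RatFunc.X + 1) ^ m := by
        rw [← mul_pow, mul_add, mul_inv_cancel₀ hX, mul_one]
      rw [mul_sub, e2]
      rw [map_mul] at h
      simp only [map_sub, map_mul, map_pow, map_add, RatFunc.algebraMap_X, map_one]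
      linear_combination -(RatFunc.X : RatFunc k) ^ m * h
    rw [← RingFilt.algebraMap_mem_rat, e]
    refine (RingFilt.rat k).mono ?_ ((RingFilt.rat k).mul_mem ((RingFilt.rat k).mul_mem
      (by simpa using RingFilt.X_zpow_mem_rat (k := k) m) h1)
      (RingFilt.algebraMap_mem_rat.2 (RingFilt.mem_deg_natCast.2 le_rfl)))
    rw [hm2.natDegree_mul hI', natDegree_pow, natDegree_X_add_C]
    push_cast
    linarith)
  rw [hm1.nextCoeff_mul hJ', hm2.nextCoeff_mul hI', (monic_X_add_C (1 : k)).nextCoeff_pow,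
    monic_X.nextCoeff_pow, nextCoeff_X_add_C] at key
  have hx0 : (X : k[X]).nextCoeff = 0 := by
    have := nextCoeff_X_add_C (0 : k)
    simpa using this
  rw [hx0] at key
  rw [idealTrace, idealTrace]
  simp at key
  rw [key]
  ring

end Infty

section Approx

variable {k R K : Type*} [Field k] [Finite k] [CommRing R] [IsDedekindDomain R]
  [Algebra k[X] R] [Module.Finite k[X] R] [Module.IsTorsionFree k[X] R] [Algebra k R]
  [IsScalarTower k k[X] R] [Field K] [Algebra R K] [IsFractionRing R K] [Algebra k K]
  [IsScalarTower k R K]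

variable (k K) in
/-- The fractional inverse of an ideal as a vector space. -/
def invSub (I : Ideal R) : Submodule k K where
  carrier := {x | ∀ a ∈ I, ∃ r : R, algebraMap R K r = x * algebraMap R K a}
  add_mem' := fun hx hy a ha => by
    obtain ⟨r, hr⟩ := hx a ha
    obtain ⟨s, hs⟩ := hy a ha
    exact ⟨r + s, by rw [map_add, hr, hs, add_mul]⟩
  zero_mem' := fun a _ => ⟨0, by simp⟩
  smul_mem' := fun c x hx a ha => by
    obtain ⟨r, hr⟩ := hx a ha
    refine ⟨c • r, ?_⟩
    rw [Algebra.smul_def, map_mul, hr, ← IsScalarTower.algebraMap_apply, Algebra.smul_def]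
    ring

variable (k R K) in
/-- The image of the ring in its fraction field as a vector space. -/
noncomputable def ringSub : Submodule k K :=
  LinearMap.range (IsScalarTower.toAlgHom k R K).toLinearMap

lemma mem_ringSub {x : K} : x ∈ ringSub k R K ↔ ∃ r : R, algebraMap R K r = x := Iff.rfl

lemma mul_mem_invSub {I : Ideal R} {x : K} (hx : x ∈ invSub k K I) (r : R) :
    x * algebraMap R K r ∈ invSub k K I := by
  intro a ha
  obtain ⟨s, hs⟩ := hx a ha
  exact ⟨r * s, by rw [map_mul, hs]; ring⟩

/-- The quotient of the inverse of an ideal by the ring has dimension at least the degree. -/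
lemma exists_le_map_mkQ (hrel : RelNormPrime k R) {I : Ideal R} (hI : I ≠ ⊥) :
    ∃ N : Submodule k (K ⧸ ringSub k R K), N ≤ (invSub k K I).map (ringSub k R K).mkQ ∧
      FiniteDimensional k N ∧ Module.finrank k N = (normPoly I : k[X]).natDegree := by
  obtain ⟨s, hs, hs0⟩ := Submodule.exists_mem_ne_zero_of_ne_bot hI
  have hss : Ideal.span {s} ≠ ⊥ := by simpa using hs0
  obtain ⟨J, hJ⟩ : I ∣ Ideal.span {s} := by
    rwa [Ideal.dvd_iff_le, Ideal.span_singleton_le_iff_mem]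
  have hJ0 : J ≠ ⊥ := by
    rintro rfl
    rw [Ideal.mul_bot] at hJ
    exact hss hJ
  have hsJ : Ideal.span {s} ≤ J := hJ ▸ Ideal.mul_le_right
  have hsK : algebraMap R K s ≠ 0 := by simpa using hs0
  have hfd := finiteDimensional_quotient_ideal k hss
  let f : R →ₗ[k] K ⧸ ringSub k R K := (ringSub k R K).mkQ ∘ₗ
    LinearMap.mulRight k (algebraMap R K s)⁻¹ ∘ₗ (IsScalarTower.toAlgHom k R K).toLinearMap
  have hf (x : R) : f x = (ringSub k R K).mkQ (algebraMap R K x * (algebraMap R K s)⁻¹) := rfl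
  have hker : LinearMap.ker f = (Ideal.span {s}).restrictScalars k := by
    ext x
    rw [LinearMap.mem_ker, hf, Submodule.mkQ_apply, Submodule.Quotient.mk_eq_zero, mem_ringSub,
      Submodule.restrictScalars_mem, Ideal.mem_span_singleton']
    refine exists_congr fun r => ?_
    rw [eq_mul_inv_iff_mul_eq₀ hsK, ← map_mul]
    exact (IsFractionRing.injective R K).eq_iff
  let fbar : (R ⧸ (Ideal.span {s}).restrictScalars k) →ₗ[k] K ⧸ ringSub k R K :=
    ((Ideal.span {s}).restrictScalars k).liftQ f hker.ge
  have hinj : Function.Injective fbar := by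
    rw [← LinearMap.ker_eq_bot, Submodule.ker_liftQ_eq_bot']
    exact hker.symm
  let g : (R ⧸ Ideal.span {s}) →ₗ[k] R ⧸ J := (Ideal.Quotient.factorₐ k hsJ).toLinearMap
  have hg (x : R) : g (Ideal.Quotient.mk _ x) = Ideal.Quotient.mk J x := rfl
  have hgs : LinearMap.range g = ⊤ := by
    rw [LinearMap.range_eq_top]
    intro y
    obtain ⟨y, rfl⟩ := Ideal.Quotient.mk_surjective y
    exact ⟨_, hg y⟩
  have e1 := LinearMap.finrank_range_add_finrank_ker g
  have e2 : (normPoly (Ideal.span {s}) : k[X]).natDegree =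
      (normPoly I : k[X]).natDegree + (normPoly J : k[X]).natDegree := by
    rw [hJ, normPoly_mul hI hJ0, (monic_normPoly hI).natDegree_mul (monic_normPoly hJ0)]
  rw [hgs, finrank_top, finrank_quotient_eq_natDegree hrel hJ0,
    finrank_quotient_eq_natDegree hrel hss, e2] at e1
  let fb : (R ⧸ Ideal.span {s}) →ₗ[k] K ⧸ ringSub k R K := fbar
  have hfb : Function.Injective fb := hinj
  refine ⟨(LinearMap.ker g).map fb, ?_, inferInstance, ?_⟩
  · rintro _ ⟨y, hy, rfl⟩
    obtain ⟨y, rfl⟩ := Ideal.Quotient.mk_surjective y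
    rw [SetLike.mem_coe, LinearMap.mem_ker, hg, Ideal.Quotient.eq_zero_iff_mem] at hy
    refine ⟨algebraMap R K y * (algebraMap R K s)⁻¹, ?_, rfl⟩
    intro a ha
    have : a * y ∈ Ideal.span {s} := hJ ▸ Ideal.mul_mem_mul ha hy
    obtain ⟨r, hr⟩ := Ideal.mem_span_singleton'.1 this
    refine ⟨r, ?_⟩
    rw [mul_right_comm, eq_mul_inv_iff_mul_eq₀ hsK, ← map_mul, hr, map_mul, mul_comm]
  · rw [← (Submodule.equivMapOfInjective fb hfb _).finrank_eq]
    omega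

/-- Ideals of large degree have inverses with prescribed leading terms at infinity. -/
lemma invSub_sup_eq_top (hrel : RelNormPrime k R) (L : RingFilt k K) (B : Finset K)
    (hB : Submodule.span k (B : Set K) ⊔ (ringSub k R K ⊔ L.F (-2)) = ⊤) {I : Ideal R}
    (hI : I ≠ ⊥) (hdeg : 2 * B.card < (normPoly I : k[X]).natDegree) :
    invSub k K I ⊔ L.F (-2) = ⊤ := by
  by_contra hne
  obtain ⟨l, hl0, hl⟩ := Submodule.exists_le_ker_of_lt_top _ (lt_top_iff_ne_top.2 hne)
  -- the functional `l` embeds the bounded part of the inverse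
  let W := invSub k K I ⊓ L.F 0
  let Θ : W →ₗ[k] (B → k) := LinearMap.pi fun b =>
    l ∘ₗ LinearMap.mulRight k (b : K) ∘ₗ W.subtype
  have hΘ (w : W) (b : B) : Θ w b = l (w * b) := rfl
  have hinj : Function.Injective Θ := by
    rw [injective_iff_map_eq_zero]
    intro w hw
    by_contra hw0
    have hw0' : (w : K) ≠ 0 := fun h => hw0 (Subtype.ext h)
    refine hl0 (LinearMap.ext fun x => ?_)
    have htop : (⊤ : Submodule k K) ≤ LinearMap.ker (l ∘ₗ LinearMap.mulLeft k (w : K)) := by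
      rw [← hB]
      refine sup_le (Submodule.span_le.2 ?_) (sup_le ?_ ?_)
      · intro b hb
        have := congrFun hw ⟨b, hb⟩
        rw [hΘ] at this
        exact this
      · rintro _ ⟨r, rfl⟩
        exact hl (Submodule.mem_sup_left (mul_mem_invSub w.2.1 r))
      · intro y hy
        refine hl (Submodule.mem_sup_right ?_)
        simpa using L.mul_mem w.2.2 hy
    have := htop (Submodule.mem_top (x := (w : K)⁻¹ * x))
    rw [LinearMap.mem_ker, LinearMap.comp_apply, LinearMap.mulLeft_apply,
      mul_inv_cancel_left₀ hw0'] at this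
    simpa using this
  have hWfd : FiniteDimensional k W := Module.Finite.of_injective Θ hinj
  have hW : Module.finrank k W ≤ B.card := by
    have := LinearMap.finrank_le_finrank_of_injective hinj
    simpa using this
  obtain ⟨N, hN, hNfd, hNd⟩ := exists_le_map_mkQ (K := K) hrel hI
  let q : (K ⧸ ringSub k R K) →ₗ[k] K ⧸ (ringSub k R K ⊔ L.F 0) :=
    Submodule.factor le_sup_left
  have hq (x : K) : q ((ringSub k R K).mkQ x) = (ringSub k R K ⊔ L.F 0).mkQ x := rfl
  have hspan : Submodule.span k ((ringSub k R K ⊔ L.F 0).mkQ '' (B : Set K)) = ⊤ := by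
    rw [← Submodule.map_span, eq_top_iff]
    rintro y -
    obtain ⟨x, rfl⟩ := Submodule.mkQ_surjective _ y
    have hx : x ∈ Submodule.span k (B : Set K) ⊔ (ringSub k R K ⊔ L.F (-2)) := hB ▸ trivial
    obtain ⟨u, hu, v, hv, rfl⟩ := Submodule.mem_sup.1 hx
    refine ⟨u, hu, ?_⟩
    have hv' : v ∈ ringSub k R K ⊔ L.F 0 := sup_le_sup_left (L.mono (by norm_num)) _ hv
    have : (ringSub k R K ⊔ L.F 0).mkQ v = 0 := (Submodule.Quotient.mk_eq_zero _).2 hv'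
    rw [map_add, this, add_zero]
  have hfin : ((ringSub k R K ⊔ L.F 0).mkQ '' (B : Set K)).Finite := B.finite_toSet.image _
  have hQfd : FiniteDimensional k (K ⧸ (ringSub k R K ⊔ L.F 0)) :=
    Module.finite_def.2 (hspan ▸ Submodule.fg_span hfin)
  have hQ : Module.finrank k (K ⧸ (ringSub k R K ⊔ L.F 0)) ≤ B.card := by
    classical
    rw [← finrank_top, ← hspan, ← Finset.coe_image]
    exact (finrank_span_finset_le_card _).trans Finset.card_image_le
  let h := q ∘ₗ N.subtype
  have e := LinearMap.finrank_range_add_finrank_ker h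
  have h1 : Module.finrank k (LinearMap.range h) ≤ B.card := (Submodule.finrank_le _).trans hQ
  have h2 : Module.finrank k (LinearMap.ker h) ≤ B.card := by
    have hle : (LinearMap.ker h).map N.subtype ≤ W.map (ringSub k R K).mkQ := by
      rintro _ ⟨y, hy, rfl⟩
      obtain ⟨x, hx, hxy⟩ := hN y.2
      have hy' : q (y : K ⧸ ringSub k R K) = 0 := hy
      rw [← hxy, hq, Submodule.mkQ_apply, Submodule.Quotient.mk_eq_zero] at hy'
      obtain ⟨_, ⟨r, rfl⟩, w, hw, hrw⟩ := Submodule.mem_sup.1 hy'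
      have hr : algebraMap R K r ∈ invSub k K I := fun a _ => ⟨r * a, map_mul _ _ _⟩
      have hrw' : algebraMap R K r + w = x := hrw
      refine ⟨w, ⟨?_, hw⟩, ?_⟩
      · rw [show w = x - algebraMap R K r by rw [← hrw']; ring]
        exact sub_mem hx hr
      · rw [Submodule.subtype_apply, ← hxy, ← hrw', map_add,
          Submodule.mkQ_apply _ (algebraMap R K r),
          (Submodule.Quotient.mk_eq_zero _).2 (mem_ringSub.2 ⟨r, rfl⟩), zero_add]
    rw [(Submodule.equivMapOfInjective N.subtype N.injective_subtype (LinearMap.ker h)).finrank_eq]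
    exact (Submodule.finrank_mono hle).trans ((Submodule.finrank_map_le _ _).trans hW)
  omega

end Approx

section ClassSum

open FractionalIdeal

variable {k R K : Type*} [Field k] [Finite k] [CommRing R] [IsDedekindDomain R]
  [Algebra k[X] R] [Module.Finite k[X] R] [Module.IsTorsionFree k[X] R] [Algebra k R]
  [IsScalarTower k k[X] R] [Field K] [Algebra R K] [IsFractionRing R K] [Algebra k K]
  [IsScalarTower k R K] [Algebra (RatFunc k) K] [FiniteDimensional (RatFunc k) K]

lemma finite_setOf_natDegree_normPoly (hrel : RelNormPrime k R) (N : ℕ) :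
    {I : Ideal R | I ≠ ⊥ ∧ (normPoly I : k[X]).natDegree = N}.Finite := by
  have := Ring.HasFiniteQuotients.of_module_finite k[X] R
  refine (Ring.HasFiniteQuotients.finite_cardQuot_le (R := R) (Nat.card k ^ N)).subset ?_
  rintro I ⟨hI, rfl⟩
  have := finiteDimensional_quotient_ideal k hI
  rw [Set.mem_ofPred_eq, ← finrank_quotient_eq_natDegree hrel hI]
  exact (Module.natCard_eq_pow_finrank (K := k) (V := R ⧸ I)).le

/-- Two ideals differ by a principal unit at infinity. -/
def InftyEquiv (L : RingFilt k K) (I J : Ideal R) : Prop :=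
  ∃ φ : K, φ - 1 ∈ L.F (-1) ∧ (J : FractionalIdeal R⁰ K) = spanSingleton R⁰ φ * I

variable {L : RingFilt k K}

lemma InftyEquiv.refl (I : Ideal R) : InftyEquiv L I I :=
  ⟨1, by simp, by simp⟩

lemma InftyEquiv.symm (hL : L.IsInfty) {I J : Ideal R} (h : InftyEquiv L I J) :
    InftyEquiv L J I := by
  obtain ⟨φ, h1, h2⟩ := h
  refine ⟨φ⁻¹, hL.inv_sub_one_mem h1, ?_⟩
  rw [h2, ← mul_assoc, spanSingleton_mul_spanSingleton, inv_mul_cancel₀ (hL.ne_zero h1),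
    spanSingleton_one, one_mul]

lemma InftyEquiv.trans {I J M : Ideal R} (h : InftyEquiv L I J) (h' : InftyEquiv L J M) :
    InftyEquiv L I M := by
  obtain ⟨φ, h1, h2⟩ := h
  obtain ⟨χ, h3, h4⟩ := h'
  refine ⟨χ * φ, RingFilt.IsInfty.mul_sub_one_mem h3 h1, ?_⟩
  rw [h4, h2, ← mul_assoc, spanSingleton_mul_spanSingleton]

lemma exists_coeIdeal_eq_of_mem_invSub {I : Ideal R} {φ : K} (h : φ ∈ invSub k K I) :
    ∃ J : Ideal R, (J : FractionalIdeal R⁰ K) = spanSingleton R⁰ φ * I := by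
  obtain ⟨J, hJ⟩ := (FractionalIdeal.le_one_iff_exists_coeIdeal
    (J := spanSingleton R⁰ φ * (I : FractionalIdeal R⁰ K))).1 (by
      rw [spanSingleton_mul_le_iff]
      intro z hz
      obtain ⟨a, ha, rfl⟩ := (mem_coeIdeal _).1 hz
      obtain ⟨r, hr⟩ := h a ha
      exact (mem_one_iff _).2 ⟨r, hr⟩)
  exact ⟨J, hJ⟩

lemma mem_invSub_of_coeIdeal_eq {I J : Ideal R} {φ : K}
    (h : (J : FractionalIdeal R⁰ K) = spanSingleton R⁰ φ * I) : φ ∈ invSub k K I := by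
  intro a ha
  have : φ * algebraMap R K a ∈ (J : FractionalIdeal R⁰ K) := by
    rw [h]
    exact FractionalIdeal.mul_mem_mul (mem_spanSingleton_self _ _) ((mem_coeIdeal _).2 ⟨a, ha, rfl⟩)
  obtain ⟨r, -, hr⟩ := (mem_coeIdeal _).1 this
  exact ⟨r, hr⟩

lemma ne_bot_of_coeIdeal_eq {I J : Ideal R} (hI : I ≠ ⊥) {φ : K} (hφ : φ ≠ 0)
    (h : (J : FractionalIdeal R⁰ K) = spanSingleton R⁰ φ * I) : J ≠ ⊥ := by
  rintro rfl
  rw [coeIdeal_bot, eq_comm, mul_eq_zero, spanSingleton_eq_zero_iff, coeIdeal_eq_zero] at h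
  tauto

lemma eq_of_coeIdeal_eq (hL : L.IsInfty) (hN : NormCompat k R K) {I J : Ideal R} (hI : I ≠ ⊥)
    {φ χ : K} (hφ : φ - 1 ∈ L.F (-1)) (hχ : χ - 1 ∈ L.F (-1))
    (h1 : (J : FractionalIdeal R⁰ K) = spanSingleton R⁰ φ * I)
    (h2 : (J : FractionalIdeal R⁰ K) = spanSingleton R⁰ χ * I) : φ = χ := by
  have hI' : (I : FractionalIdeal R⁰ K) ≠ 0 := coeIdeal_ne_zero.2 hI
  have h3 : spanSingleton R⁰ φ = spanSingleton R⁰ χ := mul_right_cancel₀ hI' (h1.symm.trans h2)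
  have hχ0 := hL.ne_zero hχ
  have h4 : φ * χ⁻¹ ∈ (1 : FractionalIdeal R⁰ K) := by
    rw [← spanSingleton_one, ← mul_inv_cancel₀ hχ0, ← spanSingleton_mul_spanSingleton, ← h3,
      spanSingleton_mul_spanSingleton]
    exact mem_spanSingleton_self _ _
  obtain ⟨r, hr⟩ := (mem_one_iff _).1 h4
  have h5 := RingFilt.IsInfty.mul_sub_one_mem hφ (hL.inv_sub_one_mem hχ)
  rw [← hr, ← map_one (algebraMap R K), ← map_sub] at h5
  have h6 := sub_eq_zero.1 (hL.eq_zero_of_mem hN h5)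
  rw [h6, map_one] at hr
  exact ((mul_inv_eq_one₀ hχ0).1 hr.symm)

lemma natDegree_normPoly_of_coeIdeal_eq (hL : L.IsInfty) (hN : NormCompat k R K) {I J : Ideal R}
    (hI : I ≠ ⊥) {φ : K} (hφ : φ - 1 ∈ L.F (-1))
    (h : (J : FractionalIdeal R⁰ K) = spanSingleton R⁰ φ * I) :
    (normPoly J : k[X]).natDegree = (normPoly I : k[X]).natDegree := by
  refine natDegree_normPoly_of_norm_sub_one hN hI (ne_bot_of_coeIdeal_eq hI (hL.ne_zero hφ) h) h ?_
  simpa using hL.norm_one_add (by norm_num) hφ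

/-- Translating by an element close to `1 / X` lowers the trace by the degree of the field. -/
lemma idealTrace_of_translate (hL : L.IsInfty) (hN : NormCompat k R K) {I J J' : Ideal R}
    (hI : I ≠ ⊥) {φ w : K} (hφ : φ - 1 ∈ L.F (-1))
    (hw : w - algebraMap (RatFunc k) K RatFunc.X⁻¹ ∈ L.F (-2))
    (h1 : (J : FractionalIdeal R⁰ K) = spanSingleton R⁰ φ * I)
    (h2 : (J' : FractionalIdeal R⁰ K) = spanSingleton R⁰ (φ + w) * I)
    (hφw : φ + w ≠ 0) :
    (idealTrace J' : k) = idealTrace J - (Module.finrank (RatFunc k) K : ℕ) := by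
  have hφ0 := hL.ne_zero hφ
  have hJ := ne_bot_of_coeIdeal_eq hI hφ0 h1
  have hJ' := ne_bot_of_coeIdeal_eq hI hφw h2
  have hT : algebraMap (RatFunc k) K RatFunc.X⁻¹ ∈ L.F (-1) := by
    refine hL.map_mem ?_
    simpa using RingFilt.X_zpow_mem_rat (k := k) (-1)
  set T := algebraMap (RatFunc k) K RatFunc.X⁻¹ with hTdef
  have hT1 : (1 + T) - 1 ∈ L.F (-1) := by simpa using hT
  have hT0 := hL.ne_zero hT1
  have hTi : (1 + T)⁻¹ ∈ L.F 0 := by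
    have := add_mem (L.mono (by norm_num) (hL.inv_sub_one_mem hT1)) L.one_mem
    simpa using this
  have hφi := hL.inv_sub_one_mem hφ
  set ε := ((φ + w) * φ⁻¹ - (1 + T)) * (1 + T)⁻¹ with hε
  have hεm : ε ∈ L.F (-2) := by
    have h3 : (φ + w) * φ⁻¹ - (1 + T) = T * (φ⁻¹ - 1) + (w - T) * (φ⁻¹ - 1) + (w - T) := by
      field_simp
      ring
    rw [hε, h3]
    have := L.mul_mem (add_mem (add_mem (L.mul_mem hT hφi)
      (L.mono (by norm_num) (L.mul_mem hw hφi))) hw) hTi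
    simpa using this
  have hu : (φ + w) * φ⁻¹ = (1 + T) * (1 + ε) := by
    rw [hε]
    field_simp
    ring
  refine idealTrace_of_norm_sub (u := (φ + w) * φ⁻¹) hN hJ hJ' ?_ ?_
  · rw [h2, h1, ← mul_assoc, spanSingleton_mul_spanSingleton, inv_mul_cancel_right₀ hφ0]
  · have h4 : (1 + T) = algebraMap (RatFunc k) K (1 + RatFunc.X⁻¹) := by simp [hTdef]
    rw [hu, map_mul, h4, Algebra.norm_algebraMap, ← mul_sub_one]
    have h5 : (1 + RatFunc.X⁻¹ : RatFunc k) ∈ (RingFilt.rat k).F 0 := by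
      refine add_mem (RingFilt.one_mem _) ((RingFilt.rat k).mono (show (-1 : ℤ) ≤ 0 by norm_num) ?_)
      simpa using RingFilt.X_zpow_mem_rat (k := k) (-1)
    have h6 := RingFilt.pow_mem _ h5 (Module.finrank (RatFunc k) K)
    simpa using RingFilt.mul_mem _ h6 (hL.norm_one_add (by norm_num) hεm)

theorem sum_addChar_idealTrace_eq_zero (hrel : RelNormPrime k R) (hN : NormCompat k R K)
    (hL : L.IsInfty) (B : Finset K)
    (hB : Submodule.span k (B : Set K) ⊔ (ringSub k R K ⊔ L.F (-2)) = ⊤) {n : ℕ}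
    (hn : 2 * B.card < n) (ψ : AddChar k ℂ)
    (hψ : ψ (-(Module.finrank (RatFunc k) K : ℕ)) ≠ 1) :
    ∑ I ∈ (finite_setOf_natDegree_normPoly (R := R) hrel n).toFinset, ψ (idealTrace I) = 0 := by
  classical
  set X := (finite_setOf_natDegree_normPoly (R := R) hrel n).toFinset with hX
  have hmem (I : Ideal R) : I ∈ X ↔ I ≠ ⊥ ∧ (normPoly I : k[X]).natDegree = n := by simp [hX]
  let st : Setoid (Ideal R) := ⟨InftyEquiv L, InftyEquiv.refl, InftyEquiv.symm hL, InftyEquiv.trans⟩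
  let rep (I : Ideal R) : Ideal R := (Quotient.mk st I).out
  have hrep (I : Ideal R) : InftyEquiv L (rep I) I :=
    Quotient.exact (s := st) (Quotient.out_eq (Quotient.mk st I))
  have hrep_eq {I J : Ideal R} (h : InftyEquiv L I J) : rep I = rep J :=
    congrArg Quotient.out (Quotient.sound (s := st) h)
  have hrepX {I : Ideal R} (h : I ∈ X) : rep I ∈ X := by
    obtain ⟨φ, h1, h2⟩ := (hrep I).symm hL
    rw [hmem] at h ⊢
    exact ⟨ne_bot_of_coeIdeal_eq h.1 (hL.ne_zero h1) h2,
      (natDegree_normPoly_of_coeIdeal_eq hL hN h.1 h1 h2).trans h.2⟩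
  have hw (I : Ideal R) : ∃ w : K, I ∈ X → w ∈ invSub k K I ∧
      w - algebraMap (RatFunc k) K RatFunc.X⁻¹ ∈ L.F (-2) := by
    by_cases hI : I ∈ X
    · have hI' := (hmem I).1 hI
      have htop := invSub_sup_eq_top hrel L B hB hI'.1 (hI'.2.symm ▸ hn)
      have hx : algebraMap (RatFunc k) K RatFunc.X⁻¹ ∈ invSub k K I ⊔ L.F (-2) := htop ▸ trivial
      obtain ⟨w, hw, v, hv, hwv⟩ := Submodule.mem_sup.1 hx
      refine ⟨w, fun _ => ⟨hw, ?_⟩⟩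
      rw [← hwv]
      simpa using hv
    · exact ⟨0, fun h => absurd h hI⟩
  choose w hw using hw
  have hT : algebraMap (RatFunc k) K RatFunc.X⁻¹ ∈ L.F (-1) := by
    refine hL.map_mem ?_
    simpa using RingFilt.X_zpow_mem_rat (k := k) (-1)
  have hσ (I : Ideal R) : ∃ J : Ideal R, I ∈ X → ∃ φ : K, φ - 1 ∈ L.F (-1) ∧
      φ + w (rep I) - 1 ∈ L.F (-1) ∧
      (I : FractionalIdeal R⁰ K) = spanSingleton R⁰ φ * (rep I : Ideal R) ∧
      (J : FractionalIdeal R⁰ K) = spanSingleton R⁰ (φ + w (rep I)) * (rep I : Ideal R) := by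
    by_cases hI : I ∈ X
    · obtain ⟨φ, h1, h2⟩ := hrep I
      obtain ⟨h3, h4⟩ := hw _ (hrepX hI)
      obtain ⟨J, hJ⟩ := exists_coeIdeal_eq_of_mem_invSub
        (add_mem (mem_invSub_of_coeIdeal_eq (k := k) h2) h3)
      refine ⟨J, fun _ => ⟨φ, h1, ?_, h2, hJ⟩⟩
      have := add_mem (add_mem h1 (L.mono (by norm_num) h4)) hT
      convert this using 1
      ring
    · exact ⟨⊥, fun h => absurd h hI⟩
  choose σ hσ using hσ
  have hσX : ∀ I ∈ X, σ I ∈ X := by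
    intro I hI
    obtain ⟨φ, h1, h2, h3, h4⟩ := hσ I hI
    have hr := (hmem _).1 (hrepX hI)
    exact (hmem _).2 ⟨ne_bot_of_coeIdeal_eq hr.1 (hL.ne_zero h2) h4,
      (natDegree_normPoly_of_coeIdeal_eq hL hN hr.1 h2 h4).trans hr.2⟩
  have hσinj : ∀ I ∈ X, ∀ J ∈ X, σ I = σ J → I = J := by
    intro I hI J hJ hIJ
    obtain ⟨φ, h1, h2, h3, h4⟩ := hσ I hI
    obtain ⟨χ, h1', h2', h3', h4'⟩ := hσ J hJ
    have e1 : InftyEquiv L (rep I) (σ I) := ⟨_, h2, h4⟩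
    have e2 : InftyEquiv L (rep J) (σ J) := ⟨_, h2', h4'⟩
    have e3 : rep I = rep J := by
      refine hrep_eq (((hrep I).symm hL).trans (e1.trans ?_))
      rw [hIJ]
      exact (e2.symm hL).trans (hrep J)
    rw [← hIJ, ← e3] at h4'
    rw [← e3] at h2' h3'
    have hr := (hmem _).1 (hrepX hI)
    have := eq_of_coeIdeal_eq hL hN hr.1 h2 h2' h4 h4'
    rw [add_left_inj] at this
    rw [← this, ← h3] at h3'
    exact (coeIdeal_injective h3').symm
  have hσtr : ∀ I ∈ X, ψ (idealTrace (σ I)) =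
      ψ (idealTrace I) * ψ (-(Module.finrank (RatFunc k) K : ℕ)) := by
    intro I hI
    obtain ⟨φ, h1, h2, h3, h4⟩ := hσ I hI
    have hr := (hmem _).1 (hrepX hI)
    rw [idealTrace_of_translate hL hN hr.1 h1 (hw _ (hrepX hI)).2 h3 h4 (hL.ne_zero h2),
      sub_eq_add_neg, AddChar.map_add_eq_mul]
  have key : ∑ I ∈ X, ψ (idealTrace (σ I)) = ∑ I ∈ X, ψ (idealTrace I) :=
    Finset.sum_bij (fun I _ => σ I) hσX (fun I hI J hJ => hσinj I hI J hJ)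
      (fun J hJ => by
        have := Finset.surj_on_of_inj_on_of_card_le (fun I (_ : I ∈ X) => σ I) hσX
          (fun I J hI hJ => hσinj I hI J hJ) le_rfl J hJ
        obtain ⟨I, hI, h⟩ := this
        exact ⟨I, hI, h.symm⟩) (fun _ _ => rfl)
  rw [Finset.sum_congr rfl hσtr, ← Finset.sum_mul] at key
  by_contra h0
  exact hψ (mul_left_cancel₀ h0 (key.trans (mul_one _).symm))

end ClassSum

section DegreeRecursion

variable {R : Type*} [CommRing R] [IsDedekindDomain R]

/-- A degree function on the ideals of a Dedekind domain. -/
structure IsIdealDegree (d : Ideal R → ℕ) : Prop where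
  mul : ∀ {I J : Ideal R}, I ≠ ⊥ → J ≠ ⊥ → d (I * J) = d I + d J
  pos : ∀ {P : Ideal R}, P.IsMaximal → P ≠ ⊥ → 0 < d P
  finite : ∀ n, {I : Ideal R | I ≠ ⊥ ∧ d I = n}.Finite

namespace IsIdealDegree

variable {d : Ideal R → ℕ} (h : IsIdealDegree d)
include h

lemma top : d ⊤ = 0 := by
  have := h.mul (I := ⊤) (J := ⊤) bot_ne_top.symm bot_ne_top.symm
  rw [Ideal.mul_top] at this
  omega

lemma pow {P : Ideal R} (hP : P ≠ ⊥) (j : ℕ) : d (P ^ j) = j * d P := by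
  induction j with
  | zero => rw [pow_zero, Ideal.one_eq_top, h.top, zero_mul]
  | succ j ih => rw [pow_succ, h.mul (pow_ne_zero j hP) hP, ih, Nat.succ_mul]

lemma eq_sum_count [DecidableEq (Ideal R)] {I : Ideal R} (hI : I ≠ ⊥) :
    d I = ∑ P ∈ (UniqueFactorizationMonoid.normalizedFactors I).toFinset,
      (UniqueFactorizationMonoid.normalizedFactors I).count P * d P := by
  have key (s : Multiset (Ideal R)) (hs : ∀ P ∈ s, P ≠ ⊥) :
      s.prod ≠ ⊥ ∧ d s.prod = (s.map d).sum := by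
    induction s using Multiset.induction with
    | empty => exact ⟨by simp, by simpa using h.top⟩
    | cons P s ih =>
      obtain ⟨h1, h2⟩ := ih fun Q hQ => hs Q (Multiset.mem_cons_of_mem hQ)
      have h3 := hs P (Multiset.mem_cons_self _ _)
      rw [Multiset.prod_cons, Multiset.map_cons, Multiset.sum_cons, h.mul h3 h1, h2]
      exact ⟨mul_ne_zero h3 h1, rfl⟩
  have := (key (UniqueFactorizationMonoid.normalizedFactors I) fun P hP =>
    (UniqueFactorizationMonoid.prime_of_normalized_factor P hP).ne_zero).2
  rw [Ideal.prod_normalizedFactors_eq_self hI, Finset.sum_multiset_map_count] at this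
  simpa using this

/-- The ideals of given degree. -/
noncomputable def ideals (n : ℕ) : Finset (Ideal R) := (h.finite n).toFinset

lemma mem_ideals {n : ℕ} {I : Ideal R} : I ∈ h.ideals n ↔ I ≠ ⊥ ∧ d I = n := by
  simp [ideals]

lemma finite_primes {r : ℕ} (hr : r ≠ 0) :
    {P : Ideal R | P.IsMaximal ∧ P ≠ ⊥ ∧ d P ∣ r}.Finite := by
  refine ((Finset.range (r + 1)).biUnion h.ideals).finite_toSet.subset ?_
  rintro P ⟨-, h0, hd⟩
  have := Nat.le_of_dvd (Nat.pos_of_ne_zero hr) hd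
  simp only [Finset.coe_biUnion, Set.mem_iUnion, Finset.mem_coe, mem_ideals]
  exact ⟨d P, by simpa using by omega, h0, rfl⟩

/-- The prime ideals whose degree divides the given number. -/
noncomputable def primes (r : ℕ) : Finset (Ideal R) :=
  if hr : r ≠ 0 then (h.finite_primes hr).toFinset else ∅

lemma mem_primes {r : ℕ} {P : Ideal R} :
    P ∈ h.primes r ↔ r ≠ 0 ∧ P.IsMaximal ∧ P ≠ ⊥ ∧ d P ∣ r := by
  rw [primes]
  split_ifs with hr <;> simp_all

open scoped Classical in
lemma sum_primes_eq {I : Ideal R} (hI : I ≠ ⊥) :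
    ∑ r ∈ Finset.Icc 1 (d I), ∑ P ∈ h.primes r, (if P ^ (r / d P) ∣ I then d P else 0) = d I := by
  conv_rhs => rw [h.eq_sum_count hI]
  have e1 (P : Ideal R) : (UniqueFactorizationMonoid.normalizedFactors I).count P * d P =
      ∑ _j ∈ Finset.Icc 1 ((UniqueFactorizationMonoid.normalizedFactors I).count P), d P := by
    simp
  have hdvd {P : Ideal R} (hP : P.IsMaximal) (h0 : P ≠ ⊥) (j : ℕ) :
      P ^ j ∣ I ↔ j ≤ (UniqueFactorizationMonoid.normalizedFactors I).count P := by
    have hirr : Irreducible P := (Ideal.prime_of_isPrime h0 hP.isPrime).irreducible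
    rw [pow_dvd_iff_le_emultiplicity,
      UniqueFactorizationMonoid.emultiplicity_eq_count_normalizedFactors hirr hI, normalize_eq,
      Nat.cast_le]
  have hprime {P : Ideal R} (hP : P ∈ UniqueFactorizationMonoid.normalizedFactors I) :
      P.IsMaximal ∧ P ≠ ⊥ := by
    have := UniqueFactorizationMonoid.prime_of_normalized_factor P hP
    exact ⟨(Ideal.isPrime_of_prime this).isMaximal this.ne_zero, this.ne_zero⟩
  simp_rw [e1, ← Finset.sum_filter]
  rw [Finset.sum_sigma', Finset.sum_sigma']
  refine Finset.sum_bij' (fun x _ => ⟨x.2, x.1 / d x.2⟩) (fun y _ => ⟨y.2 * d y.1, y.1⟩)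
    ?_ ?_ ?_ ?_ ?_
  · rintro ⟨r, P⟩ hx
    simp only [Finset.mem_sigma, Finset.mem_Icc, Finset.mem_filter, mem_primes] at hx
    obtain ⟨hr, ⟨-, hP, h0, hd⟩, hx⟩ := hx
    rw [hdvd hP h0] at hx
    have h1 : 1 ≤ r / d P := Nat.div_pos (Nat.le_of_dvd hr.1 hd) (h.pos hP h0)
    simp only [Finset.mem_sigma, Finset.mem_Icc, Multiset.mem_toFinset]
    exact ⟨Multiset.count_pos.1 (by omega), h1, hx⟩
  · rintro ⟨P, j⟩ hy
    simp only [Finset.mem_sigma, Finset.mem_Icc, Multiset.mem_toFinset] at hy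
    obtain ⟨hPm, h1, h2⟩ := hy
    obtain ⟨hP, h0⟩ := hprime hPm
    have hpos := h.pos hP h0
    have hj : P ^ j ∣ I := (hdvd hP h0 j).2 h2
    obtain ⟨J, hJ⟩ := hj
    have hJ0 : J ≠ ⊥ := by
      rintro rfl
      exact hI (by simpa using hJ)
    have hdI : d I = j * d P + d J := by
      rw [← h.pow h0, ← h.mul (pow_ne_zero j h0) hJ0, ← hJ]
    have hjd : 1 ≤ j * d P := Nat.mul_pos h1 hpos
    simp only [Finset.mem_sigma, Finset.mem_Icc, Finset.mem_filter, mem_primes]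
    refine ⟨⟨hjd, by omega⟩, ⟨by omega, hP, h0, Dvd.intro_left _ rfl⟩, ?_⟩
    rw [Nat.mul_div_cancel _ hpos]
    exact ⟨J, hJ⟩
  · rintro ⟨r, P⟩ hx
    simp only [Finset.mem_sigma, Finset.mem_filter, mem_primes] at hx
    simp [Nat.div_mul_cancel hx.2.1.2.2.2]
  · rintro ⟨P, j⟩ hy
    simp only [Finset.mem_sigma, Multiset.mem_toFinset] at hy
    obtain ⟨hP, h0⟩ := hprime hy.1
    simp [Nat.mul_div_cancel _ (h.pos hP h0)]
  · rintro ⟨r, P⟩ hx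
    rfl

lemma ideals_zero : h.ideals 0 = {⊤} := by
  ext I
  rw [mem_ideals, Finset.mem_singleton]
  refine ⟨fun ⟨h0, h1⟩ => ?_, ?_⟩
  · by_contra hI
    obtain ⟨P, hP, hIP⟩ := Ideal.exists_le_maximal I hI
    have hP0 : P ≠ ⊥ := fun hP0 => h0 (le_bot_iff.1 (hP0 ▸ hIP))
    obtain ⟨J, rfl⟩ := Ideal.dvd_iff_le.2 hIP
    have hJ0 : J ≠ ⊥ := by
      rintro rfl
      simp at h0
    rw [h.mul hP0 hJ0] at h1
    have := h.pos hP hP0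
    omega
  · rintro rfl
    exact ⟨top_ne_bot, h.top⟩

variable {χ : Ideal R → ℂ} (hχ1 : χ ⊤ = 1)
  (hχ : ∀ {I J : Ideal R}, I ≠ ⊥ → J ≠ ⊥ → χ (I * J) = χ I * χ J)
include hχ hχ1

/-- The recursion between the sums of a character over ideals and over primes. -/
theorem natCast_mul_sum (n : ℕ) :
    (n : ℂ) * ∑ I ∈ h.ideals n, χ I =
      ∑ r ∈ Finset.Icc 1 n, (∑ P ∈ h.primes r, (d P : ℂ) * χ P ^ (r / d P)) *
        ∑ I ∈ h.ideals (n - r), χ I := by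
  classical
  have hpow {P : Ideal R} (hP : P ≠ ⊥) (j : ℕ) : χ (P ^ j) = χ P ^ j := by
    induction j with
    | zero => rw [pow_zero, pow_zero, Ideal.one_eq_top, hχ1]
    | succ j ih => rw [pow_succ, hχ (pow_ne_zero j hP) hP, ih, pow_succ]
  have e1 : (n : ℂ) * ∑ I ∈ h.ideals n, χ I = ∑ I ∈ h.ideals n, ∑ r ∈ Finset.Icc 1 n,
      ∑ P ∈ h.primes r, if P ^ (r / d P) ∣ I then (d P : ℂ) * χ I else 0 := by
    rw [Finset.mul_sum]
    refine Finset.sum_congr rfl fun I hI => ?_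
    obtain ⟨h0, h1⟩ := h.mem_ideals.1 hI
    have := h.sum_primes_eq h0
    rw [h1] at this
    conv_lhs => rw [← this]
    push_cast
    simp_rw [Finset.sum_mul, ite_mul, zero_mul]
  rw [e1, Finset.sum_comm]
  refine Finset.sum_congr rfl fun r hr => ?_
  rw [Finset.sum_comm, Finset.sum_mul]
  refine Finset.sum_congr rfl fun P hP => ?_
  obtain ⟨hr0, hPm, hP0, hd⟩ := h.mem_primes.1 hP
  rw [Finset.mem_Icc] at hr
  have hQ0 : P ^ (r / d P) ≠ ⊥ := pow_ne_zero _ hP0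
  have hQd : d (P ^ (r / d P)) = r := by rw [h.pow hP0, Nat.div_mul_cancel hd]
  rw [← hpow hP0, mul_assoc, Finset.mul_sum, Finset.mul_sum, ← Finset.sum_filter]
  refine (Finset.sum_bij (fun J _ => P ^ (r / d P) * J) ?_ ?_ ?_ ?_).symm
  · intro J hJ
    obtain ⟨h0, h1⟩ := h.mem_ideals.1 hJ
    rw [Finset.mem_filter, mem_ideals, h.mul hQ0 h0, hQd, h1]
    exact ⟨⟨mul_ne_zero hQ0 h0, by omega⟩, dvd_mul_right _ _⟩
  · intro J _ J' _ hJJ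
    exact mul_left_cancel₀ hQ0 hJJ
  · intro I hI
    rw [Finset.mem_filter, mem_ideals] at hI
    obtain ⟨⟨h0, h1⟩, J, rfl⟩ := hI
    have hJ0 : J ≠ ⊥ := by
      rintro rfl
      simp at h0
    rw [h.mul hQ0 hJ0, hQd] at h1
    exact ⟨J, h.mem_ideals.2 ⟨hJ0, by omega⟩, rfl⟩
  · intro J hJ
    rw [hχ hQ0 (h.mem_ideals.1 hJ).1]

end IsIdealDegree

end DegreeRecursion

section PowerSums

/-- Newton's identities: a finite recursion is solved by power sums. -/
lemma exists_eq_neg_sum_pow {c S : ℕ → ℂ} {n₀ : ℕ} (h0 : c 0 = 1) (hc : ∀ n, n₀ < n → c n = 0)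
    (hS : ∀ n : ℕ, (n : ℂ) * c n = ∑ r ∈ Finset.Icc 1 n, S r * c (n - r)) :
    ∃ ω : Fin n₀ → ℂ, ∀ r, r ≠ 0 → S r = -∑ i, ω i ^ r := by
  set f : ℂ[X] := ∑ i ∈ Finset.range (n₀ + 1), C (c i) * X ^ (n₀ - i) with hf
  have hcoeff {i : ℕ} (hi : i ≤ n₀) : f.coeff (n₀ - i) = c i := by
    rw [hf, finsetSum_coeff, Finset.sum_eq_single i]
    · simp
    · intro j hj hji
      rw [coeff_C_mul, coeff_X_pow, if_neg, mul_zero]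
      rw [Finset.mem_range] at hj
      omega
    · intro h
      exact absurd (Finset.mem_range.2 (by omega)) h
  have hdeg : f.natDegree ≤ n₀ := natDegree_sum_le_of_forall_le _ _ fun i _ =>
    (natDegree_C_mul_X_pow_le _ _).trans (Nat.sub_le _ _)
  have hmon : f.Monic := monic_of_natDegree_le_of_coeff_eq_one n₀ hdeg (by
    simpa [h0] using hcoeff (Nat.zero_le n₀))
  have hdeg' : f.natDegree = n₀ := by
    refine le_antisymm hdeg (le_natDegree_of_ne_zero ?_)
    have := hcoeff (Nat.zero_le n₀)
    rw [Nat.sub_zero, h0] at this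
    simp [this]
  have hsplit : f.Splits := IsAlgClosed.splits f
  have hcard : f.roots.card = n₀ := hdeg' ▸ hsplit.natDegree_eq_card_roots.symm
  obtain ⟨ω, hω⟩ : ∃ ω : Fin n₀ → ℂ, f.roots = Finset.univ.val.map ω := by
    obtain ⟨l, hl⟩ := Quotient.exists_rep f.roots
    have hl' : l.length = n₀ := by
      rw [← hcard, ← hl]
      rfl
    subst hl'
    refine ⟨l.get, ?_⟩
    rw [← hl, Fin.univ_val_map, List.ofFn_get]
    rfl
  have hesymm (i : ℕ) : c i =
      (-1) ^ i * MvPolynomial.aeval ω (MvPolynomial.esymm (Fin n₀) ℂ i) := by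
    rw [MvPolynomial.aeval_esymm_eq_multiset_esymm, ← hω]
    rcases le_or_gt i n₀ with hi | hi
    · rw [← hcoeff hi, Polynomial.coeff_eq_esymm_roots_of_card (hcard.trans hdeg'.symm)
        (by omega), hmon.leadingCoeff, one_mul, hdeg', Nat.sub_sub_self hi]
    · rw [hc i hi, Multiset.esymm, Multiset.powersetCard_eq_empty _ (by omega)]
      simp
  have hnewton (n : ℕ) : (n : ℂ) * c n = ∑ r ∈ Finset.Icc 1 n, (-∑ i, ω i ^ r) * c (n - r) := by
    have := congrArg (MvPolynomial.aeval ω) (MvPolynomial.mul_esymm_eq_sum (Fin n₀) ℂ n)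
    rw [map_mul, map_natCast, map_mul, map_pow, map_neg, map_one, map_sum] at this
    rw [hesymm n, mul_left_comm, this, ← mul_assoc, ← pow_add, ← add_assoc, ← two_mul, pow_succ,
      pow_mul]
    simp only [even_two, Even.neg_pow, one_pow, mul_neg, mul_one, neg_mul, one_mul]
    rw [← Finset.sum_neg_distrib]
    refine Finset.sum_bij' (fun a _ => a.2) (fun r _ => (n - r, r)) ?_ ?_ ?_ ?_ ?_
    · rintro ⟨a, b⟩ ha
      simp only [Finset.mem_filter, Finset.HasAntidiagonal.mem_antidiagonal] at ha
      rw [Finset.mem_Icc]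
      omega
    · intro r hr
      rw [Finset.mem_Icc] at hr
      simp only [Finset.mem_filter, Finset.HasAntidiagonal.mem_antidiagonal]
      omega
    · rintro ⟨a, b⟩ ha
      simp only [Finset.mem_filter, Finset.HasAntidiagonal.mem_antidiagonal] at ha
      ext <;> simp
      omega
    · intro r hr
      rfl
    · rintro ⟨a, b⟩ ha
      simp only [Finset.mem_filter, Finset.HasAntidiagonal.mem_antidiagonal] at ha
      have : n - b = a := by omega
      rw [this, hesymm a, MvPolynomial.psum]
      simp
      ring
  refine ⟨ω, fun r => ?_⟩
  induction r using Nat.strong_induction_on with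
  | _ r ih =>
    intro hr
    have := (hS r).symm.trans (hnewton r)
    rw [← Finset.Ico_add_one_right_eq_Icc, Finset.sum_Ico_succ_top (by omega),
      Finset.sum_Ico_succ_top (by omega), Nat.sub_self, h0, mul_one, mul_one] at this
    have e : ∑ k ∈ Finset.Ico 1 r, S k * c (r - k) =
        ∑ k ∈ Finset.Ico 1 r, (-∑ i, ω i ^ k) * c (r - k) :=
      Finset.sum_congr rfl fun k hk => by
        rw [Finset.mem_Ico] at hk
        rw [ih k hk.2 (by omega)]
    rw [e] at this
    exact add_left_cancel this

/-- Power sums of slow growth have small terms. -/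
lemma norm_le_of_norm_sum_pow_le {ι : Type*} [Fintype ι] {z : ι → ℂ} {D B : ℝ} (hB : 0 < B)
    (h : ∀ j, j ≠ 0 → ‖∑ i, z i ^ j‖ ≤ D * B ^ j) (i : ι) : ‖z i‖ ≤ B := by
  classical
  by_contra! hlt
  have hz0 : z i ≠ 0 := by
    intro h0
    rw [h0, norm_zero] at hlt
    exact hlt.not_ge hB.le
  set f : ℂ[X] := X * ∏ w ∈ (Finset.univ.image z).erase (z i), (X - C w) with hf
  have hfi : f.eval (z i) ≠ 0 := by
    rw [hf, eval_mul, eval_X, eval_prod]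
    refine mul_ne_zero hz0 (Finset.prod_ne_zero_iff.2 fun w hw => ?_)
    rw [eval_sub, eval_X, eval_C, sub_ne_zero]
    exact (Finset.ne_of_mem_erase hw).symm
  have hfj {j : ι} (hj : z j ≠ z i) : f.eval (z j) = 0 := by
    rw [hf, eval_mul, eval_prod, Finset.prod_eq_zero (i := z j), mul_zero]
    · exact Finset.mem_erase.2 ⟨hj, Finset.mem_image_of_mem _ (Finset.mem_univ _)⟩
    · simp
  have hf0 : f.coeff 0 = 0 := by simp [hf, mul_coeff_zero]
  set M : ℕ := (Finset.univ.filter fun j => z j = z i).card with hM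
  have hM1 : (1 : ℝ) ≤ M := by
    exact_mod_cast Finset.card_pos.2 ⟨i, by simp⟩
  have e1 (n : ℕ) : ∑ j, z j ^ n * f.eval (z j) = M * (z i ^ n * f.eval (z i)) := by
    rw [← Finset.sum_filter_add_sum_filter_not Finset.univ (fun j => z j = z i)]
    rw [Finset.sum_congr rfl (g := fun _ => z i ^ n * f.eval (z i)) (fun j hj => by
      rw [(Finset.mem_filter.1 hj).2]), Finset.sum_const, nsmul_eq_mul]
    rw [Finset.sum_eq_zero (fun j hj => by
      rw [hfj (Finset.mem_filter.1 hj).2, mul_zero]), add_zero]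
  have e2 (n : ℕ) : ∑ j, z j ^ n * f.eval (z j) =
      ∑ l ∈ Finset.range (f.natDegree + 1), f.coeff l * ∑ j, z j ^ (n + l) := by
    simp_rw [eval_eq_sum_range, Finset.mul_sum]
    rw [Finset.sum_comm]
    refine Finset.sum_congr rfl fun l _ => Finset.sum_congr rfl fun j _ => ?_
    ring
  set A : ℝ := ∑ l ∈ Finset.range (f.natDegree + 1), ‖f.coeff l‖ * (D * B ^ l) with hA
  have e3 (n : ℕ) : ‖z i‖ ^ n * ‖f.eval (z i)‖ ≤ A * B ^ n := by
    calc ‖z i‖ ^ n * ‖f.eval (z i)‖ ≤ M * (‖z i‖ ^ n * ‖f.eval (z i)‖) :=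
          le_mul_of_one_le_left (by positivity) hM1
      _ = ‖∑ j, z j ^ n * f.eval (z j)‖ := by rw [e1]; simp
      _ ≤ ∑ l ∈ Finset.range (f.natDegree + 1), ‖f.coeff l * ∑ j, z j ^ (n + l)‖ := by
          rw [e2]
          exact norm_sum_le _ _
      _ ≤ ∑ l ∈ Finset.range (f.natDegree + 1), ‖f.coeff l‖ * (D * B ^ l) * B ^ n := by
          refine Finset.sum_le_sum fun l _ => ?_
          rw [norm_mul]
          rcases eq_or_ne l 0 with rfl | hl
          · rw [hf0]; simp
          · have := h (n + l) (by omega)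
            calc _ ≤ ‖f.coeff l‖ * (D * B ^ (n + l)) := by gcongr
              _ = _ := by ring
      _ = _ := by rw [hA, Finset.sum_mul]
  have hpos : 0 < ‖f.eval (z i)‖ := norm_pos_iff.2 hfi
  have hratio : 1 < ‖z i‖ / B := (one_lt_div hB).2 hlt
  obtain ⟨n, hn⟩ := pow_unbounded_of_one_lt (A / ‖f.eval (z i)‖) hratio
  have := e3 n
  rw [div_pow, div_lt_div_iff₀ hpos (by positivity)] at hn
  linarith

end PowerSums

section HomSums

variable {p : ℕ} [Fact p.Prime] {R : Type*} [CommRing R] [IsDedekindDomain R]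
  [Algebra (ZMod p)[X] R] [Module.Finite (ZMod p)[X] R] [Module.IsTorsionFree (ZMod p)[X] R]
  [Algebra (ZMod p) R] [IsScalarTower (ZMod p) (ZMod p)[X] R]

lemma isIdealDegree_natDegree_normPoly (hrel : RelNormPrime (ZMod p) R) :
    IsIdealDegree fun I : Ideal R => (normPoly I : (ZMod p)[X]).natDegree where
  mul hI hJ := by rw [normPoly_mul hI hJ, (monic_normPoly hI).natDegree_mul (monic_normPoly hJ)]
  pos {P} hP h0 := by
    have := finiteDimensional_quotient_ideal (ZMod p) h0
    rw [← finrank_quotient_eq_natDegree hrel h0]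
    exact Module.finrank_pos
  finite n := finite_setOf_natDegree_normPoly hrel n

/-- The homomorphisms with values in the field with `p ^ r` elements and of given trace. -/
def traceHoms (R : Type*) [CommRing R] [Algebra (ZMod p)[X] R] [Algebra (ZMod p) R]
    (Ω : Type*) [Field Ω] [Algebra (ZMod p) Ω] (r : ℕ) (β : ZMod p) : Set (R →ₐ[ZMod p] Ω) :=
  {τ | (∀ x, τ x ^ p ^ r = τ x) ∧
    ∑ i ∈ Finset.range r, τ (algebraMap (ZMod p)[X] R X) ^ p ^ i = algebraMap (ZMod p) Ω β}

variable {Ω : Type*} [Field Ω] [Algebra (ZMod p) Ω]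

lemma ker_mem_primes (hrel : RelNormPrime (ZMod p) R) {r : ℕ} (hr : r ≠ 0)
    {τ : R →ₐ[ZMod p] Ω} (hτ : ∀ x, τ x ^ p ^ r = τ x) :
    RingHom.ker τ ∈ (isIdealDegree_natDegree_normPoly hrel).primes r := by
  have hp := (Fact.out : p.Prime)
  have h0 : RingHom.ker τ ≠ ⊥ := by
    intro h
    have hinj : Function.Injective τ := (RingHom.injective_iff_ker_eq_bot _).2 h
    set f : (ZMod p)[X] := X ^ p ^ r - X with hf
    have hf0 : f ≠ 0 := FiniteField.X_pow_card_pow_sub_X_ne_zero _ hr hp.one_lt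
    have : algebraMap (ZMod p)[X] R f = 0 := by
      apply hinj
      rw [map_zero, hf, map_sub, map_sub, map_pow, map_pow, hτ, sub_self]
    exact hf0 ((FaithfulSMul.algebraMap_eq_zero_iff _ _).1 this)
  have hprime : (RingHom.ker τ).IsPrime := RingHom.ker_isPrime _
  have hmax : (RingHom.ker τ).IsMaximal := hprime.isMaximal h0
  rw [IsIdealDegree.mem_primes]
  refine ⟨hr, hmax, h0, ?_⟩
  let : Field (R ⧸ RingHom.ker τ) := Ideal.Quotient.field _
  have := finite_quotient_ideal (ZMod p) h0
  rw [← finrank_quotient_eq_natDegree hrel h0,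
    ← FiniteField.orderOf_frobeniusAlgHom (ZMod p) (R ⧸ RingHom.ker τ)]
  refine orderOf_dvd_of_pow_eq_one (DFunLike.ext _ _ fun x => ?_)
  obtain ⟨x, rfl⟩ := Ideal.Quotient.mk_surjective x
  rw [AlgHom.coe_pow, FiniteField.coe_frobeniusAlgHom, pow_iterate, AlgHom.one_apply,
    ZMod.card]
  simp only
  rw [← map_pow, Ideal.Quotient.eq, RingHom.mem_ker, map_sub, map_pow, hτ, sub_self]

lemma Finset.sum_range_mul_of_periodic {M : Type*} [AddCommMonoid M] {f : ℕ → M} {d : ℕ}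
    (hf : ∀ i, f (d + i) = f i) (j : ℕ) :
    ∑ i ∈ Finset.range (d * j), f i = j • ∑ i ∈ Finset.range d, f i := by
  induction j with
  | zero => simp
  | succ j ih =>
    have : d * (j + 1) = d + d * j := by ring
    rw [this, Finset.sum_range_add, Finset.sum_congr rfl (fun i _ => hf i), ih, succ_nsmul']

variable [IsAlgClosed Ω]

lemma ncard_ker_eq (hrel : RelNormPrime (ZMod p) R) {P : Ideal R} (hP : P.IsMaximal)
    (h0 : P ≠ ⊥) : {τ : R →ₐ[ZMod p] Ω | RingHom.ker τ = P}.Finite ∧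
    {τ : R →ₐ[ZMod p] Ω | RingHom.ker τ = P}.ncard =
      (normPoly P : (ZMod p)[X]).natDegree := by
  let : Field (R ⧸ P) := Ideal.Quotient.field P
  have := finite_quotient_ideal (ZMod p) h0
  have := finiteDimensional_quotient_ideal (ZMod p) h0
  let e : {τ : R →ₐ[ZMod p] Ω | RingHom.ker τ = P} ≃ ((R ⧸ P) →ₐ[ZMod p] Ω) :=
    { toFun := fun τ => Ideal.Quotient.liftₐ P τ.1 fun a ha => by
        rw [← τ.2] at ha
        exact ha
      invFun := fun σ => ⟨σ.comp (Ideal.Quotient.mkₐ (ZMod p) P), by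
        ext x
        rw [RingHom.mem_ker]
        change σ (Ideal.Quotient.mk P x) = 0 ↔ _
        rw [map_eq_zero_iff σ σ.toRingHom.injective, Ideal.Quotient.eq_zero_iff_mem]⟩
      left_inv := fun τ => by
        ext x
        rfl
      right_inv := fun σ => by
        ext x
        obtain ⟨x, rfl⟩ := Ideal.Quotient.mk_surjective x
        rfl }
  refine ⟨Set.finite_coe_iff.1 (Finite.of_equiv _ e.symm), ?_⟩
  rw [← Nat.card_coe_set_eq, Nat.card_congr e, ← finrank_quotient_eq_natDegree hrel h0,
    Nat.card_eq_fintype_card]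
  exact AlgHom.card (ZMod p) (R ⧸ P) Ω

lemma mem_traceHoms_iff (hrel : RelNormPrime (ZMod p) R) {r : ℕ}
    {P : Ideal R} (hP : P ∈ (isIdealDegree_natDegree_normPoly hrel).primes r)
    {τ : R →ₐ[ZMod p] Ω} (hτ : RingHom.ker τ = P) (β : ZMod p) :
    τ ∈ traceHoms R Ω r β ↔
      (r / (normPoly P : (ZMod p)[X]).natDegree) • (idealTrace P : ZMod p) = β := by
  obtain ⟨hr, hm, h0, hd⟩ := (IsIdealDegree.mem_primes _).1 hP
  let : Field (R ⧸ P) := Ideal.Quotient.field P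
  have := finite_quotient_ideal (ZMod p) h0
  have := finiteDimensional_quotient_ideal (ZMod p) h0
  obtain ⟨j, hj⟩ := hd
  set d := (normPoly P : (ZMod p)[X]).natDegree with hd
  have hd0 : d ≠ 0 := by
    rintro h
    rw [h, zero_mul] at hj
    exact hr hj
  have hdr : Module.finrank (ZMod p) (R ⧸ P) = d := finrank_quotient_eq_natDegree hrel h0
  let := Fintype.ofFinite (R ⧸ P)
  have hcard : Fintype.card (R ⧸ P) = p ^ d := by
    rw [Module.card_eq_pow_finrank (K := ZMod p), ZMod.card, hdr]
  obtain ⟨σ, hσ⟩ : ∃ σ : (R ⧸ P) →ₐ[ZMod p] Ω, ∀ x, σ (Ideal.Quotient.mk P x) = τ x :=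
    ⟨Ideal.Quotient.liftₐ P τ fun a ha => by rwa [← hτ] at ha, fun _ => rfl⟩
  have hper (x : R) (i : ℕ) : τ x ^ p ^ (d + i) = τ x ^ p ^ i := by
    rw [pow_add, pow_mul, ← hσ, ← map_pow, ← hcard, FiniteField.pow_card]
  have hfix (x : R) : τ x ^ p ^ r = τ x := by
    rw [hj]
    have (n : ℕ) : τ x ^ p ^ (d * n) = τ x := by
      induction n with
      | zero => simp
      | succ n ih => rw [Nat.mul_succ, add_comm, hper, ih]
    exact this j
  rw [traceHoms, Set.mem_ofPred_eq, and_iff_right hfix, hj,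
    Finset.sum_range_mul_of_periodic (hper _), Nat.mul_div_cancel_left _ (Nat.pos_of_ne_zero hd0),
    idealTrace_prime hrel hm h0]
  have htr := congrArg σ (FiniteField.algebraMap_trace_eq_sum_pow (ZMod p) (R ⧸ P)
    (Ideal.Quotient.mk P (algebraMap (ZMod p)[X] R X)))
  rw [AlgHom.commutes, map_sum, hdr, Nat.card_zmod] at htr
  simp_rw [map_pow, hσ] at htr
  rw [← htr, ← map_nsmul, (algebraMap (ZMod p) Ω).injective.eq_iff]

lemma finite_traceHoms (hrel : RelNormPrime (ZMod p) R) {r : ℕ} (hr : r ≠ 0) (β : ZMod p) :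
    (traceHoms R Ω r β).Finite := by
  have : (⋃ P ∈ (isIdealDegree_natDegree_normPoly (R := R) hrel).primes r,
      {τ : R →ₐ[ZMod p] Ω | RingHom.ker τ = P}).Finite := by
    refine Set.Finite.biUnion (Finset.finite_toSet _) fun P hP => ?_
    obtain ⟨-, hm, h0, -⟩ := (IsIdealDegree.mem_primes _).1 hP
    exact (ncard_ker_eq hrel hm h0).1
  refine this.subset fun τ hτ => ?_
  simp only [Set.mem_iUnion]
  exact ⟨_, ker_mem_primes hrel hr hτ.1, rfl⟩

lemma ncard_traceHoms (hrel : RelNormPrime (ZMod p) R) {r : ℕ} (hr : r ≠ 0) (β : ZMod p) :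
    (traceHoms R Ω r β).ncard = ∑ P ∈ (isIdealDegree_natDegree_normPoly hrel).primes r,
      if (r / (normPoly P : (ZMod p)[X]).natDegree) • (idealTrace P : ZMod p) = β then
        (normPoly P : (ZMod p)[X]).natDegree else 0 := by
  classical
  rw [Set.ncard_eq_toFinset_card _ (finite_traceHoms hrel hr β),
    Finset.card_eq_sum_card_fiberwise (f := fun τ : R →ₐ[ZMod p] Ω => RingHom.ker τ)
      (t := (isIdealDegree_natDegree_normPoly hrel).primes r)]
  · refine Finset.sum_congr rfl fun P hP => ?_
    obtain ⟨-, hm, h0, -⟩ := (IsIdealDegree.mem_primes _).1 hP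
    split_ifs with hβ
    · rw [← (ncard_ker_eq (Ω := Ω) hrel hm h0).2, ← Set.ncard_coe_finset]
      congr 1
      ext τ
      simp only [Finset.coe_filter, Set.Finite.mem_toFinset, Set.mem_ofPred_eq,
        and_iff_right_iff_imp]
      exact fun hτ => (mem_traceHoms_iff hrel hP hτ β).2 hβ
    · rw [Finset.card_eq_zero, Finset.filter_eq_empty_iff]
      intro τ hτ hker
      rw [Set.Finite.mem_toFinset] at hτ
      exact hβ ((mem_traceHoms_iff hrel hP hker β).1 hτ)
  · intro τ hτ
    rw [Finset.mem_coe, Set.Finite.mem_toFinset] at hτ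
    exact ker_mem_primes hrel hr hτ.1

/-- The prime sum of an additive character as a character sum over homomorphisms. -/
theorem sum_primes_eq_sum_traceHoms (Ω : Type*) [Field Ω] [Algebra (ZMod p) Ω] [IsAlgClosed Ω]
    (hrel : RelNormPrime (ZMod p) R) {r : ℕ} (hr : r ≠ 0)
    (ψ : AddChar (ZMod p) ℂ) :
    ∑ P ∈ (isIdealDegree_natDegree_normPoly (R := R) hrel).primes r,
      ((normPoly P : (ZMod p)[X]).natDegree : ℂ) *
        ψ (idealTrace P) ^ (r / (normPoly P : (ZMod p)[X]).natDegree) =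
      ∑ β, ψ β * ((traceHoms R Ω r β).ncard : ℂ) := by
  simp_rw [ncard_traceHoms hrel hr, Nat.cast_sum, Finset.mul_sum]
  rw [Finset.sum_comm]
  refine Finset.sum_congr rfl fun P _ => ?_
  rw [← AddChar.map_nsmul_eq_pow]
  simp [mul_comm]

end HomSums

section RiemannHypothesis

variable {p : ℕ} [Fact p.Prime] {R K : Type*} [CommRing R] [IsDedekindDomain R]
  [Algebra (ZMod p)[X] R] [Module.Finite (ZMod p)[X] R] [Module.IsTorsionFree (ZMod p)[X] R]
  [Algebra (ZMod p) R] [IsScalarTower (ZMod p) (ZMod p)[X] R] [Field K] [Algebra R K]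
  [IsFractionRing R K] [Algebra (ZMod p) K] [IsScalarTower (ZMod p) R K]
  [Algebra (RatFunc (ZMod p)) K] [FiniteDimensional (RatFunc (ZMod p)) K]
  {L : RingFilt (ZMod p) K}

/-- Square root cancellation over the prime field follows from square root cancellation over
sufficiently many extensions. -/
theorem norm_sum_traceHoms_one_le (Ω : Type*) [Field Ω] [Algebra (ZMod p) Ω] [IsAlgClosed Ω]
    (hrel : RelNormPrime (ZMod p) R) (hN : NormCompat (ZMod p) R K)
    (hL : L.IsInfty) (B : Finset K)
    (hB : Submodule.span (ZMod p) (B : Set K) ⊔ (ringSub (ZMod p) R K ⊔ L.F (-2)) = ⊤)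
    (ψ : AddChar (ZMod p) ℂ) (hψ : ψ (-(Module.finrank (RatFunc (ZMod p)) K : ℕ)) ≠ 1)
    (hS : ∃ C r₀ : ℕ, 0 < r₀ ∧ ∀ μ, μ ≠ 0 → r₀ ∣ μ →
      ‖∑ β, ψ β * ((traceHoms R Ω (2 * μ) β).ncard : ℂ)‖ ≤ C * (p : ℝ) ^ μ) :
    ‖∑ β, ψ β * ((traceHoms R Ω 1 β).ncard : ℂ)‖ ≤ 2 * B.card * √p := by
  have hp := (Fact.out : p.Prime)
  have hp0 : (0 : ℝ) < p := by exact_mod_cast hp.pos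
  set h := isIdealDegree_natDegree_normPoly (R := R) hrel with hh
  have hone : ψ (idealTrace (⊤ : Ideal R)) = 1 := by
    rw [idealTrace, normPoly_top]
    simp [nextCoeff]
  obtain ⟨ω, hω⟩ := exists_eq_neg_sum_pow (c := fun n => ∑ I ∈ h.ideals n, ψ (idealTrace I))
    (S := fun r => ∑ β, ψ β * ((traceHoms R Ω r β).ncard : ℂ)) (n₀ := 2 * B.card)
    (by simp only [h.ideals_zero, Finset.sum_singleton, hone])
    (fun n hn => sum_addChar_idealTrace_eq_zero hrel hN hL B hB hn ψ hψ)
    (fun n => by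
      rw [h.natCast_mul_sum hone (fun hI hJ => by
        rw [idealTrace_mul hI hJ, AddChar.map_add_eq_mul])]
      refine Finset.sum_congr rfl fun r hr => ?_
      rw [Finset.mem_Icc] at hr
      rw [sum_primes_eq_sum_traceHoms Ω hrel (by omega)])
  obtain ⟨C, r₀, hr₀, hC⟩ := hS
  have hz (i : Fin (2 * B.card)) : ‖ω i‖ ≤ √p := by
    have := norm_le_of_norm_sum_pow_le (z := fun i => ω i ^ (2 * r₀)) (D := C)
      (B := (p : ℝ) ^ r₀) (by positivity) (fun j hj => by
        have := hC (r₀ * j) (by positivity) (Dvd.intro _ rfl)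
        rw [hω _ (by positivity), norm_neg, pow_mul] at this
        simpa only [← pow_mul, mul_assoc] using this) i
    rw [norm_pow, pow_mul] at this
    exact Real.le_sqrt_of_sq_le ((pow_le_pow_iff_left₀ (by positivity) hp0.le hr₀.ne').1 this)
  have h1 := hω 1 one_ne_zero
  rw [h1, norm_neg]
  refine (norm_sum_le _ _).trans ?_
  simp_rw [pow_one]
  refine (Finset.sum_le_sum fun i _ => hz i).trans ?_
  simp

end RiemannHypothesis

section Compat

variable {k R K : Type*} [Field k] [CommRing R] [IsDedekindDomain R]
  [Algebra k[X] R] [Module.Finite k[X] R] [Module.IsTorsionFree k[X] R]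
  [Field K] [Algebra R K] [IsFractionRing R K] [Algebra k[X] K] [IsScalarTower k[X] R K]
  [Algebra (RatFunc k) K] [IsScalarTower k[X] (RatFunc k) K]

variable (k R K) in
lemma relNormPrime_of_isSeparable [Algebra.IsSeparable (RatFunc k) K] : RelNormPrime k R := by
  let _ : Algebra (FractionRing k[X]) (FractionRing R) := FractionRing.liftAlgebra _ _
  intro P hP
  have : (P.under k[X]).IsMaximal := Ideal.isMaximal_comap_of_isIntegral_of_isMaximal P
  have : Algebra.IsSeparable (FractionRing k[X]) (FractionRing R) := by
    refine Algebra.IsSeparable.of_equiv_equiv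
      (FractionRing.algEquiv k[X] (RatFunc k)).symm.toRingEquiv
      (FractionRing.algEquiv R K).symm.toRingEquiv ?_
    refine IsLocalization.ringHom_ext k[X]⁰ ?_
    refine RingHom.ext fun f => ?_
    change algebraMap (FractionRing k[X]) (FractionRing R)
        ((FractionRing.algEquiv k[X] (RatFunc k)).symm (algebraMap k[X] (RatFunc k) f)) =
      (FractionRing.algEquiv R K).symm (algebraMap (RatFunc k) K (algebraMap k[X] (RatFunc k) f))
    rw [AlgEquiv.commutes, ← IsScalarTower.algebraMap_apply k[X] (RatFunc k) K,
      IsScalarTower.algebraMap_apply k[X] R K, AlgEquiv.commutes,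
      ← IsScalarTower.algebraMap_apply k[X] (FractionRing k[X]) (FractionRing R),
      IsScalarTower.algebraMap_apply k[X] R (FractionRing R)]
  exact relNorm_eq_pow_of_separable P (P.under k[X])

variable (k R K) in
lemma normCompat_of_isIntegralClosure [IsIntegralClosure R k[X] K]
    [FiniteDimensional (RatFunc k) K] : NormCompat k R K := by
  intro x
  rw [← Algebra.algebraMap_intNorm (A := k[X]) (K := RatFunc k) (L := K) (B := R),
    Algebra.intNorm_eq_norm]

end Compat

section FunctionField

variable {k : Type*} [Field k] {Φ : k[X][X]} {δ : ℕ}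

/-- A bivariate polynomial as a polynomial over the field of rational functions. -/
noncomputable abbrev toRat (Φ : k[X][X]) : (RatFunc k)[X] := Φ.map (algebraMap k[X] (RatFunc k))

lemma natDegree_toRat (hm : Φ.Monic) : (toRat Φ).natDegree = Φ.natDegree := hm.natDegree_map _

lemma irreducible_toRat (hm : Φ.Monic) (hirr : Irreducible Φ) : Irreducible (toRat Φ) :=
  (hm.irreducible_iff_irreducible_map_fraction_map).1 hirr

lemma DegBound.toRat (hm : Φ.Monic) (h : DegBound δ Φ) :
    toRat Φ ∈ ((RingFilt.rat k).poly δ).F (δ * (toRat Φ).natDegree) := by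
  intro i
  rw [coeff_map, natDegree_toRat hm, RingFilt.algebraMap_mem_rat]
  exact h i

variable (δ) in
lemma exists_mem_adj_rat (Ψ : (RatFunc k)[X]) (x : AdjoinRoot Ψ) :
    ∃ n, x ∈ ((RingFilt.rat k).adj δ Ψ).F n := by
  obtain ⟨g, rfl⟩ := AdjoinRoot.mk_surjective x
  induction g using Polynomial.induction_on' with
  | add f g hf hg =>
    obtain ⟨a, ha⟩ := hf
    obtain ⟨b, hb⟩ := hg
    rw [map_add]
    exact ⟨max a b, add_mem (RingFilt.mono _ (le_max_left _ _) ha)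
      (RingFilt.mono _ (le_max_right _ _) hb)⟩
  | monomial i a =>
    rw [← C_mul_X_pow_eq_monomial, map_mul, map_pow, AdjoinRoot.mk_C, AdjoinRoot.mk_X]
    exact ⟨_, RingFilt.mul_mem _ (RingFilt.of_mem_adj (RingFilt.mem_rat_intDegree a))
      (RingFilt.pow_mem _ (RingFilt.root_mem_adj _ _ _) i)⟩

variable [Fact (Irreducible (toRat Φ))]

lemma isInfty_adj (hm : Φ.Monic) (h : DegBound δ Φ) :
    ((RingFilt.rat k).adj δ (toRat Φ)).IsInfty := by
  have hm' : (toRat Φ).Monic := hm.map _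
  refine ⟨exists_mem_adj_rat δ _, fun hx => RingFilt.of_mem_adj hx, fun {n x} hx => ?_,
    fun hn hx => RingFilt.norm_one_add_adj_mem hm' (h.toRat hm) hn hx⟩
  have := RingFilt.norm_adj_mem hm' (h.toRat hm) hx
  rwa [(AdjoinRoot.powerBasis' hm').finrank]

variable {R : Type*} [CommRing R] [Algebra k[X] R] [Algebra R (AdjoinRoot (toRat Φ))]
  [IsScalarTower k[X] R (AdjoinRoot (toRat Φ))] [Algebra k R]
  [IsScalarTower k R (AdjoinRoot (toRat Φ))]

open Classical in
lemma exists_finset_span_sup_eq_top (δ : ℕ) (hm : Φ.Monic)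
    (y : R) (hy : algebraMap R (AdjoinRoot (toRat Φ)) y = AdjoinRoot.root (toRat Φ)) :
    ∃ B : Finset (AdjoinRoot (toRat Φ)), B.card ≤ Φ.natDegree * (δ * Φ.natDegree + 1) ∧
      Submodule.span k (B : Set (AdjoinRoot (toRat Φ))) ⊔ (ringSub k R (AdjoinRoot (toRat Φ)) ⊔
        ((RingFilt.rat k).adj δ (toRat Φ)).F (-2)) = ⊤ := by
  have hm' : (toRat Φ).Monic := hm.map _
  set y' := AdjoinRoot.root (toRat Φ) with hy'
  let f : ℕ → ℕ → AdjoinRoot (toRat Φ) := fun i j =>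
    AdjoinRoot.of (toRat Φ) ((RatFunc.X : RatFunc k) ^ (-(j : ℤ) - 1)) * y' ^ i
  refine ⟨(Finset.range Φ.natDegree).biUnion fun i => (Finset.range (δ * i + 1)).image (f i),
    ?_, ?_⟩
  · refine Finset.card_biUnion_le.trans ?_
    rw [← smul_eq_mul (a := Φ.natDegree)]
    conv_rhs => rw [← Finset.card_range Φ.natDegree]
    refine Finset.sum_le_card_nsmul _ _ _ fun i hi => Finset.card_image_le.trans ?_
    rw [Finset.card_range, Finset.card_range]
    gcongr
    exact (Finset.mem_range.1 hi).le
  · rw [eq_top_iff]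
    rintro x -
    obtain ⟨g, rfl⟩ := AdjoinRoot.mk_surjective x
    have hgx : AdjoinRoot.mk (toRat Φ) g = AdjoinRoot.mk (toRat Φ) (g %ₘ (toRat Φ)) := by
      conv_lhs => rw [← modByMonic_add_div g (toRat Φ)]
      simp
    rw [hgx]
    have hdeg : (g %ₘ (toRat Φ)).degree < Φ.natDegree := by
      rw [← natDegree_toRat hm, ← degree_eq_natDegree hm'.ne_zero]
      exact degree_modByMonic_lt _ hm'
    rw [eq_sum_fin_of_degree_lt hdeg, map_sum]
    refine Submodule.sum_mem _ fun i _ => ?_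
    rw [map_mul, map_pow, AdjoinRoot.mk_C, AdjoinRoot.mk_X, ← hy']
    generalize (g %ₘ (toRat Φ)).coeff i = c
    obtain ⟨u, hu, v, hv, huv⟩ := Submodule.mem_sup.1 (RingFilt.rat_span (δ * i + 1) c)
    obtain ⟨w, ⟨w', hw⟩, z, hz, hwz⟩ := Submodule.mem_sup.1 hv
    rw [← huv, ← hwz, map_add, map_add, add_mul, add_mul]
    refine Submodule.add_mem_sup ?_ (Submodule.add_mem_sup ?_ ?_)
    · let T : RatFunc k →ₗ[k] AdjoinRoot (toRat Φ) :=
        (LinearMap.mulRight k (y' ^ (i : ℕ))) ∘ₗ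
          (IsScalarTower.toAlgHom k (RatFunc k) (AdjoinRoot (toRat Φ))).toLinearMap
      have hT : T u ∈ (Submodule.span k ((fun j : ℕ =>
          (RatFunc.X : RatFunc k) ^ (-(j : ℤ) - 1)) '' Set.Iio (δ * i + 1))).map T :=
        Submodule.mem_map_of_mem hu
      rw [Submodule.map_span] at hT
      refine Submodule.span_mono ?_ hT
      rintro _ ⟨_, ⟨j, hj, rfl⟩, rfl⟩
      refine Finset.mem_coe.2 (Finset.mem_biUnion.2 ⟨i, Finset.mem_range.2 i.2,
        Finset.mem_image.2 ⟨j, Finset.mem_range.2 hj, rfl⟩⟩)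
    · refine ⟨algebraMap k[X] R w' * y ^ (i : ℕ), ?_⟩
      change algebraMap R (AdjoinRoot (toRat Φ)) _ = _
      rw [map_mul, map_pow, hy, ← IsScalarTower.algebraMap_apply,
        IsScalarTower.algebraMap_apply k[X] (RatFunc k) (AdjoinRoot (toRat Φ)), ← hw]
      rfl
    · have := RingFilt.mul_mem _ (RingFilt.of_mem_adj (δ := δ) (Φ := toRat Φ) hz)
        (RingFilt.pow_mem _ (RingFilt.root_mem_adj (RingFilt.rat k) δ (toRat Φ)) i)
      refine RingFilt.mono _ ?_ this
      push_cast
      linarith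

end FunctionField

section Discr

lemma RingFilt.trace_pow_mem {k B : Type*} [Field k] [CommRing B] [Algebra k B] [Nontrivial B]
    {S : RingFilt k B} {δ n : ℤ} {Φ : B[X]} (hm : Φ.Monic)
    (hΦ : Φ ∈ (S.poly δ).F (δ * Φ.natDegree)) {θ : AdjoinRoot Φ} (hθ : θ ∈ (S.adj δ Φ).F n) :
    Algebra.trace B (AdjoinRoot Φ) θ ∈ S.F n := by
  rw [Algebra.trace_eq_matrix_trace (AdjoinRoot.powerBasis' hm).basis, Matrix.trace]
  refine Submodule.sum_mem _ fun i _ => ?_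
  simpa using RingFilt.leftMulMatrix_adj_mem hm hΦ hθ i i

lemma RingFilt.discr_mem {k B : Type*} [Field k] [CommRing B] [Algebra k B] [Nontrivial B]
    {S : RingFilt k B} {δ : ℕ} {Φ : B[X]} (hm : Φ.Monic)
    (hΦ : Φ ∈ (S.poly δ).F (δ * Φ.natDegree)) :
    Algebra.discr B (AdjoinRoot.powerBasis' hm).basis ∈
      S.F ((δ * Φ.natDegree ^ 2 : ℕ) : ℤ) := by
  set pb := AdjoinRoot.powerBasis' hm with hpb
  have hM (i j : Fin pb.dim) : Algebra.traceMatrix B pb.basis i j ∈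
      S.F ((δ * (i : ℕ) + δ * (j : ℕ) : ℤ)) := by
    rw [Algebra.traceMatrix_apply, Algebra.traceForm_apply, pb.basis_eq_pow, pb.basis_eq_pow]
    have hy (i : ℕ) : pb.gen ^ i ∈ (S.adj δ Φ).F (i * δ) :=
      RingFilt.pow_mem _ (RingFilt.root_mem_adj S δ Φ) i
    refine S.mono ?_ (RingFilt.trace_pow_mem hm hΦ ((S.adj δ Φ).mul_mem (hy i) (hy j)))
    linarith
  rw [Algebra.discr_def, Matrix.det_apply]
  refine Submodule.sum_mem _ fun σ _ => ?_
  have h1 := S.prod_mem Finset.univ (fun i => Algebra.traceMatrix B pb.basis (σ i) i)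
    (fun i => (δ * ((σ i : Fin pb.dim) : ℕ) + δ * ((i : Fin pb.dim) : ℕ) : ℤ)) fun i _ => hM _ _
  have hs : ∑ i : Fin pb.dim, (δ * ((σ i : Fin pb.dim) : ℕ) + δ * ((i : Fin pb.dim) : ℕ) : ℤ) ≤
      ((δ * Φ.natDegree ^ 2 : ℕ) : ℤ) := by
    rw [Finset.sum_add_distrib, Equiv.sum_comp σ (fun i : Fin pb.dim => (δ * (i : ℕ) : ℤ)),
      ← two_mul, ← Finset.mul_sum, Fin.sum_univ_eq_sum_range (fun i => (i : ℤ)) pb.dim]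
    have h2 : ((∑ i ∈ Finset.range pb.dim, i) * 2 : ℕ) ≤ Φ.natDegree ^ 2 := by
      rw [Finset.sum_range_id_mul_two, sq]
      exact Nat.mul_le_mul le_rfl (Nat.sub_le _ _)
    have h3 : (∑ i ∈ Finset.range pb.dim, (i : ℤ)) * 2 ≤ (Φ.natDegree : ℤ) ^ 2 := by
      have := Int.ofNat_le.2 h2
      push_cast at this
      exact this
    push_cast
    nlinarith [Int.natCast_nonneg δ]
  have h2 := S.mono hs h1
  rcases Int.units_eq_one_or (Equiv.Perm.sign σ) with h | h <;> rw [h]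
  · simpa using h2
  · simpa using neg_mem h2

variable {k : Type*} [Field k] {Φ : k[X][X]} {δ : ℕ} [Fact (Irreducible (toRat Φ))]

lemma isIntegral_root_toRat (hm : Φ.Monic) : IsIntegral k[X] (AdjoinRoot.root (toRat Φ)) := by
  refine ⟨Φ, hm, ?_⟩
  rw [← AdjoinRoot.eval₂_root (toRat Φ), eval₂_map]
  rfl

lemma exists_discr [Algebra.IsSeparable (RatFunc k) (AdjoinRoot (toRat Φ))]
    (hm : Φ.Monic) (h : DegBound δ Φ) :
    ∃ D : k[X], D ≠ 0 ∧ D.natDegree ≤ δ * Φ.natDegree ^ 2 ∧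
      ∀ z : AdjoinRoot (toRat Φ), IsIntegral k[X] z → ∃ g : k[X][X],
        algebraMap k[X] (AdjoinRoot (toRat Φ)) D * z = aeval (AdjoinRoot.root (toRat Φ)) g := by
  have hm' : (toRat Φ).Monic := hm.map _
  set pb := AdjoinRoot.powerBasis' hm' with hpb
  have : FiniteDimensional (RatFunc k) (AdjoinRoot (toRat Φ)) := pb.finite
  have hint : IsIntegral k[X] pb.gen := isIntegral_root_toRat hm
  have h1 : IsIntegral k[X] (Algebra.discr (RatFunc k) pb.basis) :=
    Algebra.discr_isIntegral (RatFunc k) fun i => by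
      rw [pb.basis_eq_pow]
      exact hint.pow _
  obtain ⟨D, hD⟩ := IsIntegrallyClosed.isIntegral_iff.1 h1
  have h2 := RingFilt.discr_mem hm' (h.toRat hm)
  rw [← hpb, ← hD, RingFilt.algebraMap_mem_rat, RingFilt.mem_deg_natCast, natDegree_toRat hm] at h2
  refine ⟨D, ?_, h2, fun z hz => ?_⟩
  · rintro rfl
    rw [map_zero] at hD
    exact Algebra.discr_not_zero_of_basis (RatFunc k) pb.basis hD.symm
  · have h3 := Algebra.discr_mul_isIntegral_mem_adjoin (RatFunc k) hint hz
    rw [Algebra.adjoin_singleton_eq_range_aeval] at h3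
    obtain ⟨g, hg⟩ := h3
    refine ⟨g, ?_⟩
    rw [Algebra.smul_def, ← hD, ← IsScalarTower.algebraMap_apply] at hg
    exact hg.symm

end Discr

section Compare

lemma Set.sum_ncard_inter_le {ι α : Type*} [Fintype ι] {T : ι → Set α}
    (hT : Pairwise fun i j => Disjoint (T i) (T j)) {Z : Set α} (hZ : Z.Finite) :
    ∑ i, (T i ∩ Z).ncard ≤ Z.ncard := by
  classical
  have := hZ.fintype
  have h (i : ι) : (T i ∩ Z).ncard = (Z.toFinset.filter (· ∈ T i)).card := by
    rw [← Set.ncard_coe_finset]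
    congr 1
    ext x
    simp [and_comm]
  rw [Finset.sum_congr rfl fun i _ => h i, ← Finset.card_biUnion, Set.ncard_eq_toFinset_card']
  · exact Finset.card_le_card (Finset.biUnion_subset.2 fun i _ => Finset.filter_subset _ _)
  · intro i _ j _ hij
    rw [Function.onFun, Finset.disjoint_left]
    intro x hx hx'
    exact Set.disjoint_left.1 (hT hij) (Finset.mem_filter.1 hx).2 (Finset.mem_filter.1 hx').2

/-- Extension of homomorphisms along an inclusion which is an isomorphism away from `d`. -/
lemma exists_algHom_extension {k O R Ω : Type*} [Field k] [CommRing O] [Algebra k O] [CommRing R]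
    [Algebra k R] [Field Ω] [Algebra k Ω] (ι : O →ₐ[k] R) (hι : Function.Injective ι) (d : O)
    (h : ∀ x, ∃ o, ι o = ι d * x) (σ : O →ₐ[k] Ω) (hσ : σ d ≠ 0) :
    ∃ τ : R →ₐ[k] Ω, ∀ o, τ (ι o) = σ o := by
  choose f hf using h
  have hfι (o : O) : f (ι o) = d * o := hι (by rw [hf, map_mul])
  refine ⟨AlgHom.ofLinearMap
    { toFun := fun x => σ (f x) / σ d
      map_add' := fun x y => ?_
      map_smul' := fun c x => ?_ } ?_ fun x y => ?_, fun o => ?_⟩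
  · have : f (x + y) = f x + f y := hι (by rw [hf, map_add, hf, hf, mul_add])
    rw [this, map_add, add_div]
  · have : f (c • x) = c • f x := hι (by rw [hf, map_smul, hf, mul_smul_comm])
    rw [this, map_smul, RingHom.id_apply, smul_div_assoc]
  · change σ (f 1) / σ d = 1
    have : f 1 = d := hι (by rw [hf, mul_one])
    rw [this, div_self hσ]
  · change σ (f (x * y)) / σ d = σ (f x) / σ d * (σ (f y) / σ d)
    have : d * f (x * y) = f x * f y := hι (by rw [map_mul, map_mul, hf, hf, hf]; ring)
    have h2 := congrArg σ this
    rw [map_mul, map_mul] at h2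
    field_simp
    rw [mul_comm, h2]
  · change σ (f (ι o)) / σ d = σ o
    rw [hfι, map_mul, mul_div_cancel_left₀ _ hσ]

variable {p : ℕ} [Fact p.Prime] {O R : Type*} [CommRing O] [Algebra (ZMod p)[X] O]
  [Algebra (ZMod p) O] [CommRing R] [Algebra (ZMod p)[X] R]
  [Algebra (ZMod p) R] {Ω : Type*} [Field Ω] [Algebra (ZMod p) Ω]

lemma pairwise_disjoint_traceHoms (r : ℕ) :
    Pairwise fun β γ => Disjoint (traceHoms (p := p) R Ω r β) (traceHoms R Ω r γ) := by
  intro β γ hne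
  rw [Set.disjoint_left]
  intro τ h1 h2
  exact hne ((algebraMap (ZMod p) Ω).injective (h1.2.symm.trans h2.2))

lemma ncard_traceHoms_diff_eq (ι : O →ₐ[ZMod p] R) (hι : Function.Injective ι)
    (hX : ι (algebraMap (ZMod p)[X] O X) = algebraMap (ZMod p)[X] R X) (d : O)
    (h : ∀ x, ∃ o, ι o = ι d * x) (r : ℕ) (β : ZMod p) :
    (traceHoms R Ω r β \ {τ | τ (ι d) = 0}).ncard =
      (traceHoms O Ω r β \ {σ | σ d = 0}).ncard := by
  have key {τ : R →ₐ[ZMod p] Ω} (hτ : τ (ι d) ≠ 0) {x : R} {o : O} (ho : ι o = ι d * x) :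
      τ x = τ (ι o) / τ (ι d) := by
    rw [ho, map_mul, mul_div_cancel_left₀ _ hτ]
  refine Set.ncard_congr (fun τ _ => τ.comp ι) ?_ ?_ ?_
  · rintro τ ⟨⟨h1, h2⟩, h3⟩
    refine ⟨⟨fun x => h1 _, ?_⟩, h3⟩
    simp only [AlgHom.comp_apply, hX]
    exact h2
  · rintro τ τ' ⟨-, h1⟩ ⟨-, h2⟩ he
    ext x
    obtain ⟨o, ho⟩ := h x
    rw [key h1 ho, key h2 ho]
    have e1 : τ (ι o) = τ' (ι o) := DFunLike.congr_fun he o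
    have e2 : τ (ι d) = τ' (ι d) := DFunLike.congr_fun he d
    rw [e1, e2]
  · rintro σ ⟨⟨h1, h2⟩, h3⟩
    obtain ⟨τ, hτ⟩ := exists_algHom_extension ι hι d h σ h3
    have hd : τ (ι d) ≠ 0 := by
      rw [hτ]
      exact h3
    refine ⟨τ, ⟨⟨fun x => ?_, ?_⟩, hd⟩, AlgHom.ext hτ⟩
    · obtain ⟨o, ho⟩ := h x
      rw [key hd ho, div_pow, hτ, hτ, h1, h1]
    · rw [← hX]
      simp only [hτ]
      exact h2

lemma norm_sum_traceHoms_sub_le (ι : O →ₐ[ZMod p] R) (hι : Function.Injective ι)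
    (hX : ι (algebraMap (ZMod p)[X] O X) = algebraMap (ZMod p)[X] R X) (d : O)
    (h : ∀ x, ∃ o, ι o = ι d * x) (r : ℕ) (hR : ∀ β, (traceHoms (p := p) R Ω r β).Finite)
    (hO : ∀ β, (traceHoms (p := p) O Ω r β).Finite)
    (hZR : {τ : R →ₐ[ZMod p] Ω | τ (ι d) = 0}.Finite)
    (hZO : {σ : O →ₐ[ZMod p] Ω | σ d = 0}.Finite) (ψ : AddChar (ZMod p) ℂ) :
    ‖∑ β, ψ β * ((traceHoms R Ω r β).ncard : ℂ) - ∑ β, ψ β * ((traceHoms O Ω r β).ncard : ℂ)‖ ≤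
      ({τ : R →ₐ[ZMod p] Ω | τ (ι d) = 0}.ncard + {σ : O →ₐ[ZMod p] Ω | σ d = 0}.ncard : ℕ) := by
  set ZR := {τ : R →ₐ[ZMod p] Ω | τ (ι d) = 0}
  set ZO := {σ : O →ₐ[ZMod p] Ω | σ d = 0}
  have hnorm {M : Type} [Fintype M] (c : M → ℕ) (φ : M → ℂ) (hφ : ∀ m, ‖φ m‖ = 1) :
      ‖∑ m, φ m * c m‖ ≤ (∑ m, c m : ℕ) := by
    rw [Nat.cast_sum]
    refine norm_sum_le_of_le _ fun m _ => ?_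
    rw [norm_mul, hφ, one_mul, Complex.norm_natCast]
  have e : ∑ β, ψ β * ((traceHoms R Ω r β).ncard : ℂ) -
      ∑ β, ψ β * ((traceHoms O Ω r β).ncard : ℂ) =
      ∑ β, ψ β * ((traceHoms R Ω r β ∩ ZR).ncard : ℂ) -
      ∑ β, ψ β * ((traceHoms O Ω r β ∩ ZO).ncard : ℂ) := by
    rw [← Finset.sum_sub_distrib, ← Finset.sum_sub_distrib]
    refine Finset.sum_congr rfl fun β _ => ?_
    rw [← Set.ncard_inter_add_ncard_sdiff_eq_ncard (traceHoms R Ω r β) ZR (hR β),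
      ← Set.ncard_inter_add_ncard_sdiff_eq_ncard (traceHoms O Ω r β) ZO (hO β),
      ncard_traceHoms_diff_eq ι hι hX d h r β]
    push_cast
    ring
  rw [e, Nat.cast_add]
  refine (norm_sub_le _ _).trans (add_le_add ?_ ?_)
  · refine (hnorm _ _ fun β => AddChar.norm_apply ψ β).trans ?_
    exact_mod_cast Set.sum_ncard_inter_le (pairwise_disjoint_traceHoms r) hZR
  · refine (hnorm _ _ fun β => AddChar.norm_apply ψ β).trans ?_
    exact_mod_cast Set.sum_ncard_inter_le (pairwise_disjoint_traceHoms r) hZO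

end Compare

section Irred

lemma isSeparable_of_finrank_lt {F E : Type*} [Field F] [Field E] [Algebra F E]
    [FiniteDimensional F E] {p : ℕ} [CharP F p] (h : Module.finrank F E < p) :
    Algebra.IsSeparable F E := by
  refine ⟨fun x => ?_⟩
  have hint := Algebra.IsIntegral.isIntegral (R := F) x
  refine (separable_iff_derivative_ne_zero (minpoly.irreducible hint)).2 fun h0 => ?_
  have hd := minpoly.natDegree_pos hint
  have := congrArg (fun f => coeff f ((minpoly F x).natDegree - 1)) h0
  simp only [coeff_derivative, coeff_zero] at this
  rw [Nat.sub_add_cancel hd, coeff_natDegree, (minpoly.monic hint).leadingCoeff, one_mul] at this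
  have h3 : (((minpoly F x).natDegree : ℕ) : F) = 0 := by
    rw [← this]
    norm_cast
    rw [Nat.sub_add_cancel hd]
  rw [CharP.cast_eq_zero_iff F p] at h3
  exact absurd (Nat.le_of_dvd hd h3) (by have := minpoly.natDegree_le (A := F) x; omega)

variable {p : ℕ} [Fact p.Prime] {Φ : (ZMod p)[X][X]} {δ : ℕ}

lemma traceHoms_adjoinRoot_iff {Ω : Type*} [Field Ω] [Algebra (ZMod p) Ω] {r : ℕ} {β : ZMod p}
    {τ : AdjoinRoot Φ →ₐ[ZMod p] Ω} : τ ∈ traceHoms (AdjoinRoot Φ) Ω r β ↔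
      τ (coordX Φ) ^ p ^ r = τ (coordX Φ) ∧
      τ (AdjoinRoot.root Φ) ^ p ^ r = τ (AdjoinRoot.root Φ) ∧
      ∑ i ∈ Finset.range r, τ (coordX Φ) ^ p ^ i = algebraMap (ZMod p) Ω β := by
  constructor
  · exact fun h => ⟨h.1 _, h.1 _, h.2⟩
  · rintro ⟨h1, h2, h3⟩
    refine ⟨fun x => ?_, h3⟩
    have e (z : Ω) : (FiniteField.frobeniusAlgHom (ZMod p) Ω ^ r) z = z ^ p ^ r := by
      rw [AlgHom.coe_pow, FiniteField.coe_frobeniusAlgHom, pow_iterate, ZMod.card]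
    have := DFunLike.congr_fun (algHom_ext_pt
      (σ := (FiniteField.frobeniusAlgHom (ZMod p) Ω ^ r).comp τ) (τ := τ)
      (by rw [AlgHom.comp_apply, e, h1]) (by rw [AlgHom.comp_apply, e, h2])) x
    rwa [AlgHom.comp_apply, e] at this

lemma evalPt_map {Ω : Type*} [Field Ω] [Algebra (ZMod p) Ω] (z y : Ω) (g : (ZMod p)[X][X]) :
    evalPt Ω z y (g.map (mapRingHom (algebraMap (ZMod p) Ω))) = evalPt (ZMod p) z y g := by
  rw [evalPt_apply, evalPt_apply, eval₂_map]
  congr 1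
  refine RingHom.ext fun f => ?_
  simp

lemma ncard_traceHoms_adjoinRoot {Ω : Type*} [Field Ω] [Algebra (ZMod p) Ω] (r : ℕ)
    (β : ZMod p) : (traceHoms (AdjoinRoot Φ) Ω r β).ncard =
      (tracePts β r (Φ.map (mapRingHom (algebraMap (ZMod p) Ω)))).ncard := by
  refine Set.ncard_congr (fun τ _ => (τ (coordX Φ), τ (AdjoinRoot.root Φ))) ?_ ?_ ?_
  · intro τ hτ
    obtain ⟨h1, h2, h3⟩ := traceHoms_adjoinRoot_iff.1 hτ
    exact ⟨h1, h2, h3, by rw [evalPt_map, evalPt_algHom]⟩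
  · intro σ τ _ _ h
    exact algHom_ext_pt (Prod.ext_iff.1 h).1 (Prod.ext_iff.1 h).2
  · rintro ⟨z, y⟩ ⟨h1, h2, h3, h4⟩
    rw [evalPt_map] at h4
    refine ⟨pointHom Φ h4, traceHoms_adjoinRoot_iff.2 ?_, ?_⟩
    · rw [pointHom_coordX, pointHom_root]
      exact ⟨h1, h2, h3⟩
    · rw [pointHom_coordX, pointHom_root]

lemma finite_traceHoms_adjoinRoot {Ω : Type*} [Field Ω] [Algebra (ZMod p) Ω] [IsAlgClosed Ω]
    {r : ℕ} (hr : r ≠ 0)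
    (β : ZMod p) : (traceHoms (AdjoinRoot Φ) Ω r β).Finite := by
  have h := finite_tracePts (E := Ω) β hr (Φ.map (mapRingHom (algebraMap (ZMod p) Ω)))
  refine Set.Finite.of_finite_image (f := fun τ => (τ (coordX Φ), τ (AdjoinRoot.root Φ)))
    (h.subset ?_) fun σ _ τ _ h => algHom_ext_pt (Prod.ext_iff.1 h).1 (Prod.ext_iff.1 h).2
  rintro _ ⟨τ, hτ, rfl⟩
  obtain ⟨h1, h2, h3⟩ := traceHoms_adjoinRoot_iff.1 hτ
  exact ⟨h1, h2, h3, by rw [evalPt_map, evalPt_algHom]⟩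

lemma ncard_traceHoms_one {Ω : Type*} [Field Ω] [Algebra (ZMod p) Ω]
    (β : ZMod p) : (traceHoms (AdjoinRoot Φ) Ω 1 β).ncard =
      {y : ZMod p | evalPt (ZMod p) β y Φ = 0}.ncard := by
  have hinj := (algebraMap (ZMod p) Ω).injective
  have hev (y : ZMod p) : evalPt (ZMod p) (algebraMap (ZMod p) Ω β) (algebraMap (ZMod p) Ω y) Φ =
      algebraMap (ZMod p) Ω (evalPt (ZMod p) β y Φ) := by
    rw [evalPt_apply, evalPt_apply, hom_eval₂]
    congr 1
    refine RingHom.ext fun f => ?_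
    simp [aeval_algebraMap_apply]
  have hfix (z : Ω) (hz : z ^ p ^ 1 = z) : ∃ y : ZMod p, algebraMap (ZMod p) Ω y = z := by
    classical
    have : CharP Ω p := charP_of_injective_algebraMap hinj p
    have hp := (Fact.out : p.Prime)
    set f : Polynomial Ω := X ^ p - X with hf
    have hf0 : f ≠ 0 := FiniteField.X_pow_card_sub_X_ne_zero Ω hp.one_lt
    have hsub : (Finset.univ.image (algebraMap (ZMod p) Ω)) ⊆ f.roots.toFinset := by
      intro x hx
      obtain ⟨y, -, rfl⟩ := Finset.mem_image.1 hx
      rw [Multiset.mem_toFinset, mem_roots hf0, IsRoot, hf, eval_sub, eval_pow, eval_X, ← map_pow,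
        ZMod.pow_card, sub_self]
    have heq := Finset.eq_of_subset_of_card_le hsub (by
      rw [Finset.card_image_of_injective _ hinj, Finset.card_univ, ZMod.card]
      refine (Multiset.toFinset_card_le _).trans ((card_roots' f).trans ?_)
      rw [hf, FiniteField.X_pow_card_sub_X_natDegree_eq Ω hp.one_lt])
    have : z ∈ f.roots.toFinset := by
      rw [Multiset.mem_toFinset, mem_roots hf0, IsRoot, hf, eval_sub, eval_pow, eval_X]
      rw [pow_one] at hz
      rw [hz, sub_self]
    rw [← heq] at this
    obtain ⟨y, -, hy⟩ := Finset.mem_image.1 this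
    exact ⟨y, hy⟩
  rw [ncard_traceHoms_adjoinRoot]
  symm
  refine Set.ncard_congr (fun y _ => (algebraMap (ZMod p) Ω β, algebraMap (ZMod p) Ω y)) ?_ ?_ ?_
  · intro y hy
    refine ⟨?_, ?_, ?_, ?_⟩
    · simp only [pow_one, ← map_pow, ZMod.pow_card]
    · simp only [pow_one, ← map_pow, ZMod.pow_card]
    · simp
    · rw [evalPt_map, hev]
      rw [Set.mem_ofPred_eq] at hy
      rw [hy, map_zero]
  · intro y y' _ _ h
    exact hinj (Prod.ext_iff.1 h).2
  · rintro ⟨z, y⟩ ⟨h1, h2, h3, h4⟩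
    obtain ⟨y, rfl⟩ := hfix y h2
    have hz : z = algebraMap (ZMod p) Ω β := by simpa using h3
    subst hz
    rw [evalPt_map, hev, map_eq_zero_iff _ hinj] at h4
    exact ⟨y, h4, rfl⟩

end Irred

section Irred

variable {p : ℕ} [Fact p.Prime] {Φ : (ZMod p)[X][X]} {δ : ℕ}

lemma exists_bound_traceHoms_adjoinRoot {Ω : Type*} [Field Ω] [Algebra (ZMod p) Ω] [IsAlgClosed Ω]
    [Algebra.IsAlgebraic (ZMod p) Ω] (hm : Φ.Monic) (hlt : Φ.natDegree < p)
    (ψ : AddChar (ZMod p) ℂ) (hψ : ψ ≠ 0) :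
    ∃ C r₀ : ℕ, 0 < r₀ ∧ ∀ μ, μ ≠ 0 → r₀ ∣ μ →
      ‖∑ β, ψ β * ((traceHoms (AdjoinRoot Φ) Ω (2 * μ) β).ncard : ℂ)‖ ≤ C * (p : ℝ) ^ μ := by
  simp only [ncard_traceHoms_adjoinRoot]
  exact norm_sum_tracePts_le (hm.map _) (by rwa [hm.natDegree_map]) hψ

lemma injective_lift_root [Fact (Irreducible (toRat Φ))] {R : Type*} [CommRing R]
    [Algebra (ZMod p)[X] R] [Algebra R (AdjoinRoot (toRat Φ))]
    [IsScalarTower (ZMod p)[X] R (AdjoinRoot (toRat Φ))] [Algebra (ZMod p) R]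
    [IsScalarTower (ZMod p) (ZMod p)[X] R] (hm : Φ.Monic)
    (hinj : Function.Injective (algebraMap R (AdjoinRoot (toRat Φ)))) (y : R)
    (hy : algebraMap R (AdjoinRoot (toRat Φ)) y = AdjoinRoot.root (toRat Φ)) :
    ∃ ι : AdjoinRoot Φ →ₐ[ZMod p] R, Function.Injective ι ∧
      (∀ f, ι (AdjoinRoot.of Φ f) = algebraMap (ZMod p)[X] R f) ∧ 
      ∀ g, algebraMap R (AdjoinRoot (toRat Φ)) (ι (AdjoinRoot.mk Φ g)) =
        aeval (AdjoinRoot.root (toRat Φ)) g := by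
  have hev (g : (ZMod p)[X][X]) : algebraMap R (AdjoinRoot (toRat Φ)) (aeval y g) =
      aeval (AdjoinRoot.root (toRat Φ)) g := by
    rw [← hy, aeval_algebraMap_apply]
  have hmk (g : (ZMod p)[X][X]) : aeval (AdjoinRoot.root (toRat Φ)) g =
      AdjoinRoot.mk (toRat Φ) (toRat g) := by
    rw [← AdjoinRoot.aeval_eq, aeval_map_algebraMap]
  have h0 : aeval y Φ = 0 := by
    apply hinj
    rw [hev, hmk, AdjoinRoot.mk_self, map_zero]
  let ι : AdjoinRoot Φ →ₐ[ZMod p] R := AdjoinRoot.liftAlgHom Φ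
    (IsScalarTower.toAlgHom (ZMod p) (ZMod p)[X] R) y h0
  have hι (g : (ZMod p)[X][X]) : ι (AdjoinRoot.mk Φ g) = aeval y g := rfl
  refine ⟨ι, ?_, fun f => ?_, fun g => ?_⟩
  · rw [injective_iff_map_eq_zero]
    intro x hx
    obtain ⟨g, rfl⟩ := AdjoinRoot.mk_surjective x
    rw [hι] at hx
    have h1 := hev g
    rw [hx, map_zero, hmk, eq_comm, AdjoinRoot.mk_eq_zero] at h1
    rw [AdjoinRoot.mk_eq_zero]
    exact (map_dvd_map _ (FaithfulSMul.algebraMap_injective (ZMod p)[X] (RatFunc (ZMod p))) hm).1 h1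
  · rw [← AdjoinRoot.mk_C, hι, aeval_C]
  · rw [hι, hev]

theorem norm_sum_points_of_integralClosure [Fact (Irreducible (toRat Φ))] {R : Type*} [CommRing R]
    [IsDomain R] [Algebra (ZMod p)[X] R] [Module.IsTorsionFree (ZMod p)[X] R]
    [Algebra R (AdjoinRoot (toRat Φ))] [IsScalarTower (ZMod p)[X] R (AdjoinRoot (toRat Φ))]
    [IsIntegralClosure R (ZMod p)[X] (AdjoinRoot (toRat Φ))]
    [Algebra (ZMod p) R] [IsScalarTower (ZMod p) (ZMod p)[X] R]
    [IsScalarTower (ZMod p) R (AdjoinRoot (toRat Φ))]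
    (hm : Φ.Monic) (hirr : Irreducible Φ) (h0 : 0 < Φ.natDegree)
    (hlt : Φ.natDegree < p) (h : DegBound δ Φ) (ψ : AddChar (ZMod p) ℂ) (hψ : ψ ≠ 0) :
    ‖∑ β, ψ β * ({y : ZMod p | evalPt (ZMod p) β y Φ = 0}.ncard : ℂ)‖ ≤
      2 * (Φ.natDegree * (δ * Φ.natDegree + 1) : ℕ) * √p +
        (2 * (δ * Φ.natDegree ^ 3) : ℕ) := by
  have hp := (Fact.out : p.Prime)
  let K := AdjoinRoot (toRat Φ)
  let Ω := AlgebraicClosure (ZMod p)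
  have hm' : (toRat Φ).Monic := hm.map _
  have hfin : FiniteDimensional (RatFunc (ZMod p)) K := (AdjoinRoot.powerBasis' hm').finite
  have hrank : Module.finrank (RatFunc (ZMod p)) K = Φ.natDegree := by
    rw [(AdjoinRoot.powerBasis' hm').finrank]
    exact natDegree_toRat hm
  have : CharP (RatFunc (ZMod p)) p :=
    charP_of_injective_algebraMap (algebraMap (ZMod p) (RatFunc (ZMod p))).injective p
  have : FaithfulSMul (ZMod p)[X] K := FaithfulSMul.trans (ZMod p)[X] (RatFunc (ZMod p)) K
  have : Module.IsTorsionFree (ZMod p)[X] K := Module.IsTorsionFree.of_faithfulSMul _ _ K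
  have hsep : Algebra.IsSeparable (RatFunc (ZMod p)) K :=
    isSeparable_of_finrank_lt (p := p) (by rwa [hrank])
  have hded : IsDedekindDomain R :=
    IsIntegralClosure.isDedekindDomain (ZMod p)[X] (RatFunc (ZMod p)) K R
  have hRfin : Module.Finite (ZMod p)[X] R :=
    IsIntegralClosure.finite (ZMod p)[X] (RatFunc (ZMod p)) K R
  have hfrac : IsFractionRing R K :=
    IsIntegralClosure.isFractionRing_of_finite_extension (ZMod p)[X] (RatFunc (ZMod p)) K R
  have hrel : RelNormPrime (ZMod p) R := relNormPrime_of_isSeparable (ZMod p) R K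
  have hN : NormCompat (ZMod p) R K := normCompat_of_isIntegralClosure (ZMod p) R K
  have hinj : Function.Injective (algebraMap R K) := IsFractionRing.injective R K
  obtain ⟨y, hy⟩ := (IsIntegralClosure.isIntegral_iff (A := R)).1 (isIntegral_root_toRat hm)
  obtain ⟨B, hBc, hB⟩ := exists_finset_span_sup_eq_top δ hm y hy
  obtain ⟨ι, hι, hιof, hιmk⟩ := injective_lift_root hm hinj y hy
  obtain ⟨D, hD0, hDdeg, hD⟩ := exists_discr hm h
  have : IsDomain (AdjoinRoot Φ) := isDomain_adjoinRoot_of_irreducible hirr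
  set d := AdjoinRoot.of Φ D with hd
  have hιd : ι d = algebraMap (ZMod p)[X] R D := hιof D
  have hext (x : R) : ∃ o, ι o = ι d * x := by
    obtain ⟨g, hg⟩ := hD (algebraMap R K x)
      ((IsIntegralClosure.isIntegral_iff (A := R)).2 ⟨x, rfl⟩)
    refine ⟨AdjoinRoot.mk Φ g, hinj ?_⟩
    rw [hιmk, ← hg, map_mul, hιd, ← IsScalarTower.algebraMap_apply]
  have hd0 : ι d ≠ 0 := by
    rw [hιd]
    exact (FaithfulSMul.algebraMap_eq_zero_iff _ _).not.2 hD0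
  have hd0' : d ≠ 0 := fun h => hd0 (by rw [h, map_zero])
  have hZO := finite_zeros (Ω := Ω) hm h (θ := d)
    (RingFilt.of_mem_adj (RingFilt.mem_deg_natCast.2 le_rfl)) hd0'
  have hZR : {τ : R →ₐ[ZMod p] Ω | τ (ι d) = 0}.Finite ∧
      {τ : R →ₐ[ZMod p] Ω | τ (ι d) = 0}.ncard ≤ Φ.natDegree * D.natDegree := by
    have := finiteDimensional_quotient_ideal (ZMod p) (I := Ideal.span {ι d}) (by simpa using hd0)
    obtain ⟨h1, h2⟩ := finite_algHom_ker (k := ZMod p) (Ω := Ω) (ι d)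
    refine ⟨h1, h2.trans (le_of_eq ?_)⟩
    rw [finrank_quotient_span_eq_natDegree_norm (Module.Free.chooseBasis (ZMod p)[X] R) hd0, hιd,
      Algebra.norm_algebraMap, natDegree_pow,
      IsIntegralClosure.rank (ZMod p)[X] (RatFunc (ZMod p)) K R, hrank]
  have hcmp (r : ℕ) (hr : r ≠ 0) := norm_sum_traceHoms_sub_le (Ω := Ω) ι hι (hιof X) d hext r
    (finite_traceHoms hrel hr) (finite_traceHoms_adjoinRoot hr) hZR.1 hZO.1 ψ
  set Z : ℕ := {τ : R →ₐ[ZMod p] Ω | τ (ι d) = 0}.ncard +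
    {σ : AdjoinRoot Φ →ₐ[ZMod p] Ω | σ d = 0}.ncard with hZ
  have hZle : Z ≤ 2 * (δ * Φ.natDegree ^ 3) := by
    have := Nat.mul_le_mul_left Φ.natDegree hDdeg
    calc Z ≤ Φ.natDegree * D.natDegree + Φ.natDegree * D.natDegree := add_le_add hZR.2 hZO.2
      _ ≤ Φ.natDegree * (δ * Φ.natDegree ^ 2) + Φ.natDegree * (δ * Φ.natDegree ^ 2) :=
          add_le_add this this
      _ = _ := by ring
  have hψm : ψ (-(Module.finrank (RatFunc (ZMod p)) K : ℕ)) ≠ 1 := by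
    rw [hrank]
    intro h1
    have hu : (-(Φ.natDegree : ℕ) : ZMod p) ≠ 0 := by
      rw [neg_ne_zero, Ne, ZMod.natCast_eq_zero_iff]
      exact fun h2 => absurd (Nat.le_of_dvd h0 h2) (by omega)
    refine hψ ?_
    ext a
    have : a = ((a / (-(Φ.natDegree : ℕ) : ZMod p)).val : ℕ) • (-(Φ.natDegree : ℕ) : ZMod p) := by
      rw [nsmul_eq_mul, ZMod.natCast_zmod_val, div_mul_cancel₀ _ hu]
    rw [this, AddChar.map_nsmul_eq_pow, h1, one_pow, AddChar.zero_apply]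
  have hmain := norm_sum_traceHoms_one_le Ω hrel hN (isInfty_adj hm h) B hB ψ hψm (by
    obtain ⟨C, r₀, hr, hC⟩ := exists_bound_traceHoms_adjoinRoot (Ω := Ω) hm hlt ψ hψ
    refine ⟨C + Z, r₀, hr, fun μ hμ hdvd => ?_⟩
    have h1 := hC μ hμ hdvd
    have h2 := hcmp (2 * μ) (by omega)
    have h3 : (1 : ℝ) ≤ (p : ℝ) ^ μ := one_le_pow₀ (by exact_mod_cast hp.one_le)
    have h4 := norm_le_norm_add_norm_sub' (∑ β, ψ β * ((traceHoms R Ω (2 * μ) β).ncard : ℂ))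
      (∑ β, ψ β * ((traceHoms (AdjoinRoot Φ) Ω (2 * μ) β).ncard : ℂ))
    push_cast
    have h5 : (Z : ℝ) ≤ Z * (p : ℝ) ^ μ := le_mul_of_one_le_right (Nat.cast_nonneg _) h3
    linarith)
  have h1 := hcmp 1 one_ne_zero
  simp only [ncard_traceHoms_one] at h1
  rw [norm_sub_rev] at h1
  have h4 := norm_le_norm_add_norm_sub'
    (∑ β, ψ β * ({y : ZMod p | evalPt (ZMod p) β y Φ = 0}.ncard : ℂ))
    (∑ β, ψ β * ((traceHoms R Ω 1 β).ncard : ℂ))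
  have h5 : (Z : ℝ) ≤ (2 * (δ * Φ.natDegree ^ 3) : ℕ) := by exact_mod_cast hZle
  have h6 : 2 * (B.card : ℝ) * √p ≤ 2 * (Φ.natDegree * (δ * Φ.natDegree + 1) : ℕ) * √p := by
    gcongr
  linarith

/-- Weil-type bound for an irreducible plane curve. -/
theorem norm_sum_points_irreducible (hm : Φ.Monic) (hirr : Irreducible Φ)
    (hlt : Φ.natDegree < p) (h : DegBound δ Φ) (ψ : AddChar (ZMod p) ℂ) (hψ : ψ ≠ 0) :
    ‖∑ β, ψ β * ({y : ZMod p | evalPt (ZMod p) β y Φ = 0}.ncard : ℂ)‖ ≤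
      2 * (Φ.natDegree * (δ * Φ.natDegree + 1) : ℕ) * √p +
        (2 * (δ * Φ.natDegree ^ 3) : ℕ) := by
  have : Fact (Irreducible (toRat Φ)) := ⟨irreducible_toRat hm hirr⟩
  have h0 : Φ.natDegree ≠ 0 := fun h => hirr.not_isUnit ((isUnit_iff_of_monic hm).2 h)
  have h1 : FaithfulSMul (ZMod p)[X] (AdjoinRoot (toRat Φ)) :=
    FaithfulSMul.trans (ZMod p)[X] (RatFunc (ZMod p)) _
  have : Module.IsTorsionFree (ZMod p)[X]
      (integralClosure (ZMod p)[X] (AdjoinRoot (toRat Φ))) :=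
    Module.IsTorsionFree.of_faithfulSMul _ _ (AdjoinRoot (toRat Φ))
  exact norm_sum_points_of_integralClosure
    (R := integralClosure (ZMod p)[X] (AdjoinRoot (toRat Φ))) hm hirr
    (Nat.pos_of_ne_zero h0) hlt h ψ hψ

end Irred

section WeightedDegree

variable {k : Type*} [Field k]

/-- The substitution `X ↦ T`, `Y ↦ Y T ^ δ`, with values in polynomials in `T` over `k[Y]`. -/
noncomputable def weightHom (k : Type*) [Field k] (δ : ℕ) : k[X][X] →+* k[X][X] :=
  eval₂RingHom (mapRingHom C) (C X * X ^ δ)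

lemma coeff_weightHom (δ : ℕ) (g : k[X][X]) (n i : ℕ) :
    ((weightHom k δ g).coeff n).coeff i =
      if δ * i ≤ n then (g.coeff i).coeff (n - δ * i) else 0 := by
  induction g using Polynomial.induction_on' with
  | add f g hf hg =>
    rw [map_add, coeff_add, coeff_add, hf, hg]
    split_ifs <;> simp
  | monomial j a =>
    have : weightHom k δ (monomial j a) = (a.map C * C (X ^ j)) * X ^ (δ * j) := by
      simp only [weightHom, coe_eval₂RingHom, eval₂_monomial, coe_mapRingHom]
      rw [mul_pow, ← pow_mul, C_pow, mul_assoc]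
    rw [this, coeff_mul_X_pow', coeff_monomial]
    rw [coeff_mul_C, apply_ite (fun f : k[X] => f.coeff i), coeff_map, coeff_C_mul, coeff_X_pow,
      coeff_zero]
    by_cases hij : j = i
    · subst hij
      simp
    · rw [if_neg (Ne.symm hij), if_neg hij]
      simp

lemma natDegree_weightHom_le_iff {δ n : ℕ} {g : k[X][X]} :
    (weightHom k δ g).natDegree ≤ n ↔ g ∈ ((RingFilt.deg k).poly δ).F n := by
  rw [RingFilt.mem_poly, natDegree_le_iff_coeff_eq_zero]
  refine ⟨fun h i => ?_, fun h N hN => ?_⟩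
  · rw [RingFilt.mem_deg]
    intro j hj
    have := congrArg (fun f => coeff f i) (h (j + δ * i) (by zify; linarith))
    simpa [coeff_weightHom] using this
  · ext i
    rw [coeff_weightHom, coeff_zero]
    split_ifs with h1
    · refine RingFilt.mem_deg.1 (h i) _ ?_
      zify [h1]
      have : (n : ℤ) < N := by exact_mod_cast hN
      linarith
    · rfl

lemma le_natDegree_weightHom {δ : ℕ} {g : k[X][X]} (hm : g.Monic) :
    δ * g.natDegree ≤ (weightHom k δ g).natDegree := by
  refine le_natDegree_of_ne_zero fun h => ?_
  have := congrArg (fun f => coeff f g.natDegree) h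
  simp [coeff_weightHom, hm.coeff_natDegree] at this

lemma weightHom_ne_zero {δ : ℕ} {g : k[X][X]} (hm : g.Monic) : weightHom k δ g ≠ 0 := by
  intro h
  have := congrArg (fun f => (coeff f (δ * g.natDegree)).coeff g.natDegree) h
  simp [coeff_weightHom, hm.coeff_natDegree] at this

lemma DegBound.of_mul_left {δ : ℕ} {f g : k[X][X]} (hf : f.Monic) (hg : g.Monic)
    (h : DegBound δ (f * g)) : DegBound δ f := by
  have h1 : (weightHom k δ (f * g)).natDegree ≤ δ * (f * g).natDegree :=
    natDegree_weightHom_le_iff.2 (by exact_mod_cast h)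
  rw [map_mul, natDegree_mul (weightHom_ne_zero hf) (weightHom_ne_zero hg), hf.natDegree_mul hg,
    mul_add] at h1
  have h2 := le_natDegree_weightHom (δ := δ) hg
  have h3 := (natDegree_weightHom_le_iff (δ := δ) (n := δ * f.natDegree) (g := f)).1 (by omega)
  rw [DegBound]
  exact_mod_cast h3

end WeightedDegree

section PointSum

variable {p : ℕ} [Fact p.Prime] {δ : ℕ}

/-- Weil-type bound for a plane curve, all of whose components are separable over the line. -/
theorem norm_sum_points_le (hδ : 1 ≤ δ) (ψ : AddChar (ZMod p) ℂ) (hψ : ψ ≠ 0)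
    {Ψ : (ZMod p)[X][X]} (hm : Ψ.Monic) (hsq : Ψ.natDegree ^ 2 ≤ p) (hlt : Ψ.natDegree < p)
    (h : DegBound δ Ψ) :
    ‖∑ β, ψ β * ({y : ZMod p | evalPt (ZMod p) β y Ψ = 0}.ncard : ℂ)‖ ≤
      6 * δ * Ψ.natDegree ^ 2 * √p := by
  obtain ⟨n, hn⟩ : ∃ n, n = Ψ.natDegree := ⟨_, rfl⟩
  induction n using Nat.strong_induction_on generalizing Ψ with
  | _ n ih =>
  subst hn
  have hp1 : (1 : ℝ) ≤ √p := by
    rw [Real.one_le_sqrt]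
    exact_mod_cast (Fact.out : p.Prime).one_le
  by_cases h0 : Ψ.natDegree = 0
  · have h1 : Ψ = 1 := (hm.natDegree_eq_zero).1 h0
    subst h1
    simp
  obtain ⟨Φ, hΦm, hΦi, Ψ₁, hΨ⟩ := exists_monic_irreducible_dvd hm h0
  have hΨ₁m : Ψ₁.Monic := hΦm.of_mul_monic_left (hΨ ▸ hm)
  have hΦ0 : Φ.natDegree ≠ 0 := fun h => hΦi.not_isUnit ((isUnit_iff_of_monic hΦm).2 h)
  have hdeg : Ψ.natDegree = Φ.natDegree + Ψ₁.natDegree := by rw [hΨ, hΦm.natDegree_mul hΨ₁m]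
  have hΦδ : DegBound δ Φ := DegBound.of_mul_left hΦm hΨ₁m (hΨ ▸ h)
  have hΨ₁δ : DegBound δ Ψ₁ := DegBound.of_mul_left hΨ₁m hΦm (by rw [mul_comm, ← hΨ]; exact h)
  have hsq1 : Φ.natDegree ^ 2 ≤ p := le_trans (Nat.pow_le_pow_left (by omega) 2) hsq
  have hsq2 : Ψ₁.natDegree ^ 2 ≤ p := le_trans (Nat.pow_le_pow_left (by omega) 2) hsq
  have ih1 := ih Ψ₁.natDegree (by omega) hΨ₁m hsq2 (by omega) hΨ₁δ rfl
  have hzero : ∀ β y : ZMod p, evalPt (ZMod p) β y Ψ = 0 ↔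
      evalPt (ZMod p) β y Φ = 0 ∨ evalPt (ZMod p) β y Ψ₁ = 0 := fun β y => by
    rw [hΨ, map_mul, mul_eq_zero]
  by_cases hd : Φ ∣ Ψ₁
  · have hz : ∀ β y : ZMod p, evalPt (ZMod p) β y Ψ = 0 ↔ evalPt (ZMod p) β y Ψ₁ = 0 := by
      intro β y
      rw [hzero, or_iff_right_of_imp]
      obtain ⟨c, rfl⟩ := hd
      intro h
      rw [map_mul, h, zero_mul]
    simp only [hz]
    refine ih1.trans ?_
    have : (Ψ₁.natDegree : ℝ) ≤ Ψ.natDegree := by exact_mod_cast (by omega)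
    gcongr
  have hirrb := norm_sum_points_irreducible hΦm hΦi (by omega) hΦδ ψ hψ
  have hcz := common_zeros (Ω := ZMod p) hΦm hΦi hΦδ hΨ₁δ hd
  set A : ZMod p → Set (ZMod p) := fun β => {y | evalPt (ZMod p) β y Φ = 0}
  set B : ZMod p → Set (ZMod p) := fun β => {y | evalPt (ZMod p) β y Ψ₁ = 0}
  have hAB : ∀ β, {y : ZMod p | evalPt (ZMod p) β y Ψ = 0} = A β ∪ B β := fun β => by
    ext y
    exact hzero β y
  have hncard : ∀ β, (({y : ZMod p | evalPt (ZMod p) β y Ψ = 0}.ncard : ℕ) : ℂ) =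
      (A β).ncard + (B β).ncard - ((A β ∩ B β).ncard : ℕ) := fun β => by
    rw [hAB, eq_sub_iff_add_eq]
    exact_mod_cast Set.ncard_union_add_ncard_inter (A β) (B β)
  have hsum : ∑ β, (A β ∩ B β).ncard ≤ Φ.natDegree * (δ * Ψ₁.natDegree) := by
    have h2 : ∑ β, (A β ∩ B β).ncard = {P : ZMod p × ZMod p | evalPt (ZMod p) P.1 P.2 Φ = 0 ∧
        evalPt (ZMod p) P.1 P.2 Ψ₁ = 0}.ncard := by
      classical
      simp only [Set.ncard_eq_toFinset_card']
      rw [← Finset.card_sigma]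
      refine Finset.card_bij (fun x _ => (x.1, x.2)) ?_ ?_ ?_
      · rintro ⟨a, b⟩ hab
        simpa [A, B] using hab
      · rintro ⟨a, b⟩ _ ⟨c, d⟩ _ h
        simpa using h
      · rintro ⟨a, b⟩ hab
        exact ⟨⟨a, b⟩, by simpa [A, B] using hab, rfl⟩
    rw [h2]
    have := hcz.2
    exact_mod_cast this
  simp only [hncard, mul_sub, mul_add, Finset.sum_sub_distrib, Finset.sum_add_distrib]
  have h3 : ‖∑ β, ψ β * (((A β ∩ B β).ncard : ℕ) : ℂ)‖ ≤
      (Φ.natDegree * (δ * Ψ₁.natDegree) : ℕ) := by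
    refine (norm_sum_le _ _).trans ?_
    simp only [norm_mul, AddChar.norm_apply, one_mul, Complex.norm_natCast]
    exact_mod_cast hsum
  refine (norm_sub_le _ _).trans (le_trans (add_le_add ((norm_add_le _ _).trans
    (add_le_add hirrb ih1)) h3) ?_)
  rw [hdeg]
  have hms : (Φ.natDegree : ℝ) ≤ √p := by
    apply Real.le_sqrt_of_sq_le
    exact_mod_cast hsq1
  have hΦ1 : (1 : ℝ) ≤ Φ.natDegree := by exact_mod_cast Nat.one_le_iff_ne_zero.2 hΦ0
  have hδ1 : (1 : ℝ) ≤ δ := by exact_mod_cast hδ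
  push_cast
  set a : ℝ := (Φ.natDegree : ℝ)
  set b : ℝ := (Ψ₁.natDegree : ℝ)
  have hb : 0 ≤ b := Nat.cast_nonneg _
  set s := √(p : ℝ)
  set d : ℝ := (δ : ℝ)
  have e1 : 2 * (a * (d * a + 1)) * s ≤ 4 * d * a ^ 2 * s := by
    have : a * 1 ≤ a * (d * a) := by
      gcongr
      nlinarith
    nlinarith
  have e2 : 2 * (d * a ^ 3) ≤ 2 * d * a ^ 2 * s := by
    have : d * a ^ 2 * a ≤ d * a ^ 2 * s := by gcongr
    linarith
  have e3 : a * (d * b) ≤ d * a * b * s := by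
    have : d * a * b * 1 ≤ d * a * b * s := by gcongr
    linarith
  have e4 : 0 ≤ d * a * b * s := by positivity
  linarith [show 6 * d * (a + b) ^ 2 * s = 6 * d * a ^ 2 * s + 6 * d * b ^ 2 * s
    + 12 * (d * a * b * s) by ring]

end PointSum

section Fejer

variable {p : ℕ} [Fact p.Prime] {ψ : AddChar (ZMod p) ℂ}

lemma sum_norm_sq_geom (hψ : ψ.IsPrimitive) {N : ℕ} (hN : N ≤ p) :
    ∑ a : ZMod p, ‖∑ v ∈ Finset.range N, ψ (a * v)‖ ^ 2 = p * N := by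
  have h : ∀ a : ZMod p, ((‖∑ v ∈ Finset.range N, ψ (a * v)‖ ^ 2 : ℝ) : ℂ) =
      ∑ u ∈ Finset.range N, ∑ v ∈ Finset.range N, ψ (a * ((v : ZMod p) - u)) := fun a => by
    rw [Complex.ofReal_pow, ← Complex.conj_mul', map_sum, Finset.sum_mul_sum]
    refine Finset.sum_congr rfl fun u _ => Finset.sum_congr rfl fun v _ => ?_
    rw [← AddChar.map_neg_eq_conj, ← AddChar.map_add_eq_mul]
    congr 1
    ring
  have h2 : ((∑ a : ZMod p, ‖∑ v ∈ Finset.range N, ψ (a * v)‖ ^ 2 : ℝ) : ℂ) = p * N := by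
    rw [Complex.ofReal_sum, Finset.sum_congr rfl fun a _ => h a, Finset.sum_comm]
    have h3 : ∀ u ∈ Finset.range N, ∑ a : ZMod p, ∑ v ∈ Finset.range N,
        ψ (a * ((v : ZMod p) - u)) = p := fun u hu => by
      rw [Finset.sum_comm, Finset.sum_eq_single u]
      · simp
      · intro v hv hvu
        rw [AddChar.sum_mulShift _ hψ, if_neg]
        · simp
        · rw [sub_eq_zero]
          intro h
          refine hvu ?_
          have := (ZMod.natCast_eq_natCast_iff' _ _ _).1 h
          rw [Finset.mem_range] at hu hv
          rwa [Nat.mod_eq_of_lt (by omega), Nat.mod_eq_of_lt (by omega)] at this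
      · exact fun h => absurd hu h
    rw [Finset.sum_congr rfl h3]
    simp [mul_comm]
  exact_mod_cast h2

/-- A nonnegative majorant of an interval with absolutely summable Fourier coefficients. -/
lemma exists_interval_majorant (hψ : ψ.IsPrimitive) (x₀ : ZMod p) {N : ℕ} (h0 : 0 < N)
    (hN : N ≤ p) : ∃ (c : ZMod p → ℂ) (w : ZMod p → ℝ),
      (∀ x, (w x : ℂ) = ∑ a, c a * ψ (a * x)) ∧ (∀ x, 0 ≤ w x) ∧
      (∀ j < N, 1 ≤ w (x₀ + j)) ∧ ∑ a, ‖c a‖ ≤ 2 ∧ ‖c 0‖ ≤ 2 * N / p := by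
  have hp0 : (0 : ℝ) < p := by exact_mod_cast (Fact.out : p.Prime).pos
  have hN0 : (0 : ℝ) < N := by exact_mod_cast h0
  have hp0' : (p : ℂ) ≠ 0 := by exact_mod_cast hp0.ne'
  have hN0' : (N : ℂ) ≠ 0 := by exact_mod_cast hN0.ne'
  let D : ZMod p → ℂ := fun a => ∑ v ∈ Finset.range N, ψ (a * v)
  let c : ZMod p → ℂ := fun a => ((N : ℂ) * p)⁻¹ * ∑ u ∈ Finset.range (2 * N),
    ∑ v ∈ Finset.range N, ψ (a * (v - u - x₀))
  let w : ZMod p → ℝ := fun x => (N : ℝ)⁻¹ * ∑ u ∈ Finset.range (2 * N),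
    ∑ v ∈ Finset.range N, if x + (v - u - x₀) = 0 then 1 else 0
  have hc : ∀ a, ‖c a‖ ≤ ((N : ℝ) * p)⁻¹ * (‖D (-a)‖ ^ 2 + ‖D a‖ ^ 2) := fun a => by
    have h1 : ∑ u ∈ Finset.range (2 * N), ∑ v ∈ Finset.range N, ψ (a * (v - u - x₀)) =
        ψ (-a * x₀) * ((1 + ψ (-a * N)) * D (-a)) * D a := by
      have h2 : (1 + ψ (-a * N)) * D (-a) = ∑ u ∈ Finset.range (2 * N), ψ (-a * u) := by
        rw [two_mul, Finset.sum_range_add, add_mul, one_mul, Finset.mul_sum]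
        congr 1
        refine Finset.sum_congr rfl fun u _ => ?_
        rw [← AddChar.map_add_eq_mul]
        congr 1
        push_cast
        ring
      rw [h2, mul_assoc, Finset.sum_mul_sum, Finset.mul_sum]
      refine Finset.sum_congr rfl fun u _ => ?_
      rw [Finset.mul_sum]
      refine Finset.sum_congr rfl fun v _ => ?_
      rw [← AddChar.map_add_eq_mul, ← AddChar.map_add_eq_mul]
      congr 1
      ring
    have h3 : ‖1 + ψ (-a * N)‖ ≤ 2 := by
      refine (norm_add_le _ _).trans ?_
      rw [AddChar.norm_apply, norm_one]
      norm_num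
    simp only [c]
    rw [h1, norm_mul, norm_inv, norm_mul, norm_mul, norm_mul, norm_mul, AddChar.norm_apply,
      one_mul, Complex.norm_natCast, Complex.norm_natCast]
    refine mul_le_mul_of_nonneg_left ?_ (by positivity)
    have h4 : ‖1 + ψ (-a * N)‖ * ‖D (-a)‖ * ‖D a‖ ≤ 2 * ‖D (-a)‖ * ‖D a‖ := by gcongr
    nlinarith [sq_nonneg (‖D (-a)‖ - ‖D a‖)]
  refine ⟨c, w, fun x => ?_, fun x => ?_, fun j hj => ?_, ?_, ?_⟩
  · simp only [w, c]
    push_cast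
    have h1 : ∀ a : ZMod p, ((N : ℂ) * p)⁻¹ * (∑ u ∈ Finset.range (2 * N),
        ∑ v ∈ Finset.range N, ψ (a * (v - u - x₀))) * ψ (a * x) = ((N : ℂ) * p)⁻¹ *
        ∑ u ∈ Finset.range (2 * N), ∑ v ∈ Finset.range N, ψ (a * (x + (v - u - x₀))) := by
      intro a
      rw [mul_assoc, Finset.sum_mul]
      congr 1
      refine Finset.sum_congr rfl fun u _ => ?_
      rw [Finset.sum_mul]
      refine Finset.sum_congr rfl fun v _ => ?_
      rw [← AddChar.map_add_eq_mul]
      congr 1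
      ring
    simp only [h1]
    rw [← Finset.mul_sum, Finset.sum_comm (s := Finset.univ), mul_inv, mul_assoc]
    congr 1
    rw [Finset.mul_sum]
    refine Finset.sum_congr rfl fun u _ => ?_
    rw [Finset.sum_comm (s := Finset.univ), Finset.mul_sum]
    refine Finset.sum_congr rfl fun v _ => ?_
    rw [AddChar.sum_mulShift _ hψ]
    split_ifs <;> simp [hp0']
  · simp only [w]
    refine mul_nonneg (by positivity) (Finset.sum_nonneg fun u _ => Finset.sum_nonneg fun v _ => ?_)
    split_ifs <;> norm_num
  · simp only [w]
    rw [Finset.sum_comm, ← div_eq_inv_mul, le_div_iff₀ hN0, one_mul]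
    have h1 : ∀ v ∈ Finset.range N, (1 : ℝ) ≤ ∑ u ∈ Finset.range (2 * N),
        if x₀ + (j : ZMod p) + (v - u - x₀) = 0 then 1 else 0 := fun v hv => by
      rw [Finset.mem_range] at hv
      refine le_trans (le_of_eq ?_) (Finset.single_le_sum
        (f := fun u : ℕ => if x₀ + (j : ZMod p) + (v - u - x₀) = 0 then (1 : ℝ) else 0)
        (fun u _ => by positivity) (Finset.mem_range.2 (show j + v < 2 * N by omega)))
      rw [if_pos]
      push_cast
      ring
    refine le_trans ?_ (Finset.sum_le_sum h1)
    simp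
  · refine (Finset.sum_le_sum fun a _ => hc a).trans ?_
    rw [← Finset.mul_sum, Finset.sum_add_distrib]
    have h1 : ∑ a, ‖D (-a)‖ ^ 2 = ∑ a, ‖D a‖ ^ 2 :=
      Fintype.sum_equiv (Equiv.neg (ZMod p)) _ _ fun _ => rfl
    rw [h1, sum_norm_sq_geom hψ hN]
    apply le_of_eq
    field_simp
    norm_num
  · refine (hc 0).trans (le_of_eq ?_)
    simp only [D, neg_zero, zero_mul, AddChar.map_zero_eq_one]
    simp
    field_simp
    norm_num

/-- Points of a plane set in a box, in terms of exponential sums over the set. -/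
lemma card_filter_box_le (hψ : ψ.IsPrimitive) (Z : Finset (ZMod p × ZMod p)) (x₀ : ZMod p) {N : ℕ}
    (h0 : 0 < N) (hN : N ≤ p) {M : ℝ}
    (hM : ∀ a b : ZMod p, (a, b) ≠ 0 → ‖∑ P ∈ Z, ψ (a * P.1 + b * P.2)‖ ≤ M) :
    (((Finset.range N ×ˢ Finset.range N).filter
      fun u => (x₀ + (u.1 : ZMod p), x₀ + (u.2 : ZMod p)) ∈ Z).card : ℝ) ≤
      4 * (N / p : ℝ) ^ 2 * Z.card + 4 * M := by
  obtain ⟨c, w, hw, hw0, hw1, hc, hc0⟩ := exists_interval_majorant hψ x₀ h0 hN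
  have hM0 : 0 ≤ M := (norm_nonneg _).trans (hM 1 0 (by simp))
  set B := (Finset.range N ×ˢ Finset.range N).filter
      fun u => (x₀ + (u.1 : ZMod p), x₀ + (u.2 : ZMod p)) ∈ Z
  have hinj : ∀ i < N, ∀ j < N, x₀ + (i : ZMod p) = x₀ + j → i = j := fun i hi j hj h => by
    have := (ZMod.natCast_eq_natCast_iff' _ _ _).1 (add_left_cancel h)
    rwa [Nat.mod_eq_of_lt (by omega), Nat.mod_eq_of_lt (by omega)] at this
  have h1 : (B.card : ℝ) ≤ ∑ P ∈ Z, w P.1 * w P.2 := by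
    calc (B.card : ℝ) = ∑ u ∈ B, 1 := by simp
      _ ≤ ∑ u ∈ B, w (x₀ + (u.1 : ZMod p)) * w (x₀ + (u.2 : ZMod p)) := by
        refine Finset.sum_le_sum fun u hu => ?_
        simp only [B, Finset.mem_filter, Finset.mem_product, Finset.mem_range] at hu
        exact one_le_mul_of_one_le_of_one_le (hw1 _ hu.1.1) (hw1 _ hu.1.2)
      _ = ∑ P ∈ B.image (fun u => (x₀ + (u.1 : ZMod p), x₀ + (u.2 : ZMod p))),
          w P.1 * w P.2 := by
        rw [Finset.sum_image]
        intro u hu v hv h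
        simp only [B, Finset.coe_filter, Finset.mem_product, Finset.mem_range,
          Set.mem_ofPred_eq] at hu hv
        rw [Prod.mk.injEq] at h
        exact Prod.ext (hinj _ hu.1.1 _ hv.1.1 h.1) (hinj _ hu.1.2 _ hv.1.2 h.2)
      _ ≤ ∑ P ∈ Z, w P.1 * w P.2 := by
        refine Finset.sum_le_sum_of_subset_of_nonneg ?_ fun P _ _ => mul_nonneg (hw0 _) (hw0 _)
        intro P hP
        obtain ⟨u, hu, rfl⟩ := Finset.mem_image.1 hP
        exact (Finset.mem_filter.1 hu).2
  have h2 : ((∑ P ∈ Z, w P.1 * w P.2 : ℝ) : ℂ) =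
      ∑ a, ∑ b, c a * c b * ∑ P ∈ Z, ψ (a * P.1 + b * P.2) := by
    push_cast
    simp only [hw, Finset.sum_mul_sum]
    simp only [Finset.mul_sum]
    rw [Finset.sum_comm]
    refine Finset.sum_congr rfl fun a _ => ?_
    rw [Finset.sum_comm]
    refine Finset.sum_congr rfl fun b _ => Finset.sum_congr rfl fun P _ => ?_
    rw [AddChar.map_add_eq_mul]
    ring
  have h3 : ∀ a b, ‖c a * c b * ∑ P ∈ Z, ψ (a * P.1 + b * P.2)‖ ≤
      ‖c a‖ * ‖c b‖ * M + if (a, b) = 0 then ‖c 0‖ ^ 2 * Z.card else 0 := fun a b => by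
    rw [norm_mul, norm_mul]
    split_ifs with h
    · obtain ⟨rfl, rfl⟩ := Prod.mk.inj h
      have : ‖c 0‖ * ‖c 0‖ * ‖∑ P ∈ Z, ψ (0 * P.1 + 0 * P.2)‖ = ‖c 0‖ ^ 2 * Z.card := by
        simp [sq]
      rw [this]
      have : 0 ≤ ‖c 0‖ * ‖c 0‖ * M := by positivity
      linarith
    · rw [add_zero]
      exact mul_le_mul_of_nonneg_left (hM a b h) (by positivity)
  have h4 : (∑ P ∈ Z, w P.1 * w P.2 : ℝ) =
      ‖∑ a, ∑ b, c a * c b * ∑ P ∈ Z, ψ (a * P.1 + b * P.2)‖ := by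
    rw [← h2, Complex.norm_real, Real.norm_of_nonneg]
    exact Finset.sum_nonneg fun P _ => mul_nonneg (hw0 _) (hw0 _)
  refine h1.trans (h4.le.trans ?_)
  have h5 : ∑ a, ∑ b, ‖c a * c b * ∑ P ∈ Z, ψ (a * P.1 + b * P.2)‖ ≤
      (∑ a, ‖c a‖) * (∑ b, ‖c b‖) * M + ‖c 0‖ ^ 2 * Z.card := by
    refine (Finset.sum_le_sum fun a _ => Finset.sum_le_sum fun b _ => h3 a b).trans
      (le_of_eq ?_)
    simp only [Finset.sum_add_distrib, Finset.sum_mul_sum]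
    simp only [Finset.sum_mul]
    congr 1
    rw [← Fintype.sum_prod_type' (f := fun a b : ZMod p =>
      if (a, b) = 0 then ‖c 0‖ ^ 2 * (Z.card : ℝ) else 0)]
    simp
  refine (norm_sum_le _ _).trans ((Finset.sum_le_sum fun a _ => norm_sum_le _ _).trans
    (h5.trans ?_))
  have h6 : ‖c 0‖ ^ 2 ≤ 4 * (N / p : ℝ) ^ 2 := by
    have : ‖c 0‖ ^ 2 ≤ (2 * N / p : ℝ) ^ 2 := by gcongr
    refine this.trans (le_of_eq (by ring))
  have h7 : (∑ a, ‖c a‖) * (∑ b, ‖c b‖) ≤ 4 := by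
    have h0 : 0 ≤ ∑ a, ‖c a‖ := Finset.sum_nonneg fun _ _ => norm_nonneg _
    nlinarith
  have h8 : ‖c 0‖ ^ 2 * (Z.card : ℝ) ≤ 4 * (N / p : ℝ) ^ 2 * Z.card := by gcongr
  have h9 : (∑ a, ‖c a‖) * (∑ b, ‖c b‖) * M ≤ 4 * M := by gcongr
  linarith

end Fejer

section ShiftProd

variable {R : Type*} [CommRing R]

/-- The product `(x + 1) ⋯ (x + k)`. -/
def shiftProd (k : ℕ) (x : R) : R := ∏ i ∈ Finset.range k, (x + ((i + 1 : ℕ) : R))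

/-- The divided difference of `shiftProd k`. -/
def shiftDiff : ℕ → R → R → R
  | 0, _, _ => 0
  | k + 1, x, y => shiftDiff k x y * (y + ((k + 1 : ℕ) : R)) + shiftProd k x

lemma shiftProd_succ (k : ℕ) (x : R) :
    shiftProd (k + 1) x = shiftProd k x * (x + ((k + 1 : ℕ) : R)) :=
  Finset.prod_range_succ _ _

lemma mul_shiftDiff (k : ℕ) (x y : R) :
    (x - y) * shiftDiff k x y = shiftProd k x - shiftProd k y := by
  induction k with
  | zero => simp [shiftDiff, shiftProd]
  | succ k ih =>
    rw [shiftDiff, shiftProd_succ, shiftProd_succ, mul_add, ← mul_assoc, ih]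
    ring

lemma map_shiftProd {S F : Type*} [CommRing S] [FunLike F R S] [RingHomClass F R S] (f : F)
    (k : ℕ) (x : R) : f (shiftProd k x) = shiftProd k (f x) := by
  simp [shiftProd, map_prod, map_add]

lemma map_shiftDiff {S F : Type*} [CommRing S] [FunLike F R S] [RingHomClass F R S] (f : F)
    (k : ℕ) (x y : R) : f (shiftDiff k x y) = shiftDiff k (f x) (f y) := by
  induction k with
  | zero => simp [shiftDiff]
  | succ k ih =>
    rw [shiftDiff, shiftDiff, map_add, map_mul, ih, map_shiftProd, map_add, map_natCast]

lemma monic_shiftProd_X (k : ℕ) : (shiftProd k (X : R[X])).Monic :=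
  monic_prod_of_monic _ _ fun i _ => by
    rw [← C_eq_natCast]
    exact monic_X_add_C _

lemma natDegree_shiftProd_X [Nontrivial R] (k : ℕ) : (shiftProd k (X : R[X])).natDegree = k := by
  rw [shiftProd, natDegree_prod_of_monic _ _ fun i _ => by
    rw [← C_eq_natCast]
    exact monic_X_add_C _]
  rw [Finset.sum_congr rfl (g := fun _ => 1)]
  · simp
  · intro i _
    rw [← C_eq_natCast, natDegree_X_add_C]

lemma natDegree_shiftProd_le {f : R[X]} (hf : f.natDegree ≤ 1) (k : ℕ) :
    (shiftProd k f).natDegree ≤ k := by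
  refine (natDegree_prod_le _ _).trans ?_
  refine (Finset.sum_le_card_nsmul _ _ 1 fun i _ => ?_).trans (by simp)
  refine (natDegree_add_le _ _).trans ?_
  rw [natDegree_natCast]
  omega

lemma shiftDiff_self_X (k : ℕ) :
    shiftDiff k (X : R[X]) X = derivative (shiftProd k (X : R[X])) := by
  induction k with
  | zero => simp [shiftDiff, shiftProd]
  | succ k ih =>
    rw [shiftDiff, shiftProd_succ, derivative_mul, ih, derivative_add, derivative_X,
      derivative_natCast]
    ring

variable {k : Type*} [Field k] [Algebra k R]

lemma RingFilt.natCast_mem (S : RingFilt k R) (m : ℕ) : (m : R) ∈ S.F 0 := by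
  rw [← nsmul_one]
  exact nsmul_mem S.one_mem m

lemma RingFilt.shiftProd_mem (S : RingFilt k R) {x : R} {n : ℤ} (hn : 0 ≤ n) (hx : x ∈ S.F n)
    (r : ℕ) : shiftProd r x ∈ S.F (r * n) := by
  have := S.prod_mem (Finset.range r) (fun i => x + ((i + 1 : ℕ) : R)) (fun _ => n)
    fun i _ => add_mem hx (S.mono hn (S.natCast_mem _))
  rw [shiftProd]
  simpa only [Finset.sum_const, Finset.card_range, nsmul_eq_mul] using this

lemma RingFilt.shiftDiff_mem (S : RingFilt k R) {x y : R} (hx : x ∈ S.F 1) (hy : y ∈ S.F 1)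
    (r : ℕ) : shiftDiff r x y ∈ S.F (r - 1) := by
  induction r with
  | zero => exact zero_mem _
  | succ r ih =>
    refine add_mem ?_ ?_
    · have := S.mul_mem ih (add_mem hy (S.mono zero_le_one (S.natCast_mem (r + 1))))
      refine S.mono ?_ this
      push_cast
      linarith
    · have := S.shiftProd_mem zero_le_one hx r
      refine S.mono ?_ this
      push_cast
      linarith

end ShiftProd

section OffDiagonal

variable {p : ℕ} [Fact p.Prime]

lemma shiftDiff_comm {k : Type*} [Field k] (r : ℕ) (x y : k) :
    shiftDiff r x y = shiftDiff r y x := by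
  by_cases h : x = y
  · rw [h]
  · refine mul_left_cancel₀ (sub_ne_zero.2 h) ?_
    have := mul_shiftDiff r y x
    rw [mul_shiftDiff]
    linear_combination this

lemma sum_fibers_equiv (ψ : AddChar (ZMod p) ℂ) (Z : Finset (ZMod p × ZMod p))
    (ε : ZMod p × ZMod p ≃ ZMod p × ZMod p) :
    ∑ P ∈ Z, ψ (ε P).1 = ∑ t, ψ t * ({y : ZMod p | ε.symm (t, y) ∈ Z}.ncard : ℂ) := by
  classical
  have h1 : ∑ P ∈ Z, ψ (ε P).1 = ∑ P, if P ∈ Z then ψ (ε P).1 else 0 := by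
    rw [Finset.sum_ite_mem, Finset.univ_inter]
  have h2 : ∑ P, (if P ∈ Z then ψ (ε P).1 else 0) =
      ∑ Q : ZMod p × ZMod p, if ε.symm Q ∈ Z then ψ Q.1 else 0 :=
    Fintype.sum_equiv ε _ _ fun P => by simp
  rw [h1, h2, Fintype.sum_prod_type]
  refine Finset.sum_congr rfl fun t _ => ?_
  rw [← Finset.sum_filter]
  simp only [Finset.sum_const, nsmul_eq_mul]
  rw [mul_comm]
  congr 2
  rw [← Set.ncard_coe_finset]
  congr 1
  ext y
  simp

/-- The coordinates `(a x + b y, x)` for `b ≠ 0`. -/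
def lineEquiv (a b : ZMod p) (hb : b ≠ 0) : ZMod p × ZMod p ≃ ZMod p × ZMod p where
  toFun P := (a * P.1 + b * P.2, P.1)
  invFun Q := (Q.2, (Q.1 - a * Q.2) / b)
  left_inv P := Prod.ext rfl (by simp [mul_div_cancel_left₀ _ hb])
  right_inv Q := Prod.ext (by simp [mul_div_cancel₀ _ hb]) rfl

/-- The coordinates `(a x, y)` for `a ≠ 0`. -/
def scaleEquiv (a : ZMod p) (ha : a ≠ 0) : ZMod p × ZMod p ≃ ZMod p × ZMod p where
  toFun P := (a * P.1, P.2)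
  invFun Q := (Q.1 / a, Q.2)
  left_inv _ := Prod.ext (mul_div_cancel_left₀ _ ha) rfl
  right_inv _ := Prod.ext (mul_div_cancel₀ _ ha) rfl

/-- The linear polynomial `(T - a X) / b`. -/
noncomputable def linePoly (a b : ZMod p) : (ZMod p)[X][X] :=
  C (C b⁻¹ * X) - C (C (a / b)) * X

lemma evalPt_linePoly (a b t x : ZMod p) :
    evalPt (ZMod p) t x (linePoly a b) = (t - a * x) / b := by
  simp only [linePoly, map_sub, map_mul, evalPt_C, evalPt_X, aeval_X, aeval_C]
  simp only [Algebra.algebraMap_self, RingHom.id_apply]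
  ring

lemma linePoly_mem (a b : ZMod p) :
    linePoly a b ∈ ((RingFilt.deg (ZMod p)).poly 1).F 1 := by
  refine sub_mem (RingFilt.C_mem_poly ?_) ?_
  · exact_mod_cast RingFilt.mem_deg_natCast.2 ((natDegree_C_mul_le _ _).trans natDegree_X_le)
  · have h := RingFilt.mul_mem _ (RingFilt.C_mem_poly (δ := 1)
      (RingFilt.mem_deg_natCast.2 (natDegree_C (a / b)).le)) (RingFilt.X_mem_poly _ 1)
    simpa using h

lemma natDegree_linePoly_le (a b : ZMod p) : (linePoly a b).natDegree ≤ 1 := by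
  refine (natDegree_sub_le _ _).trans (max_le ((natDegree_C _).le.trans zero_le_one) ?_)
  exact (natDegree_C_mul_le _ _).trans natDegree_X_le

lemma norm_sum_offDiag_le {ψ : AddChar (ZMod p) ℂ} (hψ : ψ ≠ 0) {k l : ℕ} (hl : 1 ≤ l) (hlk : l < k)
    (hkl : k ≤ 2 * l) (hsq : k ^ 2 ≤ p) (hkp : k < p) {a b : ZMod p} (hab : (a, b) ≠ 0) :
    ‖∑ P ∈ Finset.univ.filter (fun P : ZMod p × ZMod p => shiftProd k P.1 = shiftProd l P.2),
      ψ (a * P.1 + b * P.2)‖ ≤ 12 * k ^ 2 * √p := by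
  by_cases hb : b = 0
  · subst hb
    have ha : a ≠ 0 := by
      rintro rfl
      exact hab rfl
    have h1 := sum_fibers_equiv ψ (Finset.univ.filter
      (fun P : ZMod p × ZMod p => shiftProd k P.1 = shiftProd l P.2)) (scaleEquiv a ha)
    simp only [scaleEquiv, Equiv.coe_fn_mk, Equiv.coe_fn_symm_mk, Finset.mem_filter,
      Finset.mem_univ, true_and] at h1
    simp only [zero_mul, add_zero]
    set Ψ : (ZMod p)[X][X] := shiftProd l X - C (shiftProd k (C a⁻¹ * X)) with hΨ
    have hdeg : (C (shiftProd k (C a⁻¹ * X : (ZMod p)[X]))).degree <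
        (shiftProd l (X : (ZMod p)[X][X])).degree := by
      rw [degree_eq_natDegree (monic_shiftProd_X l).ne_zero, natDegree_shiftProd_X]
      exact degree_C_le.trans_lt (by exact_mod_cast hl)
    have hm : Ψ.Monic := (monic_shiftProd_X l).sub_of_left hdeg
    have hn : Ψ.natDegree = l := by
      rw [hΨ, natDegree_sub_eq_left_of_natDegree_lt, natDegree_shiftProd_X]
      rw [natDegree_C, natDegree_shiftProd_X]
      omega
    have hδ : DegBound 2 Ψ := by
      rw [DegBound, hn]
      refine sub_mem ?_ (RingFilt.C_mem_poly ?_)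
      · have := RingFilt.shiftProd_mem _ zero_le_two
          (RingFilt.X_mem_poly (RingFilt.deg (ZMod p)) 2) l
        rw [mul_comm] at this
        exact_mod_cast this
      · have := (RingFilt.mem_deg_natCast (k := ZMod p)).2
          (natDegree_shiftProd_le (f := C a⁻¹ * X)
            ((natDegree_C_mul_le _ _).trans natDegree_X_le) k)
        exact RingFilt.mono _ (by exact_mod_cast hkl) this
    have hev : ∀ t y : ZMod p, evalPt (ZMod p) t y Ψ = 0 ↔
        shiftProd k (t / a) = shiftProd l y := fun t y => by
      rw [hΨ, map_sub, map_shiftProd, evalPt_X, evalPt_C, map_shiftProd, map_mul, aeval_X,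
        aeval_C, sub_eq_zero, eq_comm, Algebra.algebraMap_self, RingHom.id_apply, mul_comm,
        ← div_eq_mul_inv]
    have h2 := norm_sum_points_le one_le_two ψ hψ hm
      (by rw [hn]; exact (Nat.pow_le_pow_left hlk.le 2).trans hsq) (by omega) hδ
    simp only [hev] at h2
    rw [h1]
    refine h2.trans ?_
    rw [hn]
    have : (l : ℝ) ≤ k := by exact_mod_cast hlk.le
    push_cast
    calc 6 * 2 * (l : ℝ) ^ 2 * √p ≤ 6 * 2 * (k : ℝ) ^ 2 * √p := by gcongr
      _ = _ := by ring
  · have h1 := sum_fibers_equiv ψ (Finset.univ.filter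
      (fun P : ZMod p × ZMod p => shiftProd k P.1 = shiftProd l P.2)) (lineEquiv a b hb)
    simp only [lineEquiv, Equiv.coe_fn_mk, Equiv.coe_fn_symm_mk, Finset.mem_filter,
      Finset.mem_univ, true_and] at h1
    set Ψ : (ZMod p)[X][X] := shiftProd k X - shiftProd l (linePoly a b) with hΨ
    have hle := natDegree_shiftProd_le (natDegree_linePoly_le a b) l
    have hdeg : (shiftProd l (linePoly a b)).degree <
        (shiftProd k (X : (ZMod p)[X][X])).degree := by
      rw [degree_eq_natDegree (monic_shiftProd_X k).ne_zero, natDegree_shiftProd_X]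
      exact (degree_le_of_natDegree_le hle).trans_lt (by exact_mod_cast hlk)
    have hm : Ψ.Monic := (monic_shiftProd_X k).sub_of_left hdeg
    have hn : Ψ.natDegree = k := by
      rw [hΨ, natDegree_sub_eq_left_of_natDegree_lt, natDegree_shiftProd_X]
      rw [natDegree_shiftProd_X]
      omega
    have hδ : DegBound 1 Ψ := by
      rw [DegBound, hn]
      refine sub_mem ?_ ?_
      · have := RingFilt.shiftProd_mem _ zero_le_one
          (RingFilt.X_mem_poly (RingFilt.deg (ZMod p)) 1) k
        rw [mul_comm] at this
        exact_mod_cast this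
      · have := RingFilt.shiftProd_mem _ zero_le_one (linePoly_mem a b) l
        refine RingFilt.mono _ ?_ (by exact_mod_cast this)
        have : (l : ℤ) ≤ k := by exact_mod_cast hlk.le
        push_cast
        linarith
    have hev : ∀ t y : ZMod p, evalPt (ZMod p) t y Ψ = 0 ↔
        shiftProd k y = shiftProd l ((t - a * y) / b) := fun t y => by
      rw [hΨ, map_sub, map_shiftProd, evalPt_X, map_shiftProd, evalPt_linePoly, sub_eq_zero]
    have h2 := norm_sum_points_le le_rfl ψ hψ hm (by rwa [hn]) (by omega) hδ
    simp only [hev] at h2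
    rw [h1]
    refine h2.trans ?_
    rw [hn]
    push_cast
    have : 0 ≤ (k : ℝ) ^ 2 * √p := by positivity
    linarith

lemma card_shiftProd_eq_le {k : ℕ} (hk : 1 ≤ k) (c : ZMod p) :
    (Finset.univ.filter (fun x : ZMod p => shiftProd k x = c)).card ≤ k := by
  have hdeg : (C c).natDegree < (shiftProd k (X : (ZMod p)[X])).natDegree := by
    rw [natDegree_C, natDegree_shiftProd_X]
    omega
  have hn := natDegree_sub_eq_left_of_natDegree_lt hdeg
  rw [natDegree_shiftProd_X] at hn
  have h0 : shiftProd k (X : (ZMod p)[X]) - C c ≠ 0 := by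
    intro h
    rw [h, natDegree_zero] at hn
    omega
  refine le_trans ?_ ((card_roots' _).trans hn.le)
  refine le_trans (Finset.card_le_card ?_) (Multiset.toFinset_card_le _)
  intro x hx
  rw [Finset.mem_filter] at hx
  have he : eval x (shiftProd k (X : (ZMod p)[X])) = shiftProd k x := by
    rw [← coe_evalRingHom, map_shiftProd, coe_evalRingHom, eval_X]
  rw [Multiset.mem_toFinset, mem_roots h0, IsRoot, eval_sub, eval_C, he, hx.2, sub_self]

lemma card_offDiag_le {k l : ℕ} (hk : 1 ≤ k) :
    (Finset.univ.filter
      (fun P : ZMod p × ZMod p => shiftProd k P.1 = shiftProd l P.2)).card ≤ p * k := by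
  classical
  refine (Finset.card_le_mul_card_image (f := Prod.snd) _ k fun y _ => ?_).trans ?_
  · refine le_trans ?_ (card_shiftProd_eq_le hk (shiftProd l y))
    refine Finset.card_le_card_of_injOn Prod.fst ?_ ?_
    · rintro ⟨x, y'⟩ h
      simp only [Finset.coe_filter, Finset.mem_filter, Finset.mem_univ, true_and,
        Set.mem_ofPred_eq] at h ⊢
      rw [h.1, h.2]
    · rintro ⟨x, y'⟩ h ⟨x', y''⟩ h' hxx
      simp only [Finset.coe_filter, Finset.mem_filter, Finset.mem_univ, true_and,
        Set.mem_ofPred_eq] at h h' hxx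
      rw [hxx, h.2, h'.2]
  · rw [mul_comm p]
    refine Nat.mul_le_mul_left _ ((Finset.card_le_univ _).trans (ZMod.card p).le)

end OffDiagonal

section NonMonic

variable {p : ℕ} [Fact p.Prime]

lemma ncard_evalPt_zeros_le {Ψ : (ZMod p)[X][X]} {t : ZMod p}
    (h : Ψ.map ((aeval t : (ZMod p)[X] →ₐ[ZMod p] ZMod p) : (ZMod p)[X] →+* ZMod p) ≠ 0) :
    {y : ZMod p | evalPt (ZMod p) t y Ψ = 0}.ncard ≤ Ψ.natDegree := by
  classical
  refine le_trans ?_ ((Multiset.toFinset_card_le _).trans ((card_roots' (Ψ.map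
    ((aeval t : (ZMod p)[X] →ₐ[ZMod p] ZMod p) : (ZMod p)[X] →+* ZMod p))).trans natDegree_map_le))
  rw [← Set.ncard_coe_finset]
  refine Set.ncard_le_ncard (fun y hy => ?_) (Finset.finite_toSet _)
  rw [Finset.mem_coe, Multiset.mem_toFinset, mem_roots h, IsRoot, eval_map]
  exact hy

/-- A Weil-type bound for plane curves of bounded total degree. -/
lemma norm_sum_points_le_of_mem {ψ : AddChar (ZMod p) ℂ} (hψ : ψ ≠ 0) {Ψ : (ZMod p)[X][X]} {e : ℕ}
    (hΨ : Ψ ∈ ((RingFilt.deg (ZMod p)).poly 1).F e)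
    (hne : ∀ t : ZMod p, Ψ.map
      ((aeval t : (ZMod p)[X] →ₐ[ZMod p] ZMod p) : (ZMod p)[X] →+* ZMod p) ≠ 0)
    (hsq : e ^ 2 ≤ p) (hlt : e < p) :
    ‖∑ t, ψ t * ({y : ZMod p | evalPt (ZMod p) t y Ψ = 0}.ncard : ℂ)‖ ≤
      6 * (e + 1) * e ^ 2 * √p + e ^ 2 := by
  have h0 : Ψ ≠ 0 := by
    rintro rfl
    exact hne 0 (Polynomial.map_zero _)
  have hde : Ψ.natDegree ≤ e := by
    by_contra! h
    have h1 := RingFilt.eq_zero_of_mem_deg (RingFilt.mem_poly.1 hΨ Ψ.natDegree)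
      (by zify at h; linarith)
    exact h0 (leadingCoeff_eq_zero.1 h1)
  have hcoeff : ∀ i ≤ e, (Ψ.coeff i).natDegree ≤ e - i := fun i hi => by
    have h := RingFilt.mem_poly.1 hΨ i
    rw [one_mul, ← Nat.cast_sub hi] at h
    exact RingFilt.mem_deg_natCast.1 h
  obtain ⟨d, hd⟩ : ∃ d, d = Ψ.natDegree := ⟨_, rfl⟩
  obtain ⟨r, hr⟩ : ∃ r, e = d + r := ⟨e - d, by omega⟩
  have hlc : Ψ.leadingCoeff.natDegree ≤ r := (hcoeff _ hde).trans (by omega)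
  have hδ : DegBound (r + 1) (integralNormalization Ψ) := by
    intro i
    rw [natDegree_integralNormalization, ← hd]
    rcases lt_trichotomy i d with hi | hi | hi
    · rw [integralNormalization_coeff_ne_natDegree (by omega), ← hd]
      have h1 : (((r + 1 : ℕ) : ℤ) * d - (r + 1 : ℕ) * i) = (((r + 1) * (d - i) : ℕ) : ℤ) := by
        push_cast [hi.le]
        ring
      rw [h1, RingFilt.mem_deg_natCast]
      refine natDegree_mul_le.trans ((add_le_add (hcoeff i (by omega)) natDegree_pow_le).trans ?_)
      obtain ⟨j, rfl⟩ : ∃ j, d = i + j + 1 := ⟨d - i - 1, by omega⟩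
      have h2 : i + j + 1 - 1 - i = j := by omega
      have h3 : i + j + 1 - i = j + 1 := by omega
      have h4 : e - i = j + 1 + r := by omega
      rw [h2, h3, h4]
      have := Nat.mul_le_mul_left j hlc
      nlinarith
    · subst hi
      rw [hd, integralNormalization_coeff_natDegree h0, sub_self]
      exact RingFilt.one_mem _
    · rw [coeff_eq_zero_of_natDegree_lt (by rw [natDegree_integralNormalization]; omega)]
      exact zero_mem _
  have hm := monic_integralNormalization h0
  have h1 := norm_sum_points_le (by omega) ψ hψ hm
    (by rw [natDegree_integralNormalization]; exact (Nat.pow_le_pow_left hde 2).trans hsq)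
    (by rw [natDegree_integralNormalization]; omega) hδ
  rw [natDegree_integralNormalization, ← hd] at h1
  set A : ZMod p → ℕ := fun t => {y : ZMod p | evalPt (ZMod p) t y Ψ = 0}.ncard with hA
  set B : ZMod p → ℕ :=
    fun t => {y : ZMod p | evalPt (ZMod p) t y (integralNormalization Ψ) = 0}.ncard with hB
  have hAd : ∀ t, A t ≤ e := fun t => (ncard_evalPt_zeros_le (hne t)).trans hde
  have hBd : ∀ t, B t ≤ e := fun t => by
    refine (ncard_evalPt_zeros_le (hm.map _).ne_zero).trans ?_
    rwa [natDegree_integralNormalization]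
  have hABeq : ∀ t, aeval t Ψ.leadingCoeff ≠ 0 → A t = B t := fun t ht => by
    rcases Nat.eq_zero_or_pos Ψ.natDegree with hz | hz
    · have e1 : Ψ.integralNormalization = 1 :=
        hm.natDegree_eq_zero.1 (by rw [natDegree_integralNormalization, hz])
      have e2 : Ψ = C Ψ.leadingCoeff := by
        rw [leadingCoeff, hz]
        exact eq_C_of_natDegree_eq_zero hz
      have e3 : ∀ y, evalPt (ZMod p) t y Ψ = aeval t Ψ.leadingCoeff := fun y => by
        conv_lhs => rw [e2]
        rw [evalPt_C]
      simp only [hA, hB, e1, e3, ht, map_one, one_ne_zero]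
    · have key : ∀ y, evalPt (ZMod p) t (aeval t Ψ.leadingCoeff * y) (integralNormalization Ψ) =
          (aeval t Ψ.leadingCoeff) ^ (Ψ.natDegree - 1) * evalPt (ZMod p) t y Ψ := fun y =>
        integralNormalization_eval₂_leadingCoeff_mul hz _ y
      refine Set.ncard_congr (fun y _ => aeval t Ψ.leadingCoeff * y) ?_ ?_ ?_
      · intro y hy
        rw [Set.mem_ofPred_eq] at hy ⊢
        rw [key, hy, mul_zero]
      · intro y z _ _ h
        exact mul_left_cancel₀ ht h
      · intro y hy
        refine ⟨y / aeval t Ψ.leadingCoeff, ?_, mul_div_cancel₀ _ ht⟩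
        rw [Set.mem_ofPred_eq] at hy ⊢
        have := key (y / aeval t Ψ.leadingCoeff)
        rw [mul_div_cancel₀ _ ht, hy] at this
        exact (mul_eq_zero.1 this.symm).resolve_left (pow_ne_zero _ ht)
  have hbad : ((Finset.univ.filter fun t : ZMod p => aeval t Ψ.leadingCoeff = 0).card) ≤ e := by
    classical
    refine le_trans ?_ ((Multiset.toFinset_card_le _).trans
      ((card_roots' Ψ.leadingCoeff).trans (hlc.trans (by omega))))
    refine Finset.card_le_card fun t ht => ?_
    rw [Finset.mem_filter] at ht
    rw [Multiset.mem_toFinset, mem_roots (leadingCoeff_ne_zero.2 h0), IsRoot, ← coe_aeval_eq_eval]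
    exact ht.2
  have hdiff : ‖∑ t, ψ t * (A t : ℂ) - ∑ t, ψ t * (B t : ℂ)‖ ≤ (e : ℝ) ^ 2 := by
    rw [← Finset.sum_sub_distrib]
    have h2 : ∀ t, ‖ψ t * (A t : ℂ) - ψ t * (B t : ℂ)‖ ≤
        if aeval t Ψ.leadingCoeff = 0 then (e : ℝ) else 0 := fun t => by
      rw [← mul_sub, norm_mul, AddChar.norm_apply, one_mul]
      split_ifs with h
      · have h3 : ((A t : ℂ) - B t) = (((A t : ℝ) - B t : ℝ) : ℂ) := by push_cast; rfl
        rw [h3, Complex.norm_real, Real.norm_eq_abs, abs_le]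
        have h4 : (A t : ℝ) ≤ e := by exact_mod_cast hAd t
        have h5 : (B t : ℝ) ≤ e := by exact_mod_cast hBd t
        have h6 : (0 : ℝ) ≤ A t := Nat.cast_nonneg _
        have h7 : (0 : ℝ) ≤ B t := Nat.cast_nonneg _
        constructor <;> linarith
      · rw [hABeq t h, sub_self, norm_zero]
    refine (norm_sum_le _ _).trans ((Finset.sum_le_sum fun t _ => h2 t).trans ?_)
    rw [← Finset.sum_filter, Finset.sum_const, nsmul_eq_mul, sq]
    gcongr
  have h2 := norm_le_norm_add_norm_sub' (∑ t, ψ t * (A t : ℂ)) (∑ t, ψ t * (B t : ℂ))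
  refine h2.trans (add_le_add (h1.trans ?_) hdiff)
  have hdr : (d : ℝ) ≤ e := by exact_mod_cast (by omega)
  have hre : ((r + 1 : ℕ) : ℝ) ≤ e + 1 := by exact_mod_cast (by omega)
  gcongr

end NonMonic

section Line

lemma two_mul_sum_shift {R : Type*} [CommRing R] (k : ℕ) :
    2 * ∑ i ∈ Finset.range k, (-((i + 1 : ℕ) : R)) = -(k * (k + 1)) := by
  induction k with
  | zero => simp
  | succ k ih =>
    rw [Finset.sum_range_succ, mul_add, ih]
    push_cast
    ring

lemma six_mul_sum_shift_sq {R : Type*} [CommRing R] (k : ℕ) :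
    6 * ∑ i ∈ Finset.range k, (-((i + 1 : ℕ) : R)) ^ 2 = k * (k + 1) * (2 * k + 1) := by
  induction k with
  | zero => simp
  | succ k ih =>
    rw [Finset.sum_range_succ, mul_add, ih]
    push_cast
    ring

variable {p : ℕ} [Fact p.Prime]

lemma natCast_ne_zero_of_lt {m : ℕ} (h0 : 0 < m) (h : m < p) : (m : ZMod p) ≠ 0 := by
  rw [Ne, ZMod.natCast_eq_zero_iff]
  exact fun h1 => absurd (Nat.le_of_dvd h0 h1) (by omega)

/-- The curve `shiftDiff k x y = 0` contains no line `y = z x + s`. -/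
lemma shiftDiff_line_ne_zero {k : ℕ} (hodd : Odd k) (hk : 1 < k) (hkp : k + 1 < p)
    (z s : ZMod p) : shiftDiff k (X : (ZMod p)[X]) (C z * X + C s) ≠ 0 := by
  classical
  intro h
  have hf := mul_shiftDiff k (X : (ZMod p)[X]) (C z * X + C s)
  rw [h, mul_zero, eq_comm, sub_eq_zero] at hf
  have hk0 : (k : ZMod p) ≠ 0 := natCast_ne_zero_of_lt (by omega) (by omega)
  have hev : ∀ x : ZMod p, shiftProd k x = shiftProd k (z * x + s) := fun x => by
    have := congrArg (evalRingHom x) hf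
    simpa [map_shiftProd] using this
  have hz0 : z ≠ 0 := by
    rintro rfl
    have := congrArg natDegree hf
    rw [natDegree_shiftProd_X, map_zero, zero_mul, zero_add, ← map_shiftProd, natDegree_C] at this
    omega
  obtain ⟨T, hT⟩ : ∃ T : Finset (ZMod p),
      T = (Finset.range k).image fun i => -((i + 1 : ℕ) : ZMod p) := ⟨_, rfl⟩
  have hinj : Set.InjOn (fun i : ℕ => -((i + 1 : ℕ) : ZMod p)) (Finset.range k) := by
    intro i hi j hj hij
    rw [Finset.coe_range, Set.mem_Iio] at hi hj
    have := (ZMod.natCast_eq_natCast_iff' _ _ _).1 (neg_injective hij)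
    rw [Nat.mod_eq_of_lt (by omega), Nat.mod_eq_of_lt (by omega)] at this
    omega
  have hTmem : ∀ x, x ∈ T ↔ shiftProd k x = 0 := fun x => by
    rw [hT, Finset.mem_image, shiftProd, Finset.prod_eq_zero_iff]
    refine exists_congr fun i => and_congr_right fun _ => ?_
    rw [neg_eq_iff_add_eq_zero, add_comm]
  have hσ : T.image (fun x => z * x + s) = T := by
    refine Finset.eq_of_subset_of_card_le (fun y hy => ?_) ?_
    · obtain ⟨x, hx, rfl⟩ := Finset.mem_image.1 hy
      rw [hTmem, ← hev, ← hTmem]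
      exact hx
    · rw [Finset.card_image_of_injective]
      intro x y hxy
      exact mul_left_cancel₀ hz0 (add_right_cancel hxy)
  have hsum : ∀ g : ZMod p → ZMod p, ∑ x ∈ T, g (z * x + s) = ∑ x ∈ T, g x := fun g => by
    conv_rhs => rw [← hσ]
    rw [Finset.sum_image]
    intro x _ y _ hxy
    exact mul_left_cancel₀ hz0 (add_right_cancel hxy)
  have hcard : (T.card : ZMod p) = k := by
    rw [hT, Finset.card_image_of_injOn hinj, Finset.card_range]
  have hS1 : 2 * ∑ x ∈ T, x = -((k : ZMod p) * (k + 1)) := by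
    rw [hT, Finset.sum_image hinj, two_mul_sum_shift]
  have hS2 : 6 * ∑ x ∈ T, x ^ 2 = (k : ZMod p) * (k + 1) * (2 * k + 1) := by
    rw [hT, Finset.sum_image hinj, six_mul_sum_shift_sq]
  have e1 := hsum fun x => x
  have e2 := hsum fun x => x ^ 2
  have e0 : ∑ x ∈ T, z * x = z * ∑ x ∈ T, x := (Finset.mul_sum _ _ _).symm
  simp only [add_sq, mul_pow, Finset.sum_add_distrib, ← Finset.mul_sum, Finset.sum_const,
    nsmul_eq_mul, hcard] at e1 e2
  have e3 : ∑ x ∈ T, 2 * (z * x) * s = 2 * z * s * ∑ x ∈ T, x := by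
    rw [Finset.mul_sum]
    exact Finset.sum_congr rfl fun x _ => by ring
  rw [e3] at e2
  rw [e0] at e1
  set S₁ := ∑ x ∈ T, x
  set S₂ := ∑ x ∈ T, x ^ 2
  have hvar : 12 * (k * S₂ - S₁ ^ 2) =
      (k : ZMod p) ^ 2 * ((k + 1 : ℕ) * ((k - 1 : ℕ) : ZMod p)) := by
    rw [Nat.cast_sub (by omega)]
    push_cast
    linear_combination 2 * (k : ZMod p) * hS2 - 3 * (2 * S₁ - ((k : ZMod p) * (k + 1))) * hS1
  have hvar0 : k * S₂ - S₁ ^ 2 ≠ 0 := by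
    intro h0
    rw [h0, mul_zero, eq_comm] at hvar
    exact mul_ne_zero (pow_ne_zero 2 hk0) (mul_ne_zero (natCast_ne_zero_of_lt (by omega) hkp)
      (natCast_ne_zero_of_lt (by omega) (by omega))) hvar
  have hz2 : z ^ 2 = 1 := by
    refine sub_eq_zero.1 ((mul_eq_zero.1 ?_).resolve_right hvar0)
    linear_combination (k : ZMod p) * e2 - (z * S₁ + k * s + S₁) * e1
  have hzk : z ^ k = 1 := by
    have := congrArg leadingCoeff hf
    rw [monic_shiftProd_X, shiftProd, leadingCoeff_prod, Finset.prod_congr rfl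
      (g := fun _ => z), Finset.prod_const, Finset.card_range] at this
    · exact this.symm
    · intro i _
      rw [← C_eq_natCast, add_assoc, ← C_add, leadingCoeff_linear hz0]
  have hz1 : z = 1 := by
    obtain ⟨j, rfl⟩ := hodd
    rw [pow_succ, pow_mul, hz2, one_pow, one_mul] at hzk
    exact hzk
  subst hz1
  have hs : s = 0 := by
    have : (k : ZMod p) * s = 0 := by linear_combination e1
    exact (mul_eq_zero.1 this).resolve_left hk0
  subst hs
  rw [map_one, one_mul, map_zero, add_zero, shiftDiff_self_X] at h
  have := congrArg (fun f => coeff f (k - 1)) h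
  simp only [coeff_derivative, coeff_zero] at this
  have hc : (shiftProd k (X : (ZMod p)[X])).coeff (k - 1 + 1) = 1 := by
    rw [Nat.sub_add_cancel (by omega)]
    have := monic_shiftProd_X (R := ZMod p) k
    rwa [Monic, leadingCoeff, natDegree_shiftProd_X] at this
  rw [hc, one_mul, Nat.cast_sub (by omega)] at this
  refine hk0 ?_
  simpa using this

lemma norm_sum_diag_le {ψ : AddChar (ZMod p) ℂ} (hψ : ψ ≠ 0) {k : ℕ} (hodd : Odd k) (hk : 1 < k)
    (hkp : k + 1 < p) (hsq : k ^ 2 ≤ p) {a b : ZMod p} (hab : (a, b) ≠ 0) :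
    ‖∑ P ∈ Finset.univ.filter (fun P : ZMod p × ZMod p => shiftDiff k P.1 P.2 = 0),
      ψ (a * P.1 + b * P.2)‖ ≤ 6 * k ^ 3 * √p + k ^ 2 := by
  wlog hb : b ≠ 0 generalizing a b
  · push Not at hb
    subst hb
    have ha : a ≠ 0 := by
      rintro rfl
      exact hab rfl
    refine le_trans (le_of_eq ?_) (this (a := 0) (b := a) (by simpa using ha) ha)
    congr 1
    refine Finset.sum_equiv (Equiv.prodComm _ _) (fun P => ?_) fun P _ => ?_
    · simp [shiftDiff_comm k P.1 P.2]
    · simp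
  have h1 := sum_fibers_equiv ψ (Finset.univ.filter
    (fun P : ZMod p × ZMod p => shiftDiff k P.1 P.2 = 0)) (lineEquiv a b hb)
  simp only [lineEquiv, Equiv.coe_fn_mk, Equiv.coe_fn_symm_mk, Finset.mem_filter,
    Finset.mem_univ, true_and] at h1
  rw [h1]
  set Ψ : (ZMod p)[X][X] := shiftDiff k X (linePoly a b) with hΨ
  have hev : ∀ t y : ZMod p, evalPt (ZMod p) t y Ψ = 0 ↔
      shiftDiff k y ((t - a * y) / b) = 0 := fun t y => by
    rw [hΨ, map_shiftDiff, evalPt_X, evalPt_linePoly]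
  have hmem : Ψ ∈ ((RingFilt.deg (ZMod p)).poly 1).F ((k - 1 : ℕ) : ℤ) := by
    have := RingFilt.shiftDiff_mem _ (RingFilt.X_mem_poly (RingFilt.deg (ZMod p)) 1)
      (linePoly_mem a b) k
    rwa [Nat.cast_sub (by omega), Nat.cast_one]
  have hne : ∀ t : ZMod p, Ψ.map
      ((aeval t : (ZMod p)[X] →ₐ[ZMod p] ZMod p) : (ZMod p)[X] →+* ZMod p) ≠ 0 := fun t => by
    have := shiftDiff_line_ne_zero hodd hk hkp (-(a / b)) (t / b)
    rw [← coe_mapRingHom, hΨ, map_shiftDiff, coe_mapRingHom, map_X]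
    convert this using 2
    simp only [linePoly, Polynomial.map_sub, Polynomial.map_mul, map_C, map_X,
      map_mul, aeval_C, aeval_X, RingHom.coe_coe, Algebra.algebraMap_self, RingHom.id_apply,
      map_neg, div_eq_mul_inv]
    ring
  have h2 := norm_sum_points_le_of_mem hψ hmem hne
    ((Nat.pow_le_pow_left (Nat.sub_le k 1) 2).trans hsq) (by omega)
  simp only [hev] at h2
  refine h2.trans ?_
  have hk1 : ((k - 1 : ℕ) : ℝ) = k - 1 := by
    rw [Nat.cast_sub (by omega), Nat.cast_one]
  have hkr : (1 : ℝ) ≤ k := by exact_mod_cast hk.le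
  rw [hk1]
  have h3 : (k - 1 : ℝ) ^ 2 ≤ k ^ 2 := by
    apply pow_le_pow_left₀ <;> linarith
  calc 6 * ((k : ℝ) - 1 + 1) * (k - 1) ^ 2 * √p + (k - 1) ^ 2
      ≤ 6 * ((k : ℝ) - 1 + 1) * k ^ 2 * √p + k ^ 2 := by
        gcongr
    _ = _ := by ring

end Line

section Collisions

lemma sq_card_le_card_mul_collisions {α β : Type*} [DecidableEq β] (W : Finset α)
    (R : Finset β) (f : α → β) (hf : ∀ w ∈ W, f w ∈ R) :
    W.card ^ 2 ≤ R.card * ((W ×ˢ W).filter fun w => f w.1 = f w.2).card := by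
  rw [Finset.card_eq_sum_card_fiberwise hf]
  refine (sq_sum_le_card_mul_sum_sq).trans (Nat.mul_le_mul_left _ (le_of_eq ?_))
  rw [Finset.card_eq_sum_card_fiberwise (f := fun w => f w.1) (t := R)
    (fun w hw => hf _ (Finset.mem_product.1 (Finset.mem_filter.1 hw).1).1)]
  refine Finset.sum_congr rfl fun r _ => ?_
  rw [sq, ← Finset.card_product]
  congr 1
  ext w
  simp only [Finset.mem_product, Finset.mem_filter]
  constructor
  · rintro ⟨⟨h1, h2⟩, h3, h4⟩
    exact ⟨⟨⟨h1, h3⟩, h2.trans h4.symm⟩, h2⟩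
  · rintro ⟨⟨⟨h1, h3⟩, h2⟩, h4⟩
    exact ⟨⟨h1, h4⟩, h3, h2 ▸ h4⟩

variable {p : ℕ} [Fact p.Prime]

/-- The number of `u, v < N` such that the product of the `k` elements following `x₀ + u` is the
product of the `l` elements following `x₀ + v`. -/
def shiftCollisions (x₀ : ZMod p) (N k l : ℕ) : ℕ :=
  ((Finset.range N ×ˢ Finset.range N).filter fun u =>
    shiftProd k (x₀ + (u.1 : ZMod p)) = shiftProd l (x₀ + (u.2 : ZMod p))).card

lemma shiftCollisions_comm (x₀ : ZMod p) (N k l : ℕ) :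
    shiftCollisions x₀ N k l = shiftCollisions x₀ N l k := by
  refine Finset.card_equiv (Equiv.prodComm _ _) fun u => ?_
  simp [and_comm, eq_comm]

lemma sq_card_mul_le_sum_shiftCollisions (x₀ : ZMod p) (N M : ℕ) (hMN : M ≤ N) (K : Finset ℕ)
    (R : Finset (ZMod p)) (hR : ∀ k ∈ K, ∀ u < M, shiftProd k (x₀ + (u : ZMod p)) ∈ R) :
    (K.card * M) ^ 2 ≤ R.card * ∑ P ∈ K ×ˢ K, shiftCollisions x₀ N P.1 P.2 := by
  have h := sq_card_le_card_mul_collisions (K ×ˢ Finset.range M) R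
    (fun w => shiftProd w.1 (x₀ + (w.2 : ZMod p))) fun w hw => by
      rw [Finset.mem_product, Finset.mem_range] at hw
      exact hR _ hw.1 _ hw.2
  rw [Finset.card_product, Finset.card_range] at h
  refine h.trans (Nat.mul_le_mul_left _ ?_)
  rw [Finset.card_eq_sum_card_fiberwise (f := fun w => (w.1.1, w.2.1)) (t := K ×ˢ K)]
  · refine Finset.sum_le_sum fun P _ => ?_
    refine Finset.card_le_card_of_injOn (fun w => (w.1.2, w.2.2)) (fun w hw => ?_) ?_
    · simp only [Finset.coe_filter, Finset.mem_filter, Finset.mem_product, Finset.mem_range,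
        Set.mem_ofPred_eq] at hw ⊢
      obtain ⟨⟨⟨⟨_, h2⟩, _, h4⟩, h5⟩, rfl⟩ := hw
      exact ⟨⟨h2.trans_le hMN, h4.trans_le hMN⟩, h5⟩
    · rintro ⟨⟨a, b⟩, c, d⟩ hw ⟨⟨a', b'⟩, c', d'⟩ hw' he
      have h1 := (Finset.mem_filter.1 hw).2
      have h2 := (Finset.mem_filter.1 hw').2
      simp only [Prod.mk.injEq] at he ⊢
      have h3 := h1.trans h2.symm
      simp only [Prod.mk.injEq] at h3
      exact ⟨⟨h3.1, he.1⟩, h3.2, he.2⟩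
  · intro w hw
    have := (Finset.mem_filter.1 hw).1
    simp only [Finset.mem_product] at this
    exact Finset.mem_product.2 ⟨this.1.1, this.2.1⟩

lemma stdAddChar_ne_zero : (ZMod.stdAddChar : AddChar (ZMod p) ℂ) ≠ 0 := by
  have := ZMod.isPrimitive_stdAddChar p one_ne_zero
  rwa [AddChar.mulShift_one] at this

lemma four_mul_sq_mul_card_le {N k c : ℕ} (h : c ≤ p * k) :
    4 * ((N : ℝ) / p) ^ 2 * c ≤ 4 * N ^ 2 * k / p := by
  have hp : (0 : ℝ) < p := by exact_mod_cast (Fact.out : p.Prime).pos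
  have h1 : (c : ℝ) ≤ p * k := by exact_mod_cast h
  calc 4 * ((N : ℝ) / p) ^ 2 * c ≤ 4 * ((N : ℝ) / p) ^ 2 * (p * k) := by gcongr
    _ = _ := by
      field_simp

lemma shiftCollisions_le_of_lt (x₀ : ZMod p) {N k l : ℕ} (h0 : 0 < N) (hN : N ≤ p) (hl : 1 ≤ l)
    (hlk : l < k) (hkl : k ≤ 2 * l) (hsq : k ^ 2 ≤ p) (hkp : k < p) :
    (shiftCollisions x₀ N k l : ℝ) ≤ 4 * N ^ 2 * k / p + 48 * k ^ 2 * √p := by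
  have hψ := ZMod.isPrimitive_stdAddChar p
  have hψ0 := stdAddChar_ne_zero (p := p)
  have h := card_filter_box_le hψ (Finset.univ.filter fun P : ZMod p × ZMod p =>
    shiftProd k P.1 = shiftProd l P.2) x₀ h0 hN
    fun a b hab => norm_sum_offDiag_le hψ0 hl hlk hkl hsq hkp hab
  simp only [Finset.mem_filter, Finset.mem_univ, true_and] at h
  have h2 := four_mul_sq_mul_card_le (N := N)
    (card_offDiag_le (p := p) (k := k) (l := l) (by omega))
  rw [shiftCollisions]
  linarith

lemma shiftCollisions_self_le (x₀ : ZMod p) {N k : ℕ} (h0 : 0 < N) (hN : N ≤ p) (hodd : Odd k)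
    (hk : 1 < k) (hkp : k + 1 < p) (hsq : k ^ 2 ≤ p) :
    (shiftCollisions x₀ N k k : ℝ) ≤ N + 4 * N ^ 2 * k / p + 4 * (6 * k ^ 3 * √p + k ^ 2) := by
  have hψ := ZMod.isPrimitive_stdAddChar p
  have hψ0 := stdAddChar_ne_zero (p := p)
  have h := card_filter_box_le hψ (Finset.univ.filter fun P : ZMod p × ZMod p =>
    shiftDiff k P.1 P.2 = 0) x₀ h0 hN
    fun a b hab => norm_sum_diag_le hψ0 hodd hk hkp hsq hab
  simp only [Finset.mem_filter, Finset.mem_univ, true_and] at h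
  have hsub : (Finset.univ.filter fun P : ZMod p × ZMod p => shiftDiff k P.1 P.2 = 0) ⊆
      Finset.univ.filter fun P : ZMod p × ZMod p => shiftProd k P.1 = shiftProd k P.2 := by
    refine Finset.monotone_filter_right _ fun P _ hP => ?_
    rw [← sub_eq_zero, ← mul_shiftDiff, hP, mul_zero]
  have h2 := four_mul_sq_mul_card_le (N := N)
    ((Finset.card_le_card hsub).trans (card_offDiag_le (p := p) (k := k) (l := k) (by omega)))
  have h3 : shiftCollisions x₀ N k k ≤ N + ((Finset.range N ×ˢ Finset.range N).filter fun u =>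
      shiftDiff k (x₀ + (u.1 : ZMod p)) (x₀ + (u.2 : ZMod p)) = 0).card := by
    have h4 : ((Finset.range N).image fun u => (u, u)).card ≤ N :=
      Finset.card_image_le.trans (Finset.card_range N).le
    refine le_trans ?_ (Nat.add_le_add_right h4 _)
    refine le_trans (Finset.card_le_card fun u hu => ?_) (Finset.card_union_le _ _)
    rw [Finset.mem_filter, Finset.mem_product, Finset.mem_range, Finset.mem_range] at hu
    obtain ⟨⟨hu1, hu2⟩, hu3⟩ := hu
    rw [Finset.mem_union]
    by_cases he : u.1 = u.2
    · exact Or.inl (Finset.mem_image.2 ⟨u.1, Finset.mem_range.2 hu1, Prod.ext rfl he⟩)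
    · right
      rw [Finset.mem_filter, Finset.mem_product, Finset.mem_range, Finset.mem_range]
      refine ⟨⟨hu1, hu2⟩, ?_⟩
      have := mul_shiftDiff k (x₀ + (u.1 : ZMod p)) (x₀ + (u.2 : ZMod p))
      rw [hu3, sub_self] at this
      refine (mul_eq_zero.1 this).resolve_left fun h5 => he ?_
      have h6 := (ZMod.natCast_eq_natCast_iff' _ _ _).1 (add_left_cancel (sub_eq_zero.1 h5))
      rwa [Nat.mod_eq_of_lt (by omega), Nat.mod_eq_of_lt (by omega)] at h6
  have h4 : (shiftCollisions x₀ N k k : ℝ) ≤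
      N + (((Finset.range N ×ˢ Finset.range N).filter fun u =>
      shiftDiff k (x₀ + (u.1 : ZMod p)) (x₀ + (u.2 : ZMod p)) = 0).card : ℝ) := by
    exact_mod_cast h3
  linarith

lemma factorial_mul_shiftProd {R : Type*} [CommRing R] (n k : ℕ) :
    (n.factorial : R) * shiftProd k (n : R) = ((n + k).factorial : R) := by
  induction k with
  | zero => simp [shiftProd]
  | succ k ih =>
    rw [shiftProd_succ, ← mul_assoc, ih, ← add_assoc, Nat.factorial_succ]
    push_cast
    ring

lemma shiftProd_mem_intervalFactorialsRatio {L N n k : ℕ} (hL : L + 1 ≤ n) (hn : n + k ≤ L + N)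
    (hp : L + N < p) : shiftProd k (n : ZMod p) ∈ intervalFactorialsRatio p L N := by
  have h0 : (n.factorial : ZMod p) ≠ 0 := by
    rw [Ne, ZMod.natCast_eq_zero_iff, (Fact.out : p.Prime).dvd_factorial]
    omega
  refine Finset.mem_image₂.2 ⟨((n + k).factorial : ZMod p), ?_, (n.factorial : ZMod p), ?_, ?_⟩
  · exact Finset.mem_image_of_mem _ (Finset.mem_Icc.2 ⟨by omega, hn⟩)
  · exact Finset.mem_image_of_mem _ (Finset.mem_Icc.2 ⟨hL, by omega⟩)
  · rw [← factorial_mul_shiftProd, mul_comm, inv_mul_cancel_left₀ h0]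

/-- The odd numbers between `2 * H` and `4 * H`. -/
def oddBlock (H : ℕ) : Finset ℕ := (Finset.Ico H (2 * H)).image fun h => 2 * h + 1

lemma card_oddBlock (H : ℕ) : (oddBlock H).card = H := by
  rw [oddBlock, Finset.card_image_of_injective _ fun a b h => by simpa using h, Nat.card_Ico]
  omega

lemma of_mem_oddBlock {H k : ℕ} (hk : k ∈ oddBlock H) : Odd k ∧ 2 * H < k ∧ k < 4 * H := by
  obtain ⟨h, hh, rfl⟩ := Finset.mem_image.1 hk
  rw [Finset.mem_Ico] at hh
  exact ⟨⟨h, rfl⟩, by omega, by omega⟩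

lemma sum_shiftCollisions_oddBlock_le (x₀ : ZMod p) {N H : ℕ} (hH : 1 ≤ H) (hN : N ≤ p)
    (h1 : 480 * (H : ℝ) ^ 3 * √p ≤ N) (h2 : 100 * ((N : ℝ) * H ^ 2) ≤ p) :
    ∑ P ∈ oddBlock H ×ˢ oddBlock H, (shiftCollisions x₀ N P.1 P.2 : ℝ) ≤ 7 * N * H := by
  have hp2 := (Fact.out : p.Prime).two_le
  have hp : (0 : ℝ) < p := by exact_mod_cast (by omega : 0 < p)
  have hHr : (1 : ℝ) ≤ H := by exact_mod_cast hH
  have hsp : (1 : ℝ) ≤ √p := Real.one_le_sqrt.2 (by exact_mod_cast (by omega : 1 ≤ p))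
  have hss : √p * √p = (p : ℝ) := Real.mul_self_sqrt hp.le
  have hNp : (N : ℝ) ≤ p := by exact_mod_cast hN
  have hH3 : (1 : ℝ) ≤ (H : ℝ) ^ 3 := one_le_pow₀ hHr
  have hH23 : (H : ℝ) ^ 2 ≤ (H : ℝ) ^ 3 := pow_le_pow_right₀ hHr (by norm_num)
  have hH13 : (H : ℝ) ≤ (H : ℝ) ^ 3 := le_self_pow₀ hHr (by norm_num)
  have hN0 : (0 : ℝ) < N := lt_of_lt_of_le (by positivity) h1
  have h0 : 0 < N := by exact_mod_cast hN0
  have h3 : 480 * (H : ℝ) ^ 3 ≤ √p := by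
    refine le_of_mul_le_mul_right ?_ (by linarith : 0 < √(p : ℝ))
    rw [hss]
    linarith
  have h4 : 16 * (H : ℝ) ^ 2 ≤ p := by nlinarith
  have h5 : 4 * (H : ℝ) < p := by nlinarith
  have hoff : ∀ {k l}, k ∈ oddBlock H → l ∈ oddBlock H → l < k →
      (shiftCollisions x₀ N k l : ℝ) ≤ 16 * N ^ 2 * H / p + 768 * H ^ 2 * √p := by
    intro k l hk hl hlk
    obtain ⟨-, hk1, hk2⟩ := of_mem_oddBlock hk
    obtain ⟨-, hl1, hl2⟩ := of_mem_oddBlock hl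
    have hkr : (k : ℝ) ≤ 4 * H := by exact_mod_cast hk2.le
    have hksq : (k : ℝ) ^ 2 ≤ (4 * H) ^ 2 := by gcongr
    have := shiftCollisions_le_of_lt x₀ h0 hN (by omega) hlk (by omega)
      (by exact_mod_cast (by linarith : (k : ℝ) ^ 2 ≤ p)) (by exact_mod_cast hkr.trans_lt h5)
    refine this.trans ?_
    calc 4 * (N : ℝ) ^ 2 * k / p + 48 * k ^ 2 * √p
        ≤ 4 * (N : ℝ) ^ 2 * (4 * H) / p + 48 * (4 * H) ^ 2 * √p := by gcongr
      _ = _ := by ring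
  have hdiag : ∀ {k}, k ∈ oddBlock H → (shiftCollisions x₀ N k k : ℝ) ≤
      N + 16 * N ^ 2 * H / p + 1536 * H ^ 3 * √p + 64 * H ^ 2 := by
    intro k hk
    obtain ⟨hodd, hk1, hk2⟩ := of_mem_oddBlock hk
    have hkr : (k : ℝ) ≤ 4 * H := by exact_mod_cast hk2.le
    have hksq : (k : ℝ) ^ 2 ≤ (4 * H) ^ 2 := by gcongr
    have h5' : 4 * H < p := by exact_mod_cast h5
    have := shiftCollisions_self_le x₀ h0 hN hodd (by omega) (by omega)
      (by exact_mod_cast (by linarith : (k : ℝ) ^ 2 ≤ p))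
    refine this.trans ?_
    calc (N : ℝ) + 4 * N ^ 2 * k / p + 4 * (6 * k ^ 3 * √p + k ^ 2)
        ≤ (N : ℝ) + 4 * N ^ 2 * (4 * H) / p + 4 * (6 * (4 * H) ^ 3 * √p + (4 * H) ^ 2) := by gcongr
      _ = _ := by ring
  have hle : ∀ P ∈ oddBlock H ×ˢ oddBlock H, (shiftCollisions x₀ N P.1 P.2 : ℝ) ≤
      (16 * N ^ 2 * H / p + 768 * H ^ 2 * √p) +
        if P.1 = P.2 then (N + 16 * N ^ 2 * H / p + 1536 * H ^ 3 * √p + 64 * H ^ 2 : ℝ) else 0 := by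
    rintro ⟨k, l⟩ hP
    rw [Finset.mem_product] at hP
    dsimp only at hP ⊢
    have hnn : (0 : ℝ) ≤ 16 * N ^ 2 * H / p + 768 * H ^ 2 * √p := by positivity
    split_ifs with h
    · subst h
      have := hdiag hP.1
      linarith
    · rw [add_zero]
      rcases lt_or_gt_of_ne h with h | h
      · rw [shiftCollisions_comm]
        exact hoff hP.2 hP.1 h
      · exact hoff hP.1 hP.2 h
  refine (Finset.sum_le_sum hle).trans ?_
  rw [Finset.sum_add_distrib, Finset.sum_const, Finset.card_product, Finset.sum_product]
  simp only [Finset.sum_ite_eq]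
  rw [Finset.sum_congr rfl
    (g := fun _ => (N + 16 * N ^ 2 * H / p + 1536 * H ^ 3 * √p + 64 * H ^ 2 : ℝ))
    (fun k hk => if_pos hk), Finset.sum_const, card_oddBlock, nsmul_eq_mul,
    nsmul_eq_mul, Nat.cast_mul]
  have h6 : 100 * ((N : ℝ) ^ 2 * H ^ 2 / p) ≤ N := by
    rw [mul_div_assoc', div_le_iff₀ hp]
    nlinarith
  have h7 : (N : ℝ) ^ 2 * H / p ≤ (N : ℝ) ^ 2 * H ^ 2 / p := by
    gcongr
    exact le_self_pow₀ hHr (by norm_num)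
  have h8 : 480 * (H : ℝ) ^ 2 ≤ N := by nlinarith
  have h9 : 16 * ((N : ℝ) ^ 2 * H ^ 2 / p) + 768 * (H ^ 3 * √p) +
      (N + 16 * (N ^ 2 * H / p) + 1536 * (H ^ 3 * √p) + 64 * H ^ 2) ≤ 7 * N := by
    linarith
  calc _ = H * (16 * ((N : ℝ) ^ 2 * H ^ 2 / p) + 768 * (H ^ 3 * √p) +
      (N + 16 * (N ^ 2 * H / p) + 1536 * (H ^ 3 * √p) + 64 * H ^ 2)) := by ring
    _ ≤ H * (7 * N) := by gcongr
    _ = _ := by ring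

lemma mul_le_card_intervalFactorialsRatio {L N H : ℕ} (hH : 1 ≤ H) (hp : L + N < p)
    (h1 : 480 * (H : ℝ) ^ 3 * √p ≤ N) (h2 : 100 * ((N : ℝ) * H ^ 2) ≤ p) :
    (H : ℝ) * N ≤ 28 * (intervalFactorialsRatio p L N).card := by
  have hHr : (1 : ℝ) ≤ H := by exact_mod_cast hH
  have hsp : (1 : ℝ) ≤ √p := Real.one_le_sqrt.2
    (by exact_mod_cast (Fact.out : p.Prime).one_lt.le)
  have hH13 : (H : ℝ) ≤ (H : ℝ) ^ 3 := le_self_pow₀ hHr (by norm_num)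
  have hN0 : (0 : ℝ) < N := lt_of_lt_of_le (by positivity) h1
  have h8 : 8 * (H : ℝ) ≤ N := by nlinarith
  have h8' : 8 * H ≤ N := by exact_mod_cast h8
  have hcs := sq_card_mul_le_sum_shiftCollisions ((L + 1 : ℕ) : ZMod p) N (N - 4 * H) (by omega)
    (oddBlock H) (intervalFactorialsRatio p L N) fun k hk u hu => by
      obtain ⟨-, hk1, hk2⟩ := of_mem_oddBlock hk
      rw [← Nat.cast_add]
      exact shiftProd_mem_intervalFactorialsRatio (by omega) (by omega) hp
  rw [card_oddBlock] at hcs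
  have hsum := sum_shiftCollisions_oddBlock_le ((L + 1 : ℕ) : ZMod p) hH (by omega) h1 h2
  have hcs' : ((H : ℝ) * ((N - 4 * H : ℕ) : ℝ)) ^ 2 ≤
      (intervalFactorialsRatio p L N).card * (7 * N * H) := by
    refine le_trans (by exact_mod_cast hcs) (mul_le_mul_of_nonneg_left hsum (Nat.cast_nonneg _))
  rw [Nat.cast_sub (by omega)] at hcs'
  push_cast at hcs'
  have h9 : ((H : ℝ) * (N / 2)) ^ 2 ≤ (H * (N - 4 * H)) ^ 2 := by
    gcongr
    linarith
  refine le_of_mul_le_mul_right ?_ (by positivity : (0 : ℝ) < N * H / 4)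
  linarith

end Collisions

/-- **Theorem 2, Case 5.** If `c₅·√p·(log p)² ≤ N ≤ c₄·p^{4/5}·(log p)^{4/5}` then
`|A_N / A_N| ≥ c·N·Q^{1/3}` where `Q = N/(√p·(log p)²)`. -/
theorem card_intervalFactorialsRatio_ge_case5 :
    ∃ c c₄ c₅ : ℝ, c > 0 ∧ c₄ > 0 ∧ c₅ > 0 ∧ ∀ p L N : ℕ, p.Prime →
      0 < L + 1 → L + 1 < L + N → L + N < p →
      c₅ * Real.sqrt p * (Real.log p) ^ 2 ≤ (N : ℝ) →
      (N : ℝ) ≤ c₄ * (p : ℝ) ^ ((4 : ℝ) / 5) * (Real.log p) ^ ((4 : ℝ) / 5) →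
      ((intervalFactorialsRatio p L N).card : ℝ) ≥
        c * (N : ℝ) * ((N : ℝ) / (Real.sqrt p * (Real.log p) ^ 2)) ^ ((1 : ℝ) / 3) := by
  refine ⟨1 / 560, 1, 1000, by norm_num, by norm_num, by norm_num, ?_⟩
  intro p L N hpp _ _ hLN hlow hup
  have : Fact p.Prime := ⟨hpp⟩
  have hp : (0 : ℝ) < p := by exact_mod_cast hpp.pos
  have hsp : 0 < √(p : ℝ) := Real.sqrt_pos.2 hp
  have hlog : 0.693 ≤ Real.log p := by
    have h1 : Real.log 2 ≤ Real.log p :=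
      Real.log_le_log two_pos (by exact_mod_cast hpp.two_le)
    have := Real.log_two_gt_d9
    linarith
  have hlog0 : 0 < Real.log p := by linarith
  have hlogsq : 0.48 ≤ Real.log p ^ 2 := by nlinarith
  obtain ⟨S, hS⟩ : ∃ S, S = √(p : ℝ) * Real.log p ^ 2 := ⟨_, rfl⟩
  have hS0 : 0 < S := by
    rw [hS]
    positivity
  have hSsq : S ^ 2 = p * Real.log p ^ 4 := by
    rw [hS, mul_pow, Real.sq_sqrt hp.le]
    ring
  rw [mul_assoc, ← hS] at hlow
  rw [← hS]
  obtain ⟨q, hq⟩ : ∃ q, q = ((N : ℝ) / S) ^ ((1 : ℝ) / 3) := ⟨_, rfl⟩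
  have hQ : 1000 ≤ (N : ℝ) / S := (le_div_iff₀ hS0).2 hlow
  have hq0 : 0 ≤ q := by
    rw [hq]
    positivity
  have hq3 : q ^ 3 = N / S := by
    rw [hq, ← Real.rpow_natCast, ← Real.rpow_mul (by positivity)]
    norm_num
  have hq10 : 10 ≤ q := by
    refine le_of_pow_le_pow_left₀ (n := 3) (by norm_num) hq0 ?_
    rw [hq3]
    linarith
  rw [← hq]
  have hH1 := Nat.floor_le (by positivity : 0 ≤ q / 10)
  have hH2 := Nat.lt_floor_add_one (q / 10)
  have hH : 1 ≤ ⌊q / 10⌋₊ := Nat.le_floor (by rw [Nat.cast_one]; linarith)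
  set H := ⌊q / 10⌋₊
  have hHr : (1 : ℝ) ≤ H := by exact_mod_cast hH
  have hcube : 1000 * (H : ℝ) ^ 3 * S ≤ N := by
    have h1 : (H : ℝ) ^ 3 ≤ (q / 10) ^ 3 := by gcongr
    have h2 : (q / 10) ^ 3 * 1000 = N / S := by rw [← hq3]; ring
    rw [← le_div_iff₀ hS0]
    linarith
  have h1 : 480 * (H : ℝ) ^ 3 * √p ≤ N := by
    have h3 : 0 ≤ (H : ℝ) ^ 3 * √p := by positivity
    rw [hS] at hcube
    nlinarith
  have hN5 : (N : ℝ) ^ 5 ≤ p ^ 4 * Real.log p ^ 4 := by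
    rw [one_mul, ← Real.mul_rpow hp.le hlog0.le] at hup
    calc (N : ℝ) ^ 5 ≤ (((p : ℝ) * Real.log p) ^ ((4 : ℝ) / 5)) ^ 5 := by gcongr
      _ = ((p : ℝ) * Real.log p) ^ (4 : ℝ) := by
        rw [← Real.rpow_natCast, ← Real.rpow_mul (by positivity)]
        norm_num
      _ = p ^ 4 * Real.log p ^ 4 := by
        rw [← mul_pow]
        exact_mod_cast Real.rpow_natCast _ 4
  have h2 : 100 * ((N : ℝ) * H ^ 2) ≤ p := by
    refine le_of_pow_le_pow_left₀ (n := 3) (by norm_num) hp.le ?_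
    refine le_of_mul_le_mul_right ?_ (by positivity : (0 : ℝ) < p * Real.log p ^ 4)
    calc (100 * ((N : ℝ) * H ^ 2)) ^ 3 * (p * Real.log p ^ 4)
        = (N : ℝ) ^ 3 * (1000 * H ^ 3 * S) ^ 2 := by
          rw [← hSsq]
          ring
      _ ≤ (N : ℝ) ^ 3 * N ^ 2 := by gcongr
      _ ≤ p ^ 4 * Real.log p ^ 4 := by
          rw [← pow_add]
          exact hN5
      _ = _ := by ring
  have := mul_le_card_intervalFactorialsRatio hH hLN h1 h2
  have h3 : q / 20 * N ≤ H * N := by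
    gcongr
    linarith
  linarith
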